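/- arXiv:1509.07428 — 5 statements merged into one kernel-verified Lean document; each statement's English description precedes it below -/
import Mathlib

section
/- Let X be an infinite-dimensional complex Banach space and let T ∈ L(X) be a bounded linear operator. If T has at most countably many eigenvalues (i.e. σ_p(T) is countable), then T admits an almost-invariant halfspace of defect ≤ 1. -/
/-- A halfspace of a Banach space `X`: a closed subspace of infinite dimension
and infinite codimension. -/
def IsHalfspace {X : Type*} [NormedAddCommGroup X] [NormedSpace ℂ X]
    (Y : Submodule ℂ X) : Prop :=
  IsClosed (Y : Set X) ∧ ¬FiniteDimensional ℂ Y ∧ ¬FiniteDimensional ℂ (X ⧸ Y)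

/-- `T` admits an almost-invariant halfspace of defect at most 1:
there are a halfspace `Y` and a subspace `E` with `dim E ≤ 1` such that `T Y ⊆ Y + E`. -/
def HasAIHS1 {X : Type*} [NormedAddCommGroup X] [NormedSpace ℂ X]
    (T : X →L[ℂ] X) : Prop :=
  ∃ Y : Submodule ℂ X, IsHalfspace Y ∧
    ∃ E : Submodule ℂ X, FiniteDimensional ℂ E ∧ Module.finrank ℂ E ≤ 1 ∧
      ∀ y ∈ Y, T y ∈ Y ⊔ E

namespace AlmostInvariant

open Filter Topology Set

universe u

theorem not_finiteDimensional_of_biorthogonal {V : Type*} [AddCommGroup V] [Module ℂ V]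
    (g : ℕ → V →ₗ[ℂ] ℂ) (v : ℕ → V) (h : ∀ i j, g i (v j) = if i = j then 1 else 0) :
    ¬FiniteDimensional ℂ V := by
  intro hV
  have hli : LinearIndependent ℂ v := by
    rw [linearIndependent_iff']
    intro s c hc i hi
    have := congrArg (g i) hc
    simpa [map_sum, h, hi] using this
  have := hli.finite_of_isNoetherian
  exact not_finite ℕ

section Halfspace

variable {X : Type*} [NormedAddCommGroup X] [NormedSpace ℂ X]

theorem isHalfspace_of_biorthogonal {Y : Submodule ℂ X} (hY : IsClosed (Y : Set X))
    (g g' : ℕ → X →L[ℂ] ℂ) (v v' : ℕ → X)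
    (h : ∀ i j, g i (v j) = if i = j then 1 else 0)
    (hmk : ∀ i j, g' i (v' j) = if i = j then 1 else 0)
    (hv : ∀ j, v j ∈ Y) (hg' : ∀ i, ∀ y ∈ Y, g' i y = 0) : IsHalfspace Y := by
  refine ⟨hY, ?_, ?_⟩
  · exact not_finiteDimensional_of_biorthogonal
      (fun i => (g i : X →ₗ[ℂ] ℂ).comp Y.subtype) (fun j => ⟨v j, hv j⟩) (by simpa using h)
  · exact not_finiteDimensional_of_biorthogonal
      (fun i => Y.liftQ (g' i : X →ₗ[ℂ] ℂ) fun y hy => hg' i y hy)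
      (fun j => Y.mkQ (v' j)) hmk

/-- The common kernel of every other functional of a biorthogonal system. -/
theorem isHalfspace_iInf_ker (s : ℕ → X →L[ℂ] ℂ) (y : ℕ → X)
    (h : ∀ i j, s i (y j) = if i = j then 1 else 0) :
    IsHalfspace (⨅ n, LinearMap.ker (s (2 * n) : X →ₗ[ℂ] ℂ)) := by
  refine isHalfspace_of_biorthogonal ?_ (fun i => s (2 * i + 1)) (fun i => s (2 * i))
    (fun i => y (2 * i + 1)) (fun i => y (2 * i)) ?_ ?_ ?_ ?_
  · rw [Submodule.coe_iInf]
    exact isClosed_iInter fun n => (s (2 * n)).isClosed_ker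
  · intro i j; simp [h]
  · intro i j; simp [h]
  · intro j
    simp only [Submodule.mem_iInf, LinearMap.mem_ker, ContinuousLinearMap.coe_coe, h]
    intro i; rw [if_neg (by omega)]
  · intro i z hz
    simpa using (Submodule.mem_iInf _).1 hz i

/-- The closed span of every other vector of a biorthogonal system. -/
theorem isHalfspace_closure_span (s : ℕ → X →L[ℂ] ℂ) (y : ℕ → X)
    (h : ∀ i j, s i (y j) = if i = j then 1 else 0) :
    IsHalfspace (Submodule.span ℂ (range fun n => y (2 * n))).topologicalClosure := by
  refine isHalfspace_of_biorthogonal (Submodule.isClosed_topologicalClosure _)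
    (fun i => s (2 * i)) (fun i => s (2 * i + 1))
    (fun i => y (2 * i)) (fun i => y (2 * i + 1)) ?_ ?_ ?_ ?_
  · intro i j; simp [h]
  · intro i j; simp [h]
  · exact fun j => Submodule.le_topologicalClosure _ (Submodule.subset_span ⟨j, rfl⟩)
  · intro i z hz
    have hle : (Submodule.span ℂ (range fun n => y (2 * n))).topologicalClosure ≤
        LinearMap.ker (s (2 * i + 1) : X →ₗ[ℂ] ℂ) := by
      refine Submodule.topologicalClosure_minimal _ ?_ (s (2 * i + 1)).isClosed_ker
      rw [Submodule.span_le]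
      rintro _ ⟨j, rfl⟩
      simp only [SetLike.mem_coe, LinearMap.mem_ker, ContinuousLinearMap.coe_coe, h]
      rw [if_neg (by omega)]
    simpa using hle hz

theorem hasAIHS1_of_halfspace {T : X →L[ℂ] X} {Y : Submodule ℂ X} (hY : IsHalfspace Y) (e : X)
    (h : ∀ y ∈ Y, T y ∈ Y ⊔ ℂ ∙ e) : HasAIHS1 T :=
  ⟨Y, hY, ℂ ∙ e, inferInstance, (finrank_span_le_card _).trans (by simp), h⟩

theorem _root_.HasAIHS1.exists_vector {T : X →L[ℂ] X} (h : HasAIHS1 T) :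
    ∃ Y : Submodule ℂ X, IsHalfspace Y ∧ ∃ e : X, ∀ y ∈ Y, T y ∈ Y ⊔ ℂ ∙ e := by
  obtain ⟨Y, hY, E, hE, hE1, hT⟩ := h
  obtain ⟨e, he⟩ := finrank_le_one_iff.1 hE1
  refine ⟨Y, hY, e, fun y hy => sup_le_sup_left ?_ Y (hT y hy)⟩
  intro x hx
  obtain ⟨c, hc⟩ := he ⟨x, hx⟩
  exact Submodule.mem_span_singleton.2 ⟨c, congrArg Subtype.val hc⟩

theorem _root_.HasAIHS1.of_sub_smul {T : X →L[ℂ] X} (z : ℂ)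
    (h : HasAIHS1 (T - algebraMap ℂ (X →L[ℂ] X) z)) : HasAIHS1 T := by
  obtain ⟨Y, hY, E, hE, hE1, hT⟩ := h
  refine ⟨Y, hY, E, hE, hE1, fun y hy => ?_⟩
  have h1 := add_mem (hT y hy) ((le_sup_left : Y ≤ Y ⊔ E) (Y.smul_mem z hy))
  simpa [Algebra.algebraMap_eq_smul_one] using h1

variable {X' : Type*} [NormedAddCommGroup X'] [NormedSpace ℂ X']

theorem _root_.HasAIHS1.of_subspace {T : X →L[ℂ] X} {M : Submodule ℂ X} (hM : IsClosed (M : Set X))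
    {S : M →L[ℂ] M} (hS : ∀ x : M, T x = S x) (h : HasAIHS1 S) : HasAIHS1 T := by
  obtain ⟨Y, ⟨hYc, hYi, hYq⟩, e, hT⟩ := h.exists_vector
  refine hasAIHS1_of_halfspace (Y := Y.map M.subtype) ⟨?_, ?_, ?_⟩ (e : X) ?_
  · exact hM.isClosedEmbedding_subtypeVal.isClosedMap _ hYc
  · intro hf
    exact hYi (LinearEquiv.finiteDimensional
      (Submodule.equivMapOfInjective M.subtype M.injective_subtype Y).symm)
  · intro hf
    refine hYq (FiniteDimensional.of_injective
      (Y.mapQ (Y.map M.subtype) M.subtype (Submodule.le_comap_map _ _)) ?_)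
    rw [← LinearMap.ker_eq_bot, Submodule.ker_mapQ,
      Submodule.comap_map_eq_of_injective M.injective_subtype]
    simp
  · rintro _ ⟨y, hy, rfl⟩
    have := Submodule.mem_map_of_mem (f := M.subtype) (hT y hy)
    rw [Submodule.map_sup, Submodule.map_span, image_singleton] at this
    simpa [hS] using this

theorem _root_.HasAIHS1.of_quotient {T : X →L[ℂ] X} {T' : X' →L[ℂ] X'} {π : X →L[ℂ] X'}
    (hπ : Function.Surjective π) (hT : ∀ x, T' (π x) = π (T x)) (h : HasAIHS1 T') :
    HasAIHS1 T := by
  obtain ⟨Y, ⟨hYc, hYi, hYq⟩, e', hY⟩ := h.exists_vector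
  obtain ⟨e, rfl⟩ := hπ e'
  refine hasAIHS1_of_halfspace (Y := Y.comap (π : X →ₗ[ℂ] X')) ⟨?_, ?_, ?_⟩ e ?_
  · exact hYc.preimage π.continuous
  · intro hf
    refine hYi (Module.Finite.of_surjective
      ((π : X →ₗ[ℂ] X').restrict (p := Y.comap (π : X →ₗ[ℂ] X')) (q := Y) fun x hx => hx) ?_)
    rintro ⟨y, hy⟩
    obtain ⟨x, rfl⟩ := hπ y
    exact ⟨⟨x, hy⟩, rfl⟩
  · intro hf
    refine hYq (Module.Finite.of_surjective
      ((Y.comap (π : X →ₗ[ℂ] X')).mapQ Y (π : X →ₗ[ℂ] X') le_rfl) ?_)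
    intro q
    obtain ⟨y, rfl⟩ := Y.mkQ_surjective q
    obtain ⟨x, rfl⟩ := hπ y
    exact ⟨(Y.comap (π : X →ₗ[ℂ] X')).mkQ x, rfl⟩
  · intro x hx
    have := hY (π x) hx
    rw [hT, Submodule.mem_sup] at this
    obtain ⟨y, hy, w, hw, hyw⟩ := this
    obtain ⟨c, rfl⟩ := Submodule.mem_span_singleton.1 hw
    refine Submodule.mem_sup.2 ⟨T x - c • e, ?_, c • e,
      Submodule.mem_span_singleton.2 ⟨c, rfl⟩, by simp⟩
    have hy' : π (T x - c • e) = y := by simp [← hyw]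
    simpa [hy'] using hy

end Halfspace

section Biorthogonal

variable {Z : Type*} [NormedAddCommGroup Z] [NormedSpace ℂ Z]

/-- The first `k` terms of `p.1` lie in `S` and are biorthogonal to the first `k` terms of `p.2`. -/
def IsPartialBiorthogonal (S : Set (Z →L[ℂ] ℂ)) (k : ℕ)
    (p : (ℕ → Z →L[ℂ] ℂ) × (ℕ → Z)) : Prop :=
  (∀ i < k, p.1 i ∈ S) ∧ ∀ i < k, ∀ j < k, p.1 i (p.2 j) = if i = j then 1 else 0

theorem IsPartialBiorthogonal.exists_extension {S : Set (Z →L[ℂ] ℂ)} {c : ℝ} (hc : 0 < c)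
    (hS : ∀ s ∈ S, c ≤ ‖s‖)
    (hcl : ∀ (F : Finset Z) (ε : ℝ), 0 < ε → ∃ s ∈ S, ∀ y ∈ F, ‖s y‖ < ε)
    {k : ℕ} {p : (ℕ → Z →L[ℂ] ℂ) × (ℕ → Z)} (hp : IsPartialBiorthogonal S k p)
    {ε : ℝ} (hε : 0 < ε) :
    ∃ q, IsPartialBiorthogonal S (k + 1) q ∧ (∀ i < k, q.1 i = p.1 i) ∧
      ∀ j < k, ‖q.2 j - p.2 j‖ ≤ ε := by
  classical
  obtain ⟨s, y⟩ := p
  obtain ⟨hpS, hpB⟩ := hp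
  simp only at hpS hpB
  set B : ℝ := ∑ j ∈ Finset.range k, ‖s j‖ with hB
  set C : ℝ := 1 + ∑ j ∈ Finset.range k, ‖s j‖ * ‖y j‖ with hC
  have hB0 : 0 ≤ B := Finset.sum_nonneg fun _ _ => norm_nonneg _
  have hC0 : 0 < C := by
    have : 0 ≤ ∑ j ∈ Finset.range k, ‖s j‖ * ‖y j‖ := Finset.sum_nonneg fun _ _ => by positivity
    linarith
  set δ : ℝ := min (c / 4 / (B + 1)) (ε * (c / 4) / C) with hδ
  have hδ0 : 0 < δ := by positivity
  obtain ⟨x, hxS, hx⟩ := hcl ((Finset.range k).image y) δ hδ0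
  have hx' : ∀ j < k, ‖x (y j)‖ < δ := fun j hj =>
    hx _ (Finset.mem_image_of_mem _ (Finset.mem_range.2 hj))
  obtain ⟨u, hu1, hu⟩ : ∃ u : Z, ‖u‖ < 1 ∧ c / 2 < ‖x u‖ :=
    x.exists_lt_apply_of_lt_opNorm (by linarith [hS x hxS])
  set w : Z := u - ∑ j ∈ Finset.range k, s j u • y j with hw
  have hsu : ∀ j, ‖s j u‖ ≤ ‖s j‖ := fun j => (s j).le_of_opNorm_le_of_le le_rfl hu1.le |>.trans
    (by simp)
  have hwC : ‖w‖ ≤ C := by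
    refine (norm_sub_le _ _).trans (add_le_add hu1.le ((norm_sum_le _ _).trans ?_))
    refine Finset.sum_le_sum fun j _ => ?_
    rw [norm_smul]
    exact mul_le_mul_of_nonneg_right (hsu j) (norm_nonneg _)
  have hws : ∀ i < k, s i w = 0 := by
    intro i hi
    simp only [hw, map_sub, map_sum, map_smul, smul_eq_mul]
    rw [Finset.sum_congr rfl fun j hj => by rw [hpB i hi j (Finset.mem_range.1 hj)]]
    simp [hi]
  have hxw : c / 4 ≤ ‖x w‖ := by
    have h1 : ‖∑ j ∈ Finset.range k, s j u * x (y j)‖ ≤ c / 4 := by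
      calc ‖∑ j ∈ Finset.range k, s j u * x (y j)‖
          ≤ ∑ j ∈ Finset.range k, ‖s j‖ * δ := by
            refine (norm_sum_le _ _).trans (Finset.sum_le_sum fun j hj => ?_)
            rw [norm_mul]
            exact mul_le_mul (hsu j) (hx' j (Finset.mem_range.1 hj)).le (norm_nonneg _)
              (norm_nonneg _)
        _ = B * δ := by rw [← Finset.sum_mul]
        _ ≤ (B + 1) * (c / 4 / (B + 1)) :=
            mul_le_mul (by linarith) (min_le_left _ _) hδ0.le (by linarith)
        _ = c / 4 := by field_simp
    have h2 : x w = x u - ∑ j ∈ Finset.range k, s j u * x (y j) := by simp [hw]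
    rw [h2]
    have := norm_sub_norm_le (x u) (∑ j ∈ Finset.range k, s j u * x (y j))
    linarith
  have hxw0 : x w ≠ 0 := norm_pos_iff.1 (by linarith)
  set v : Z := (x w)⁻¹ • w with hv
  have hxv : x v = 1 := by simp [hv, hxw0]
  have hsv : ∀ i < k, s i v = 0 := fun i hi => by simp [hv, hws i hi]
  have hvn : ‖v‖ ≤ C / (c / 4) := by
    rw [hv, norm_smul, norm_inv, inv_mul_eq_div]
    exact div_le_div₀ hC0.le hwC (by positivity) hxw
  refine ⟨(fun i => if i < k then s i else x, fun j => if j < k then y j - x (y j) • v else v),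
    ⟨?_, ?_⟩, ?_, ?_⟩
  · intro i _
    by_cases hi : i < k <;> simp [hi, hxS, hpS]
  · intro i hi' j hj'
    by_cases hj : j < k <;> by_cases hi : i < k
    · simp [hi, hj, hsv, hpB]
    · have : i ≠ j := by omega
      simp [hi, hj, hxv, this]
    · have : i ≠ j := by omega
      simp [hi, hj, hsv, this]
    · have : i = j := by omega
      simp [hj, hxv, this]
  · intro i hi; simp [hi]
  · intro j hj
    simp only [hj, if_true, sub_sub_cancel_left, norm_neg, norm_smul]
    calc ‖x (y j)‖ * ‖v‖ ≤ (ε * (c / 4) / C) * (C / (c / 4)) :=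
          mul_le_mul ((hx' j hj).le.trans (min_le_right _ _)) hvn (norm_nonneg _) (by positivity)
      _ = ε := by field_simp

theorem exists_biorthogonal [CompleteSpace Z] {S : Set (Z →L[ℂ] ℂ)} {c : ℝ} (hc : 0 < c)
    (hS : ∀ s ∈ S, c ≤ ‖s‖)
    (hcl : ∀ (F : Finset Z) (ε : ℝ), 0 < ε → ∃ s ∈ S, ∀ y ∈ F, ‖s y‖ < ε) :
    ∃ (s : ℕ → Z →L[ℂ] ℂ) (y : ℕ → Z), (∀ k, s k ∈ S) ∧
      ∀ i j, s i (y j) = if i = j then 1 else 0 := by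
  choose! next hnext hfst hsnd using fun (k : ℕ) (p : (ℕ → Z →L[ℂ] ℂ) × (ℕ → Z))
    (hp : IsPartialBiorthogonal S k p) =>
      hp.exists_extension hc hS hcl (ε := 1 / 2 / 2 ^ k) (by positivity)
  let p : ℕ → (ℕ → Z →L[ℂ] ℂ) × (ℕ → Z) := fun k => Nat.rec (0, 0) next k
  have hp : ∀ k, IsPartialBiorthogonal S k (p k) := by
    intro k
    induction k with
    | zero => exact ⟨by simp, by simp⟩
    | succ k ih => exact hnext k (p k) ih
  have hstab : ∀ i n, (p (i + 1 + n)).1 i = (p (i + 1)).1 i := by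
    intro i n
    induction n with
    | zero => rfl
    | succ n ih => exact (hfst _ _ (hp _) i (by change i < i + 1 + n; omega)).trans ih
  have hcauchy : ∀ j, ∃ z, Tendsto (fun k => (p k).2 j) atTop (𝓝 z) := by
    intro j
    suffices CauchySeq fun n => (p (n + (j + 1))).2 j by
      obtain ⟨z, hz⟩ := cauchySeq_tendsto_of_complete this
      exact ⟨z, (tendsto_add_atTop_iff_nat (f := fun k => (p k).2 j) (j + 1)).1 hz⟩
    refine cauchySeq_of_le_geometric_two (C := 1) fun n => ?_
    rw [dist_comm, dist_eq_norm]
    have h := hsnd _ _ (hp (n + (j + 1))) j (by omega)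
    have e : n + 1 + (j + 1) = (n + (j + 1)) + 1 := by omega
    rw [e]
    refine h.trans ?_
    gcongr
    · norm_num
    · omega
  choose y hy using hcauchy
  refine ⟨fun k => (p (k + 1)).1 k, y, fun k => (hp (k + 1)).1 k (by omega), fun i j => ?_⟩
  have h1 := (((p (i + 1)).1 i).continuous.tendsto (y j)).comp (hy j)
  refine tendsto_nhds_unique h1 (tendsto_const_nhds.congr' ?_)
  filter_upwards [eventually_ge_atTop (i + 1 + (j + 1))] with k hk
  obtain ⟨n, rfl⟩ := Nat.exists_eq_add_of_le (show i + 1 ≤ k by omega)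
  have := (hp (i + 1 + n)).2 i (by omega) j (by omega)
  rw [hstab] at this
  exact this.symm

/-- Every infinite-dimensional Banach space contains a halfspace. -/
theorem hasAIHS1_zero [CompleteSpace Z] (hZ : ¬FiniteDimensional ℂ Z) :
    HasAIHS1 (0 : Z →L[ℂ] Z) := by
  obtain ⟨s, y, -, h⟩ := exists_biorthogonal (S := {s : Z →L[ℂ] ℂ | ‖s‖ = 1}) one_pos
    (fun s hs => (show ‖s‖ = 1 from hs).ge) (by
      intro F ε hε
      have hcl : IsClosed (Submodule.span ℂ (F : Set Z) : Set Z) :=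
        Submodule.closed_of_finiteDimensional _
      obtain ⟨x, hx⟩ : ∃ x, x ∉ Submodule.span ℂ (F : Set Z) := by
        by_contra! h
        refine hZ (Module.finite_def.2 ⟨F, ?_⟩)
        exact eq_top_iff.2 fun x _ => h x
      obtain ⟨g, hg1, hg⟩ := exists_dual_vector ℂ
        ((Submodule.span ℂ (F : Set Z)).mkQ x) (by
          rw [norm_ne_zero_iff]
          simpa using hx)
      let f : Z →L[ℂ] ℂ := g.comp (Submodule.span ℂ (F : Set Z)).mkQL
      have hf : f ≠ 0 := by
        intro h0
        have : f x = 0 := by rw [h0]; rfl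
        change g ((Submodule.span ℂ (F : Set Z)).mkQ x) = 0 at this
        rw [hg] at this
        simp [hx] at this
      refine ⟨((‖f‖ : ℂ)⁻¹) • f, ?_, fun y hy => ?_⟩
      · have : ‖f‖ ≠ 0 := norm_ne_zero_iff.2 hf
        simp [norm_smul, this]
      · have : f y = 0 := by
          change g ((Submodule.span ℂ (F : Set Z)).mkQ y) = 0
          rw [(Submodule.Quotient.mk_eq_zero _).2 (Submodule.subset_span hy) |>
            (show (Submodule.span ℂ (F : Set Z)).mkQ y = 0 from ·), map_zero]
        simp [this, hε])
  exact hasAIHS1_of_halfspace (isHalfspace_iInf_ker s y h) 0 (by simp)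

end Biorthogonal

section Resolvent

theorem exists_approximate_eigenvectors {V : Type*} [NormedAddCommGroup V] [NormedSpace ℂ V]
    [CompleteSpace V] (A : V →L[ℂ] V) (μ : ℕ → ℂ) (R : ℕ → V →L[ℂ] V)
    (hμ : Tendsto μ atTop (𝓝 0)) (hR : ∀ n e, μ n • R n e - A (R n e) = e)
    (hunb : ¬∃ C, ∀ n, ‖R n‖ ≤ C) :
    ∃ (e : V) (x : ℕ → V) (ν c : ℕ → ℂ), (∀ n, ‖x n‖ = 1) ∧ Tendsto ν atTop (𝓝 0) ∧
      Tendsto c atTop (𝓝 0) ∧ ∀ n, A (x n) = ν n • x n - c n • e := by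
  obtain ⟨e, he⟩ : ∃ e, ∀ C, ∃ n, C < ‖R n e‖ := by
    by_contra! h
    exact hunb (banach_steinhaus h)
  have he' : ∀ k : ℕ, ∃ n ≥ k, (k : ℝ) + 1 < ‖R n e‖ := by
    intro k
    obtain ⟨n, hn⟩ := he (k + 1 + ∑ i ∈ Finset.range k, ‖R i e‖)
    have h0 : 0 ≤ ∑ i ∈ Finset.range k, ‖R i e‖ := Finset.sum_nonneg fun _ _ => norm_nonneg _
    refine ⟨n, ?_, by linarith⟩
    by_contra! hk
    have := Finset.single_le_sum (f := fun i => ‖R i e‖) (fun _ _ => norm_nonneg _)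
      (Finset.mem_range.2 hk)
    have hk0 : (0 : ℝ) ≤ k := k.cast_nonneg
    linarith
  choose φ hφ hφR using he'
  have hpos : ∀ k, 0 < ‖R (φ k) e‖ := fun k => lt_trans (by positivity) (hφR k)
  refine ⟨e, fun k => ((‖R (φ k) e‖ : ℂ)⁻¹) • R (φ k) e, fun k => μ (φ k),
    fun k => (‖R (φ k) e‖ : ℂ)⁻¹, fun k => ?_, ?_, ?_, fun k => ?_⟩
  · simp [norm_smul, (hpos k).ne']
  · exact hμ.comp (tendsto_atTop_mono hφ tendsto_id)
  · rw [tendsto_zero_iff_norm_tendsto_zero]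
    simp only [norm_inv, Complex.norm_real, norm_norm]
    refine tendsto_inv_atTop_zero.comp (tendsto_atTop_mono (fun k => ?_)
      tendsto_natCast_atTop_atTop)
    linarith [hφR k]
  · rw [map_smul, smul_comm, ← smul_sub]
    congr 1
    rw [eq_sub_iff_add_eq, ← eq_sub_iff_add_eq']
    exact (hR (φ k) e).symm

variable {X : Type*} [NormedAddCommGroup X] [NormedSpace ℂ X] [CompleteSpace X]

theorem exists_unbounded_resolvents {T : X →L[ℂ] X} (hT : ¬IsUnit T)
    (hcl : (0 : ℂ) ∈ closure (spectrum ℂ T)ᶜ) :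
    ∃ (μ : ℕ → ℂ) (R : ℕ → X →L[ℂ] X), Tendsto μ atTop (𝓝 0) ∧
      (∀ n e, μ n • R n e - T (R n e) = e) ∧ (∀ n e, R n (μ n • e - T e) = e) ∧
      ¬∃ C, ∀ n, ‖R n‖ ≤ C := by
  obtain ⟨μ, hμ, hμ0⟩ := mem_closure_iff_seq_limit.1 hcl
  have hu : ∀ n, IsUnit (algebraMap ℂ (X →L[ℂ] X) (μ n) - T) := fun n =>
    spectrum.notMem_iff.1 (hμ n)
  choose U hU using hu
  have hUap : ∀ n e, (U n : X →L[ℂ] X) e = μ n • e - T e := fun n e => by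
    rw [hU]; simp [Algebra.algebraMap_eq_smul_one]
  refine ⟨μ, fun n => ((U n)⁻¹ : (X →L[ℂ] X)ˣ), hμ0, fun n e => ?_, fun n e => ?_, ?_⟩
  · rw [← hUap, ← mul_apply_eq_comp, Units.mul_inv]; rfl
  · rw [← hUap, ← mul_apply_eq_comp, Units.inv_mul]; rfl
  · rintro ⟨C, hC⟩
    have hC1 : 0 < |C| + 1 := by positivity
    have := (Metric.tendsto_nhds.1 hμ0 (1 / (|C| + 1)) (by positivity)).exists
    obtain ⟨n, hn⟩ := this
    rw [dist_zero_right] at hn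
    have hneg : ¬IsUnit (-T) := by simpa using hT
    by_cases h0 : ‖(((U n)⁻¹ : (X →L[ℂ] X)ˣ) : X →L[ℂ] X)‖ = 0
    · have h1 : (((U n)⁻¹ : (X →L[ℂ] X)ˣ) : X →L[ℂ] X) = 0 := norm_eq_zero.1 h0
      have h2 : (1 : X →L[ℂ] X) = 0 := by rw [← (U n).mul_inv, h1, mul_zero]
      have : Subsingleton (X →L[ℂ] X) := subsingleton_of_zero_eq_one h2.symm
      exact hT (isUnit_of_subsingleton T)
    · refine hneg ⟨(U n).ofNearby (-T) ?_, rfl⟩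
      have h3 : -T - (U n : X →L[ℂ] X) = -(μ n • (1 : X →L[ℂ] X)) := by
        rw [hU, Algebra.algebraMap_eq_smul_one]; abel
      rw [h3, norm_neg]
      have h4 : ‖μ n • (1 : X →L[ℂ] X)‖ ≤ ‖μ n‖ := by
        rw [norm_smul]
        exact mul_le_of_le_one_right (norm_nonneg _) ContinuousLinearMap.norm_id_le
      refine h4.trans_lt (hn.trans_le ?_)
      rw [one_div]
      refine inv_anti₀ (lt_of_le_of_ne (norm_nonneg _) (Ne.symm h0)) ?_
      linarith [hC n, le_abs_self C]

theorem exists_hyperfilter_tendsto {Z : Type*} [NormedAddCommGroup Z] [NormedSpace ℂ Z]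
    (x : ℕ → Z →L[ℂ] ℂ) (hx : ∀ n, ‖x n‖ ≤ 1) :
    ∃ z : Z →L[ℂ] ℂ, ∀ f, Tendsto (fun n => x n f) (hyperfilter ℕ) (𝓝 (z f)) := by
  have hK := WeakDual.isCompact_closedBall (𝕜 := ℂ) (0 : StrongDual ℂ Z) 1
  obtain ⟨z, -, hz⟩ := isCompact_iff_ultrafilter_le_nhds.1 hK
    ((hyperfilter ℕ).map fun n => StrongDual.toWeakDual (x n)) (by
      refine le_principal_iff.2 (Filter.mem_map.2 (univ_mem' fun n => ?_))
      simpa using hx n)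
  refine ⟨WeakDual.toStrongDual z, fun f => ?_⟩
  exact ((WeakDual.eval_continuous f).tendsto z).comp hz

theorem exists_norm_lt_of_hyperfilter_tendsto {Z : Type*} {x : ℕ → Z → ℂ}
    (h : ∀ f, Tendsto (fun n => x n f) (hyperfilter ℕ) (𝓝 0)) (F : Finset Z) {ε : ℝ}
    (hε : 0 < ε) : ∃ n, ∀ f ∈ F, ‖x n f‖ < ε := by
  have : ∀ᶠ n in (hyperfilter ℕ : Filter ℕ), ∀ f ∈ F, ‖x n f‖ < ε := by
    rw [Filter.eventually_all_finset]
    intro f _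
    simpa using Metric.tendsto_nhds.1 (h f) ε hε
  exact this.exists

/-- The case in which the adjoint is injective. -/
theorem hasAIHS1_of_denseRange {T : X →L[ℂ] X} (hT : ¬IsUnit T)
    (hcl : (0 : ℂ) ∈ closure (spectrum ℂ T)ᶜ) (hd : DenseRange T) : HasAIHS1 T := by
  obtain ⟨μ, R, hμ, hR, hR', hunb⟩ := exists_unbounded_resolvents hT hcl
  let adj : (X →L[ℂ] X) → (X →L[ℂ] ℂ) →L[ℂ] (X →L[ℂ] ℂ) :=
    fun S => (ContinuousLinearMap.compL ℂ X X ℂ).flip S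
  have hadj : ∀ S f x, adj S f x = f (S x) := fun _ _ _ => rfl
  obtain ⟨e, x, ν, c, hx1, hν, hc, hx⟩ := exists_approximate_eigenvectors (adj T) μ
    (fun n => adj (R n)) hμ (fun n f => by
      ext y
      have := congrArg f (hR' n y)
      rw [map_sub, map_sub, map_smul, map_smul] at this
      simpa [hadj] using this) (by
      rintro ⟨C, hC⟩
      have hC0 : 0 ≤ C := (norm_nonneg _).trans (hC 0)
      refine hunb ⟨C, fun n => ContinuousLinearMap.opNorm_le_bound _ hC0 fun y => ?_⟩
      obtain ⟨g, hg1, hg⟩ := exists_dual_vector'' ℂ (R n y)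
      have h1 : ‖adj (R n) g y‖ ≤ C * ‖y‖ := by
        refine (adj (R n) g).le_of_opNorm_le ?_ y
        refine ((adj (R n)).le_of_opNorm_le (hC n) g).trans ?_
        exact mul_le_of_le_one_right hC0 hg1
      rw [hadj, hg] at h1
      simpa using h1)
  obtain ⟨z, hz⟩ := exists_hyperfilter_tendsto x fun n => (hx1 n).le
  have hU : (hyperfilter ℕ : Filter ℕ) ≤ atTop := Nat.hyperfilter_le_atTop
  have hzT : ∀ y, z (T y) = 0 := by
    intro y
    refine tendsto_nhds_unique (hz (T y)) ?_
    have h1 : ∀ n, x n (T y) = ν n * x n y - c n * e y := fun n => by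
      have := congrArg (fun f : X →L[ℂ] ℂ => f y) (hx n)
      simpa [hadj] using this
    simp only [h1]
    simpa using ((hν.mono_left hU).mul (hz y)).sub ((hc.mono_left hU).mul_const (e y))
  have hz0 : ∀ y, z y = 0 := by
    intro y
    exact congrFun (hd.equalizer z.continuous continuous_const (funext hzT)) y
  simp only [hz0] at hz
  obtain ⟨s, v, hs, hsv⟩ := exists_biorthogonal (S := range x) one_pos
    (by rintro _ ⟨n, rfl⟩; exact (hx1 n).ge) (by
      intro F ε hε
      obtain ⟨n, hn⟩ := exists_norm_lt_of_hyperfilter_tendsto (x := fun n f => x n f) hz F hε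
      exact ⟨x n, ⟨n, rfl⟩, hn⟩)
  choose m hm using hs
  set Y := ⨅ n, LinearMap.ker (s (2 * n) : X →ₗ[ℂ] ℂ) with hY
  have hYmem : ∀ {y}, y ∈ Y ↔ ∀ n, s (2 * n) y = 0 := fun {y} => by simp [hY]
  have hker : ∀ y ∈ Y, e y = 0 → T y ∈ Y := by
    intro y hy hey
    rw [hYmem] at hy ⊢
    intro n
    have h1 := congrArg (fun f : X →L[ℂ] ℂ => f y) (hx (m (2 * n)))
    rw [hm] at h1
    simpa [hadj, hy n, hey] using h1
  have hH : IsHalfspace Y := isHalfspace_iInf_ker s v hsv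
  by_cases hall : ∀ y ∈ Y, e y = 0
  · exact hasAIHS1_of_halfspace hH 0 fun y hy => by simpa using hker y hy (hall y hy)
  · push Not at hall
    obtain ⟨y₀, hy₀, hey₀⟩ := hall
    refine hasAIHS1_of_halfspace hH (T y₀) fun y hy => ?_
    have h1 := hker (y - (e y / e y₀) • y₀) (Y.sub_mem hy (Y.smul_mem _ hy₀)) (by
      simp [hey₀])
    refine Submodule.mem_sup.2 ⟨_, h1, (e y / e y₀) • T y₀,
      Submodule.mem_span_singleton.2 ⟨_, rfl⟩, by simp⟩

theorem le_norm_domRestrict_ker {Z : Type*} [NormedAddCommGroup Z] [NormedSpace ℂ Z]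
    {φ z : Z →L[ℂ] ℂ} {c : ℝ} (h : ∀ a : ℂ, c ≤ ‖φ - a • z‖) :
    c ≤ ‖φ.comp (LinearMap.ker (z : Z →ₗ[ℂ] ℂ)).subtypeL‖ := by
  obtain ⟨g, hg, hgn⟩ := exists_extension_norm_eq (LinearMap.ker (z : Z →ₗ[ℂ] ℂ))
    (φ.comp (LinearMap.ker (z : Z →ₗ[ℂ] ℂ)).subtypeL)
  have hgφ : ∀ y, z y = 0 → g y = φ y := fun y hy => hg ⟨y, hy⟩
  obtain ⟨a, ha⟩ : ∃ a : ℂ, g = φ - a • z := by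
    by_cases hz : ∀ y, z y = 0
    · exact ⟨0, by ext y; simp [hgφ y (hz y)]⟩
    · push Not at hz
      obtain ⟨y₀, hy₀⟩ := hz
      refine ⟨(φ y₀ - g y₀) / z y₀, ?_⟩
      ext y
      have h1 := hgφ (y - (z y / z y₀) • y₀) (by simp [hy₀])
      simp only [map_sub, map_smul, smul_eq_mul] at h1
      simp only [sub_apply, smul_apply, smul_eq_mul]
      linear_combination h1
  rw [← hgn, ha]
  exact h a

theorem exists_le_norm_sub_smul {G : Type*} [NormedAddCommGroup G] [NormedSpace ℂ G]
    {L : Submodule ℂ G} (hL : IsClosed (L : Set G)) {z : G} (hz : z = 0 ∨ z ∉ L) :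
    ∃ c > 0, ∀ w ∈ L, ‖w‖ = 1 → ∀ a : ℂ, c ≤ ‖w - a • z‖ := by
  rcases hz with rfl | hz
  · exact ⟨1, one_pos, fun w _ hw a => by simp [hw]⟩
  set d := Metric.infDist z L
  have hd : 0 < d := (hL.notMem_iff_infDist_pos ⟨0, L.zero_mem⟩).1 hz
  have hz0 : 0 < ‖z‖ := norm_pos_iff.2 fun h => hz (h ▸ L.zero_mem)
  have hbound : ∀ w ∈ L, ∀ a : ℂ, ‖a‖ * d ≤ ‖w - a • z‖ := by
    intro w hw a
    by_cases ha : a = 0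
    · simp [ha]
    · have h1 : w - a • z = -(a • (z - a⁻¹ • w)) := by simp [smul_sub, ha]
      rw [h1, norm_neg, norm_smul, ← dist_eq_norm]
      exact mul_le_mul_of_nonneg_left (Metric.infDist_le_dist_of_mem (L.smul_mem _ hw))
        (norm_nonneg _)
  refine ⟨min (1 / 2) (d / (2 * ‖z‖)), by positivity, fun w hw hw1 a => ?_⟩
  by_cases ha : ‖a‖ * ‖z‖ ≤ 1 / 2
  · have := norm_sub_norm_le w (a • z)
    rw [norm_smul, hw1] at this
    exact (min_le_left _ _).trans (by linarith)
  · refine (min_le_right _ _).trans (le_trans ?_ (hbound w hw a))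
    rw [div_le_iff₀ (by positivity)]
    nlinarith

/-- The case in which the operator is injective. -/
theorem hasAIHS1_of_injective {T : X →L[ℂ] X} (hT : ¬IsUnit T)
    (hcl : (0 : ℂ) ∈ closure (spectrum ℂ T)ᶜ) (hinj : Function.Injective T) : HasAIHS1 T := by
  obtain ⟨μ, R, hμ, hR, -, hunb⟩ := exists_unbounded_resolvents hT hcl
  obtain ⟨e, x, ν, c, hx1, hν, hc, hx⟩ := exists_approximate_eigenvectors T μ R hμ hR hunb
  let J := NormedSpace.inclusionInDoubleDualLi (E := X) ℂ
  have hJ : ∀ x f, J x f = f x := fun _ _ => rfl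
  obtain ⟨z, hz⟩ := exists_hyperfilter_tendsto (fun n => J (x n)) fun n => by
    rw [J.norm_map, hx1]
  simp only [hJ] at hz
  have hU : (hyperfilter ℕ : Filter ℕ) ≤ atTop := Nat.hyperfilter_le_atTop
  have hzT : ∀ f : X →L[ℂ] ℂ, z (f.comp T) = 0 := by
    intro f
    refine tendsto_nhds_unique (hz (f.comp T)) ?_
    have h1 : ∀ n, (f.comp T) (x n) = ν n * f (x n) - c n * f e := fun n => by simp [hx]
    simp only [h1]
    simpa using ((hν.mono_left hU).mul (hz f)).sub ((hc.mono_left hU).mul_const (f e))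
  have hz' : z = 0 ∨ z ∉ LinearMap.range J.toLinearMap := by
    rw [or_iff_not_imp_right, not_not]
    rintro ⟨a, rfl⟩
    have hTa : T a = 0 := by
      by_contra h0
      obtain ⟨g, -, hg⟩ := exists_dual_vector ℂ (T a) (norm_ne_zero_iff.2 h0)
      have h2 : g (T a) = 0 := hzT g
      rw [h2] at hg
      exact h0 (norm_eq_zero.1 (RCLike.ofReal_eq_zero.1 hg.symm))
    rw [hinj (hTa.trans (map_zero T).symm), map_zero]
  have hJc : IsClosed (LinearMap.range J.toLinearMap : Set (StrongDual ℂ (StrongDual ℂ X))) := by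
    rw [LinearMap.coe_range]
    exact J.isometry.isUniformInducing.isComplete_range.isClosed
  obtain ⟨d, hd, hdist⟩ := exists_le_norm_sub_smul hJc hz'
  set N := LinearMap.ker (z : (X →L[ℂ] ℂ) →ₗ[ℂ] ℂ)
  have : CompleteSpace N := z.isClosed_ker.completeSpace_coe
  obtain ⟨s, v, hs, hsv⟩ := exists_biorthogonal (S := range fun n => (J (x n)).comp N.subtypeL) hd
    (by
      rintro _ ⟨n, rfl⟩
      exact le_norm_domRestrict_ker (hdist _ ⟨x n, rfl⟩ ((J.norm_map _).trans (hx1 n)))) (by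
      intro F ε hε
      obtain ⟨n, hn⟩ := exists_norm_lt_of_hyperfilter_tendsto
        (x := fun n (f : N) => (f : X →L[ℂ] ℂ) (x n)) (fun f => by
          simpa only [show z f = 0 from f.2] using hz f) F hε
      exact ⟨_, ⟨n, rfl⟩, hn⟩)
  choose m hm using hs
  have hbi : ∀ i j, (v i : X →L[ℂ] ℂ) (x (m j)) = if i = j then 1 else 0 := by
    intro i j
    have h1 := hsv j i
    rw [← hm] at h1
    have h2 : (v i : X →L[ℂ] ℂ) (x (m j)) = if j = i then 1 else 0 := h1
    simpa only [eq_comm (a := j)] using h2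
  refine hasAIHS1_of_halfspace (isHalfspace_closure_span _ _ hbi) e ?_
  set Y := (Submodule.span ℂ (range fun n => x (m (2 * n)))).topologicalClosure
  have hclosed : IsClosed ((Y ⊔ ℂ ∙ e : Submodule ℂ X) : Set X) :=
    Submodule.isClosed_sup_finiteDimensional _ _ (Submodule.isClosed_topologicalClosure _)
  have hle : Y ≤ (Y ⊔ ℂ ∙ e).comap (T : X →ₗ[ℂ] X) := by
    refine Submodule.topologicalClosure_minimal _ ?_ (hclosed.preimage T.continuous)
    rw [Submodule.span_le]
    rintro _ ⟨n, rfl⟩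
    change T (x (m (2 * n))) ∈ Y ⊔ ℂ ∙ e
    rw [hx]
    refine sub_mem (Submodule.mem_sup_left (Y.smul_mem _ ?_))
      (Submodule.mem_sup_right (Submodule.mem_span_singleton.2 ⟨_, rfl⟩))
    exact Submodule.le_topologicalClosure _ (Submodule.subset_span ⟨n, rfl⟩)
  exact fun y hy => hle hy

end Resolvent

section GeneralizedKernel

variable {V : Type*} [AddCommGroup V] [Module ℂ V]

theorem exists_smul_sub_eq_of_nilpotent {L : V →ₗ[ℂ] V} {K : Submodule ℂ V}
    (hK : ∀ x ∈ K, L x ∈ K) (hnil : ∀ x ∈ K, ∃ m, L^[m] x = 0) {z : ℂ} (hz : z ≠ 0) {x : V}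
    (hx : x ∈ K) : ∃ w ∈ K, z • w - L w = x := by
  obtain ⟨m, hm⟩ := hnil x hx
  induction m generalizing x with
  | zero => exact ⟨0, K.zero_mem, by simpa using hm.symm⟩
  | succ m ih =>
    obtain ⟨w, hw, hwx⟩ := ih (hK x hx) hm
    refine ⟨z⁻¹ • (x + w), K.smul_mem _ (K.add_mem hx hw), ?_⟩
    rw [sub_eq_iff_eq_add] at hwx
    rw [smul_inv_smul₀ hz, map_smul, map_add, ← hwx, inv_smul_smul₀ hz, add_sub_cancel_right]

theorem eq_zero_of_nilpotent_of_eigenvector {L : V →ₗ[ℂ] V} {z : ℂ} (hz : z ≠ 0) {x : V}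
    (hx : L x = z • x) {m : ℕ} (hm : L^[m] x = 0) : x = 0 := by
  have : L^[m] x = z ^ m • x := by
    clear hm
    induction m with
    | zero => simp
    | succ m ih => rw [Function.iterate_succ_apply', ih, map_smul, hx, smul_smul, pow_succ]
  rw [this] at hm
  exact (smul_eq_zero.1 hm).resolve_left (pow_ne_zero _ hz)

theorem finiteDimensional_ker_pow {L : V →ₗ[ℂ] V} (h : FiniteDimensional ℂ (LinearMap.ker L))
    (m : ℕ) : FiniteDimensional ℂ (LinearMap.ker (L ^ m)) := by
  induction m with
  | zero => rw [pow_zero, Module.End.one_eq_id, LinearMap.ker_id]; infer_instance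
  | succ m ih =>
    refine Module.Finite.iff_fg.2 (Submodule.fg_of_fg_map_of_fg_inf_ker L ?_ ?_)
    · refine Module.Finite.iff_fg.1 (Submodule.finiteDimensional_of_le
        (S₂ := LinearMap.ker (L ^ m)) ?_)
      rintro _ ⟨x, hx, rfl⟩
      simpa [pow_succ] using hx
    · exact Module.Finite.iff_fg.1 (Submodule.finiteDimensional_of_le inf_le_right)

/-- The stable part of the generalized kernel of an operator with finite-dimensional kernel. -/
theorem exists_divisible_submodule (L : V →ₗ[ℂ] V) (h : FiniteDimensional ℂ (LinearMap.ker L)) :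
    ∃ D : Submodule ℂ V, D.map L = D ∧ (∀ x ∈ D, ∃ m, L^[m] x = 0) ∧
      ∃ J, ∀ x m, L^[m] x = 0 → L^[J] x ∈ D := by
  let K : Submodule ℂ V :=
    { carrier := {x | ∃ m, L^[m] x = 0}
      zero_mem' := ⟨0, rfl⟩
      add_mem' := by
        rintro x y ⟨m, hm⟩ ⟨n, hn⟩
        refine ⟨m + n, ?_⟩
        rw [iterate_map_add, Function.iterate_add_apply L m n y, hn, add_comm m n,
          Function.iterate_add_apply, hm]
        simp [iterate_map_zero]
      smul_mem' := by
        rintro c x ⟨m, hm⟩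
        exact ⟨m, by rw [← Module.End.pow_apply] at *; simp [hm]⟩ }
  have hanti : ∀ {i j : ℕ}, i ≤ j → LinearMap.range (L ^ j) ≤ LinearMap.range (L ^ i) := by
    rintro i j hij _ ⟨y, rfl⟩
    obtain ⟨k, rfl⟩ := Nat.exists_eq_add_of_le hij
    exact ⟨(L ^ k) y, by rw [pow_add]; rfl⟩
  obtain ⟨J, hJ⟩ := IsArtinian.monotone_stabilizes (R := ℂ) (M := LinearMap.ker L)
    ⟨fun j => OrderDual.toDual ((LinearMap.range (L ^ j)).comap (LinearMap.ker L).subtype),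
      fun i j hij => Submodule.comap_mono (hanti hij)⟩
  have hstab : ∀ J' ≥ J, ∀ x, L x = 0 → x ∈ LinearMap.range (L ^ J) →
      x ∈ LinearMap.range (L ^ J') := by
    intro J' hJ' x hx hxJ
    have h1 : (LinearMap.range (L ^ J)).comap (LinearMap.ker L).subtype =
      (LinearMap.range (L ^ J')).comap (LinearMap.ker L).subtype := hJ J' hJ'
    have h2 : (⟨x, hx⟩ : LinearMap.ker L) ∈
      (LinearMap.range (L ^ J)).comap (LinearMap.ker L).subtype := hxJ
    rw [h1] at h2
    exact h2
  have hdiv : ∀ m x, L^[m] x = 0 → x ∈ LinearMap.range (L ^ J) → ∀ J' ≥ J,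
      x ∈ LinearMap.range (L ^ J') := by
    intro m
    induction m with
    | zero => rintro x hx - J' -; rw [show x = 0 from hx]; exact zero_mem _
    | succ m ih =>
      intro x hx hxJ J' hJ'
      have hLx : L x ∈ LinearMap.range (L ^ J) := by
        obtain ⟨y, rfl⟩ := hxJ
        refine ⟨L y, ?_⟩
        rw [← Module.End.mul_apply, ← Module.End.mul_apply, ← pow_succ, ← pow_succ']
      obtain ⟨y, hy⟩ := ih (L x) hx hLx (J' + 1) (by omega)
      rw [pow_succ', Module.End.mul_apply] at hy
      have h1 : x - (L ^ J') y ∈ LinearMap.range (L ^ J') :=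
        hstab J' hJ' _ (by rw [map_sub, hy, sub_self]) (sub_mem hxJ (hanti hJ' ⟨y, rfl⟩))
      simpa using add_mem h1 (LinearMap.mem_range_self (L ^ J') y)
  refine ⟨K ⊓ LinearMap.range (L ^ J), le_antisymm ?_ ?_, fun x hx => hx.1, J, ?_⟩
  · rintro _ ⟨x, ⟨⟨m, hm⟩, ⟨y, rfl⟩⟩, rfl⟩
    refine ⟨⟨m, ?_⟩, ⟨L y, ?_⟩⟩
    · rw [← Function.iterate_succ_apply, Function.iterate_succ_apply', hm, map_zero]
    · rw [← Module.End.mul_apply, ← Module.End.mul_apply, ← pow_succ, ← pow_succ']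
  · rintro x ⟨⟨m, hm⟩, hx⟩
    obtain ⟨y, rfl⟩ := hdiv m x hm hx (J + 1) (by omega)
    rw [pow_succ', Module.End.mul_apply] at *
    exact ⟨(L ^ J) y, ⟨⟨m + 1, hm⟩, ⟨y, rfl⟩⟩, rfl⟩
  · intro x m hm
    refine ⟨⟨m, ?_⟩, ⟨x, Module.End.pow_apply L J x⟩⟩
    rw [← Function.iterate_add_apply, add_comm, Function.iterate_add_apply, hm, iterate_map_zero]

end GeneralizedKernel

section Reduction

theorem spectrum_sub_algebraMap {X : Type*} [NormedAddCommGroup X]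
    [NormedSpace ℂ X] (T : X →L[ℂ] X) (a z : ℂ) :
    z ∈ spectrum ℂ (T - algebraMap ℂ (X →L[ℂ] X) a) ↔ z + a ∈ spectrum ℂ T := by
  rw [spectrum.mem_iff, spectrum.mem_iff, map_add, sub_sub_eq_add_sub]

variable {X : Type u} [NormedAddCommGroup X] [NormedSpace ℂ X] [CompleteSpace X]

theorem notMem_spectrum_iff {T : X →L[ℂ] X} {z : ℂ} :
    z ∉ spectrum ℂ T ↔ Function.Bijective fun x => z • x - T x := by
  rw [spectrum.notMem_iff, ContinuousLinearMap.isUnit_iff_bijective]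
  simp [Algebra.algebraMap_eq_smul_one, Function.Bijective, Function.Injective,
    Function.Surjective]

/-- Passing to a surjective image whose kernel consists of generalized null vectors does not
change the nonzero spectrum. -/
theorem mem_spectrum_quotient_iff {X' : Type*} [NormedAddCommGroup X'] [NormedSpace ℂ X']
    [CompleteSpace X'] {T : X →L[ℂ] X} {T' : X' →L[ℂ] X'} {π : X →L[ℂ] X'}
    (hπ : Function.Surjective π) (hT : ∀ x, T' (π x) = π (T x))
    (hnil : ∀ x, π x = 0 → ∃ m, T^[m] x = 0) {z : ℂ} (hz : z ≠ 0) :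
    z ∈ spectrum ℂ T' ↔ z ∈ spectrum ℂ T := by
  have key : ∀ x, π x = 0 → ∃ w, π w = 0 ∧ z • w - T w = x := fun x hx =>
    exists_smul_sub_eq_of_nilpotent (L := (T : X →ₗ[ℂ] X))
      (K := LinearMap.ker (π : X →ₗ[ℂ] X'))
      (fun x hx => by
        have hx : π x = 0 := hx
        change π (T x) = 0
        rw [← hT, hx, map_zero]) (fun x hx => hnil x hx) hz hx
  have hπz : ∀ x, π (z • x - T x) = z • π x - T' (π x) := fun x => by simp [hT]
  rw [← not_iff_not, notMem_spectrum_iff, notMem_spectrum_iff]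
  constructor
  · rintro ⟨hinj, hsurj⟩
    refine ⟨fun x y hxy => ?_, fun y => ?_⟩
    · have h0 : T (x - y) = z • (x - y) := by
        simp only at hxy
        rw [map_sub, smul_sub, sub_eq_sub_iff_add_eq_add]
        rw [sub_eq_sub_iff_add_eq_add] at hxy
        rw [add_comm, ← hxy, add_comm]
      have h1 : π x = π y := hinj (by simp only [← hπz]; exact congrArg π hxy)
      obtain ⟨m, hm⟩ := hnil (x - y) (by rw [map_sub, h1, sub_self])
      exact sub_eq_zero.1 (eq_zero_of_nilpotent_of_eigenvector (L := (T : X →ₗ[ℂ] X)) hz h0 hm)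
    · obtain ⟨x', hx'⟩ := hsurj (π y)
      obtain ⟨x, rfl⟩ := hπ x'
      simp only [← hπz] at hx'
      obtain ⟨w, -, hw⟩ := key (y - (z • x - T x)) (by rw [map_sub, hx', sub_self])
      refine ⟨x + w, ?_⟩
      simp only [smul_add, map_add]
      rw [add_sub_add_comm, hw]
      abel
  · rintro ⟨hinj, hsurj⟩
    refine ⟨fun p q hpq => ?_, fun q => ?_⟩
    · obtain ⟨x, rfl⟩ := hπ p
      obtain ⟨y, rfl⟩ := hπ q
      simp only [← hπz] at hpq
      obtain ⟨w, hw0, hw⟩ := key (z • (x - y) - T (x - y)) (by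
        rw [hπz, map_sub, map_sub, smul_sub, ← sub_eq_zero.2 hpq, hπz, hπz]; abel)
      have h1 : w = x - y := hinj hw
      exact sub_eq_zero.1 (by rw [← map_sub, ← h1, hw0])
    · obtain ⟨y, rfl⟩ := hπ q
      obtain ⟨x, rfl⟩ := hsurj y
      exact ⟨π x, (hπz x).symm⟩

theorem hasAIHS1_of_divisible_submodule {T : X →L[ℂ] X} (hT : ¬IsUnit T)
    (hcl : (0 : ℂ) ∈ closure (spectrum ℂ T)ᶜ) {D : Submodule ℂ X}
    (hD : D.map (T : X →ₗ[ℂ] X) = D) (hnil : ∀ x ∈ D, ∃ m, T^[m] x = 0) (hD0 : D ≠ ⊥) :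
    HasAIHS1 T := by
  have hDT : ∀ x ∈ D, T x ∈ D := fun x hx => hD ▸ Submodule.mem_map_of_mem hx
  set M := D.topologicalClosure with hMdef
  have hM : IsClosed (M : Set X) := D.isClosed_topologicalClosure
  have : CompleteSpace M := hM.completeSpace_coe
  have hinv : ∀ (S : X →L[ℂ] X), (∀ x ∈ D, S x ∈ D) → ∀ x ∈ M, S x ∈ M := fun S hS x hx =>
    Submodule.topologicalClosure_minimal D (t := M.comap (S : X →ₗ[ℂ] X))
      (fun y hy => D.le_topologicalClosure (hS y hy)) (hM.preimage S.continuous) hx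
  let S : M →L[ℂ] M := T.restrict (hinv T hDT)
  have hS : ∀ x : M, (S x : X) = T x := fun _ => rfl
  refine HasAIHS1.of_subspace hM (S := S) (fun _ => rfl) (hasAIHS1_of_denseRange ?_ ?_ ?_)
  · intro hu
    obtain ⟨x, hx, hx0⟩ := D.exists_mem_ne_zero_of_ne_bot hD0
    obtain ⟨m, hm⟩ := hnil x hx
    have hinj : ∀ y ∈ D, T y = 0 → y = 0 := fun y hy hy0 => by
      have h1 : S ⟨y, D.le_topologicalClosure hy⟩ = S 0 := by
        rw [map_zero]; exact Subtype.ext hy0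
      exact congrArg Subtype.val ((ContinuousLinearMap.isUnit_iff_bijective.1 hu).1 h1)
    clear hnil
    induction m generalizing x with
    | zero => exact hx0 hm
    | succ m ih => exact ih (T x) (hDT x hx) (fun h => hx0 (hinj x hx h)) hm
  · refine closure_mono (fun z hz => ?_) hcl
    have hz0 : z ≠ 0 := by
      rintro rfl
      exact hz ((spectrum.zero_mem_iff ℂ).2 hT)
    obtain ⟨hi, -⟩ := notMem_spectrum_iff.1 hz
    have hu : IsUnit (algebraMap ℂ (X →L[ℂ] X) z - T) := spectrum.notMem_iff.1 hz
    obtain ⟨U, hU⟩ := hu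
    have hUap : ∀ x, (U : X →L[ℂ] X) x = z • x - T x := fun x => by
      rw [hU]; simp [Algebra.algebraMap_eq_smul_one]
    have hR : ∀ x, z • (↑U⁻¹ : X →L[ℂ] X) x - T ((↑U⁻¹ : X →L[ℂ] X) x) = x := fun x => by
      rw [← hUap, ← mul_apply_eq_comp, Units.mul_inv]; rfl
    have hRD : ∀ x ∈ D, (↑U⁻¹ : X →L[ℂ] X) x ∈ D := by
      intro x hx
      obtain ⟨w, hw, hwx⟩ := exists_smul_sub_eq_of_nilpotent (L := (T : X →ₗ[ℂ] X)) hDT hnil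
        hz0 hx
      have : (↑U⁻¹ : X →L[ℂ] X) x = w := hi ((hR x).trans hwx.symm)
      rwa [this]
    refine notMem_spectrum_iff.2 ⟨fun x y hxy => ?_, fun y => ?_⟩
    · exact Subtype.ext (hi (congrArg Subtype.val hxy))
    · exact ⟨⟨_, hinv _ hRD y y.2⟩, Subtype.ext (hR y)⟩
  · intro x
    rw [Topology.IsInducing.subtypeVal.closure_eq_preimage_closure_image]
    refine closure_mono ?_ x.2
    intro y hy
    rw [SetLike.mem_coe, ← hD] at hy
    obtain ⟨w, hw, rfl⟩ := hy
    exact ⟨_, ⟨⟨w, D.le_topologicalClosure hw⟩, rfl⟩, rfl⟩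

/-- Near a boundary point `0` of the spectrum, either there is an almost-invariant halfspace, or
`0` can be removed from the spectrum by passing to the quotient by a finite-dimensional
subspace. -/
theorem hasAIHS1_or_exists_quotient_zero {T : X →L[ℂ] X} (hT : ¬IsUnit T)
    (hcl : (0 : ℂ) ∈ closure (spectrum ℂ T)ᶜ) :
    HasAIHS1 T ∨ ∃ (X' : Type u) (_ : NormedAddCommGroup X') (_ : NormedSpace ℂ X')
      (_ : CompleteSpace X') (T' : X' →L[ℂ] X'),
      (FiniteDimensional ℂ X' → FiniteDimensional ℂ X) ∧
      spectrum ℂ T' = spectrum ℂ T \ {0} ∧ (HasAIHS1 T' → HasAIHS1 T) := by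
  by_cases hker : FiniteDimensional ℂ (LinearMap.ker (T : X →ₗ[ℂ] X))
  swap
  · left
    have : CompleteSpace (LinearMap.ker (T : X →ₗ[ℂ] X)) := T.isClosed_ker.completeSpace_coe
    exact HasAIHS1.of_subspace T.isClosed_ker (S := 0) (fun x => x.2) (hasAIHS1_zero hker)
  obtain ⟨D, hD, hnil, J, hJ⟩ := exists_divisible_submodule (T : X →ₗ[ℂ] X) hker
  by_cases hD0 : D = ⊥
  swap
  · exact .inl (hasAIHS1_of_divisible_submodule hT hcl hD hnil hD0)
  subst hD0
  set K := LinearMap.ker ((T : X →ₗ[ℂ] X) ^ J)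
  have hKfin : FiniteDimensional ℂ K := finiteDimensional_ker_pow hker J
  have hKmem : ∀ x, x ∈ K ↔ T^[J] x = 0 := fun x => by
    rw [LinearMap.mem_ker, Module.End.pow_apply]; rfl
  have hKT : ∀ x, T x ∈ K → x ∈ K := fun x hx =>
    (hKmem x).2 ((Submodule.mem_bot ℂ).1 (hJ x (J + 1) ((hKmem _).1 hx)))
  have hTK : ∀ x ∈ K, T x ∈ K := fun x hx => by
    rw [hKmem] at *
    rw [← Function.iterate_succ_apply, Function.iterate_succ_apply', hx, map_zero]
  have hKc : IsClosed (K : Set X) := K.closed_of_finiteDimensional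
  let T' : X ⧸ K →L[ℂ] X ⧸ K := K.liftQL (K.mkQL.comp T) fun x hx =>
    (Submodule.Quotient.mk_eq_zero K).2 (hTK x hx)
  have hmk : ∀ x, K.mkQL x = 0 ↔ x ∈ K := fun x => Submodule.Quotient.mk_eq_zero K
  have hT' : ∀ x, T' (K.mkQL x) = K.mkQL (T x) := fun _ => rfl
  have hsurj : Function.Surjective K.mkQL := K.mkQ_surjective
  have hspec : ∀ {z : ℂ}, z ≠ 0 → (z ∈ spectrum ℂ T' ↔ z ∈ spectrum ℂ T) := fun hz =>
    mem_spectrum_quotient_iff hsurj hT'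
      (fun x hx => ⟨J, (hKmem x).1 ((hmk x).1 hx)⟩) hz
  have hlift : HasAIHS1 T' → HasAIHS1 T := HasAIHS1.of_quotient hsurj hT'
  by_cases hu : IsUnit T'
  · refine .inr ⟨X ⧸ K, inferInstance, inferInstance, inferInstance, T', fun hfin =>
      Module.Finite.of_submodule_quotient K, ?_, hlift⟩
    ext z
    by_cases hz : z = 0
    · subst hz
      simpa [spectrum.zero_mem_iff] using hu
    · simp [hspec hz, hz]
  · refine .inl (hlift (hasAIHS1_of_injective hu (closure_mono (fun z hz => ?_) hcl) ?_))
    · have hz0 : z ≠ 0 := by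
        rintro rfl
        exact hz ((spectrum.zero_mem_iff ℂ).2 hT)
      exact fun h => hz ((hspec hz0).1 h)
    · rw [injective_iff_map_eq_zero]
      intro q hq
      obtain ⟨x, rfl⟩ := hsurj q
      rw [hT', hmk] at hq
      exact (hmk x).2 (hKT x hq)

theorem hasAIHS1_or_exists_quotient {T : X →L[ℂ] X} {a : ℂ} (ha : a ∈ spectrum ℂ T)
    (hcl : a ∈ closure (spectrum ℂ T)ᶜ) :
    HasAIHS1 T ∨ ∃ (X' : Type u) (_ : NormedAddCommGroup X') (_ : NormedSpace ℂ X')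
      (_ : CompleteSpace X') (T' : X' →L[ℂ] X'),
      (FiniteDimensional ℂ X' → FiniteDimensional ℂ X) ∧
      spectrum ℂ T' = spectrum ℂ T \ {a} ∧ (HasAIHS1 T' → HasAIHS1 T) := by
  rcases hasAIHS1_or_exists_quotient_zero (T := T - algebraMap ℂ (X →L[ℂ] X) a) (by
      rw [← spectrum.zero_mem_iff ℂ, spectrum_sub_algebraMap, zero_add]; exact ha) (by
      have := mem_closure_image (f := fun z => z - a)
        (continuous_id.sub continuous_const).continuousAt hcl
      simp only [sub_self] at this
      refine closure_mono ?_ this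
      rintro _ ⟨z, hz, rfl⟩
      rw [mem_compl_iff, spectrum_sub_algebraMap, sub_add_cancel]
      exact hz) with h | ⟨X', _, _, _, S, hfin, hspec, hlift⟩
  · exact .inl (h.of_sub_smul a)
  · refine .inr ⟨X', inferInstance, inferInstance, inferInstance,
      S - algebraMap ℂ (X' →L[ℂ] X') (-a), hfin, ?_, fun h =>
        (hlift (h.of_sub_smul (-a))).of_sub_smul a⟩
    ext z
    rw [spectrum_sub_algebraMap, hspec]
    simp only [Set.mem_sdiff, spectrum_sub_algebraMap, mem_singleton_iff,
      ← sub_eq_add_neg, sub_add_cancel, sub_eq_zero]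

/-- An infinite compact subset of `ℂ` has an accumulation point on its boundary. -/
theorem exists_accPt_mem_closure_compl {K : Set ℂ} (hK : IsCompact K) (hinf : K.Infinite) :
    ∃ a ∈ K, AccPt a (𝓟 K) ∧ a ∈ closure Kᶜ := by
  have hsub : derivedSet K ⊆ K := (isClosed_iff_derivedSet_subset K).1 hK.isClosed
  have hcomp : IsCompact (derivedSet K) := hK.of_isClosed_subset (isClosed_derivedSet K) hsub
  obtain ⟨b, -, hb⟩ := hinf.exists_accPt_of_subset_isCompact hK Subset.rfl
  obtain ⟨a, ha, hmax⟩ := hcomp.exists_isMaxOn ⟨b, hb⟩ Complex.continuous_re.continuousOn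
  refine ⟨a, hsub ha, ha, Metric.mem_closure_iff.2 fun ε hε => ?_⟩
  have hnot : ¬AccPt (a + (ε / 2 : ℝ)) (𝓟 K) := by
    intro h
    have := hmax h
    simp only [mem_ofPred_eq, Complex.add_re, Complex.ofReal_re] at this
    linarith
  rw [accPt_iff_frequently, not_frequently] at hnot
  have hev : ∀ᶠ y in 𝓝[≠] (a + (ε / 2 : ℝ) : ℂ), y ∈ Kᶜ := by
    rw [eventually_nhdsWithin_iff]
    filter_upwards [hnot] with y hy hne hyK
    exact hy ⟨hne, hyK⟩
  have hball : ∀ᶠ y in 𝓝[≠] (a + (ε / 2 : ℝ) : ℂ), dist a y < ε := by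
    refine nhdsWithin_le_nhds ((continuous_const.dist continuous_id).continuousAt.eventually_lt
      continuousAt_const ?_)
    simp [dist_eq_norm, abs_of_pos hε]
    linarith
  obtain ⟨y, hy⟩ := (hev.and hball).exists
  exact ⟨y, hy⟩

theorem hasAIHS1_of_spectrum_infinite {T : X →L[ℂ] X} (h : (spectrum ℂ T).Infinite) :
    HasAIHS1 T := by
  obtain ⟨a, ha, hacc, hcl⟩ := exists_accPt_mem_closure_compl (spectrum.isCompact T) h
  refine (hasAIHS1_or_exists_quotient ha hcl).resolve_right ?_
  rintro ⟨X', _, _, _, T', -, hspec, -⟩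
  have hopen : (spectrum ℂ T')ᶜ ∈ 𝓝 a := (spectrum.isClosed T').isOpen_compl.mem_nhds (by
    rw [hspec]; simp)
  rw [accPt_iff_frequently] at hacc
  obtain ⟨y, ⟨hya, hy⟩, hy'⟩ := (hacc.and_eventually hopen).exists
  rw [hspec] at hy'
  exact hy' ⟨hy, hya⟩

theorem hasAIHS1_of_spectrum_finite : ∀ (n : ℕ) {X : Type u} [NormedAddCommGroup X]
    [NormedSpace ℂ X] [CompleteSpace X] (_ : ¬FiniteDimensional ℂ X) (T : X →L[ℂ] X)
    (_ : (spectrum ℂ T).Finite) (_ : (spectrum ℂ T).ncard = n), HasAIHS1 T := by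
  intro n
  induction n with
  | zero =>
    intro X _ _ _ hX T hfin hn
    have : Nontrivial X := not_subsingleton_iff_nontrivial.1 fun _ => hX inferInstance
    rw [ncard_eq_zero hfin] at hn
    exact absurd hn (spectrum.nonempty T).ne_empty
  | succ n ih =>
    intro X _ _ _ hX T hfin hn
    obtain ⟨a, ha⟩ := nonempty_of_ncard_ne_zero (s := spectrum ℂ T) (by omega)
    have hdense : Dense (spectrum ℂ T)ᶜ := hfin.countable.dense_compl ℂ
    rcases hasAIHS1_or_exists_quotient ha (hdense a) with h | ⟨X', _, _, _, T', hX', hspec, hlift⟩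
    · exact h
    · refine hlift (ih (fun h => hX (hX' h)) T' ?_ ?_)
      · rw [hspec]; exact hfin.sdiff
      · rw [hspec, ncard_sdiff_singleton_of_mem ha, hn, Nat.add_sub_cancel]

end Reduction

end AlmostInvariant

/-- If an operator `T` on an infinite-dimensional complex Banach space has at most
countably many eigenvalues, then it admits an almost-invariant halfspace of defect ≤ 1. -/
theorem aihs_of_countable_point_spectrum
    {X : Type*} [NormedAddCommGroup X] [NormedSpace ℂ X] [CompleteSpace X]
    (hX : ¬FiniteDimensional ℂ X) (T : X →L[ℂ] X)
    (hcount : {z : ℂ | ∃ x : X, x ≠ 0 ∧ T x = z • x}.Countable) :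
    HasAIHS1 T := by
  by_cases h : (spectrum ℂ T).Finite
  · exact AlmostInvariant.hasAIHS1_of_spectrum_finite _ hX T h rfl
  · exact AlmostInvariant.hasAIHS1_of_spectrum_infinite h
end

section
/- Let X be an infinite-dimensional complex Banach space and suppose S ∈ L(X) and T ∈ L(X) satisfy: (i) the point spectrum σ_p(S) is countable; (ii) S is not a scalar multiple of the identity, i.e. S ≠ μI for every μ ∈ ℂ; (iii) the adjoint T* ∈ L(X*) has empty point spectrum, σ_p(T*) = ∅; and (iv) ST = TS. Then T admits an almost-invariant halfspace of defect ≤ 1. -/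
open Filter Topology

/-- A vector space carrying a triangular system of functionals is infinite-dimensional. -/
theorem not_finiteDimensional_of_triangular {V : Type*} [AddCommGroup V] [Module ℂ V]
    (φ : ℕ → V →ₗ[ℂ] ℂ) (v : ℕ → V) (hd : ∀ n, φ n (v n) ≠ 0)
    (ht : ∀ i j, i < j → φ i (v j) = 0) : ¬FiniteDimensional ℂ V := by
  intro hfin
  have hanti : StrictAnti fun n : ℕ => ⨅ i : Fin n, LinearMap.ker (φ i) := by
    refine strictAnti_nat_of_succ_lt fun n => ?_
    refine SetLike.lt_iff_le_and_exists.2 ⟨fun x hx => ?_, v n, ?_, fun h => ?_⟩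
    · simp only [Submodule.mem_iInf, LinearMap.mem_ker] at hx ⊢
      exact fun i => hx i.castSucc
    · simp only [Submodule.mem_iInf, LinearMap.mem_ker]
      exact fun i => ht _ _ i.2
    · simp only [Submodule.mem_iInf, LinearMap.mem_ker] at h
      exact hd n (h (Fin.last n))
  obtain ⟨n, hn⟩ := WellFounded.not_rel_apply_succ
    (r := ((· < ·) : Submodule ℂ V → Submodule ℂ V → Prop))
    fun n : ℕ => ⨅ i : Fin n, LinearMap.ker (φ i)
  exact hn (hanti n.lt_succ_self)

/-- The coefficients, starting with `1` at index `k`, that solve the lower triangular system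
given by the rows of `a` of even index beyond `k`. -/
noncomputable def triangularCoeff (a : ℕ → ℕ → ℂ) (k : ℕ) : ℕ → ℂ
  | n => if n = k then 1 else
      if Even n ∧ k < n then -∑ j : Fin n, triangularCoeff a k j * a n j else 0
termination_by n => n
decreasing_by exact j.2

section TriangularCoeff

variable (a : ℕ → ℕ → ℂ) (k : ℕ)

theorem triangularCoeff_self : triangularCoeff a k k = 1 := by
  rw [triangularCoeff]; simp

theorem triangularCoeff_of_lt {n : ℕ} (h : n < k) : triangularCoeff a k n = 0 := by
  rw [triangularCoeff, if_neg h.ne, if_neg fun h' => by omega]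

theorem triangularCoeff_of_even {n : ℕ} (hn : Even n) (h : k < n) :
    triangularCoeff a k n = -∑ j ∈ Finset.range n, triangularCoeff a k j * a n j := by
  rw [triangularCoeff, if_neg h.ne', if_pos ⟨hn, h⟩, Finset.sum_range]

theorem norm_triangularCoeff_le
    (ha : ∀ i j, i < j → ‖a j i‖ ≤ ((j : ℝ) + 1)⁻¹ * (1 / 2) ^ j) (n : ℕ) :
    ‖triangularCoeff a k n‖ ≤ 1 ∧ (n ≠ k → ‖triangularCoeff a k n‖ ≤ (1 / 2) ^ n) := by
  induction n using Nat.strong_induction_on with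
  | _ n ih =>
    have hpow : ((1 : ℝ) / 2) ^ n ≤ 1 := pow_le_one₀ (by norm_num) (by norm_num)
    suffices h : n ≠ k → ‖triangularCoeff a k n‖ ≤ (1 / 2) ^ n by
      refine ⟨?_, h⟩
      by_cases hnk : n = k
      · subst hnk; simp [triangularCoeff_self]
      · exact (h hnk).trans hpow
    intro hnk
    rcases lt_or_gt_of_ne hnk with hlt | hgt
    · rw [triangularCoeff_of_lt a k hlt]; simp
    by_cases hev : Even n
    · rw [triangularCoeff_of_even a k hev hgt, norm_neg]
      calc ‖∑ j ∈ Finset.range n, triangularCoeff a k j * a n j‖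
          ≤ ∑ j ∈ Finset.range n, ((n : ℝ) + 1)⁻¹ * (1 / 2) ^ n := by
            refine norm_sum_le_of_le _ fun j hj => ?_
            have hj' := Finset.mem_range.1 hj
            rw [norm_mul]
            calc _ ≤ 1 * ‖a n j‖ := by gcongr; exact (ih j hj').1
              _ ≤ _ := by rw [one_mul]; exact ha j n hj'
        _ = (n * ((n : ℝ) + 1)⁻¹) * (1 / 2) ^ n := by simp [mul_assoc]
        _ ≤ 1 * (1 / 2) ^ n := by
            gcongr
            rw [← div_eq_mul_inv, div_le_one (by positivity)]
            linarith
        _ = _ := one_mul _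
    · rw [triangularCoeff, if_neg hnk, if_neg fun h' => hev h'.1]; simp

end TriangularCoeff

section AdjointResolvents

variable {X : Type*} [NormedAddCommGroup X] [NormedSpace ℂ X]

/-- For an almost biorthogonal triangular system, each `u k` with `k` odd can be perturbed to a
vector annihilated by all functionals of even index. -/
theorem exists_annihilated_by_even [CompleteSpace X] (u : ℕ → X) (g : ℕ → X →L[ℂ] ℂ)
    (hu : ∀ n, ‖u n‖ ≤ 1) (hd : ∀ n, g n (u n) = 1) (ht : ∀ i j, i < j → g i (u j) = 0)
    (hs : ∀ i j, i < j → ‖g j (u i)‖ ≤ ((j : ℝ) + 1)⁻¹ * (1 / 2) ^ j) (k : ℕ) (hk : Odd k) :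
    ∃ y : X, (∀ n, Even n → g n y = 0) ∧ g k y = 1 ∧ ∀ i, i < k → g i y = 0 := by
  set a : ℕ → ℕ → ℂ := fun n j => g n (u j) with ha
  set c := triangularCoeff a k with hc
  have hsum : Summable fun n => c n • u n := by
    refine Summable.of_norm_bounded_eventually_nat (g := fun n : ℕ => ((1 : ℝ) / 2) ^ n)
      (summable_geometric_of_lt_one (by norm_num) (by norm_num)) ?_
    filter_upwards [eventually_gt_atTop k] with n hn
    rw [norm_smul]
    calc ‖c n‖ * ‖u n‖ ≤ (1 / 2) ^ n * 1 := by
          gcongr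
          exacts [(norm_triangularCoeff_le a k hs n).2 hn.ne', hu n]
      _ = (1 / 2) ^ n := mul_one _
  have hval : ∀ n, g n (∑' j, c j • u j) = ∑ j ∈ Finset.range (n + 1), c j * g n (u j) := by
    intro n
    rw [(g n).map_tsum hsum, tsum_eq_sum (s := Finset.range (n + 1))]
    · simp
    · intro j hj
      have : n < j := by rw [Finset.mem_range] at hj; omega
      simp [ht n j this]
  have hlow : ∀ i, i < k → g i (∑' j, c j • u j) = 0 := by
    intro i hi
    rw [hval]
    refine Finset.sum_eq_zero fun j hj => ?_
    rw [hc, triangularCoeff_of_lt a k (by have := Finset.mem_range.1 hj; omega), zero_mul]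
  refine ⟨∑' j, c j • u j, fun n hn => ?_, ?_, hlow⟩
  · rcases lt_trichotomy n k with h | h | h
    · exact hlow n h
    · subst h; exact absurd hn (Nat.not_even_iff_odd.2 hk)
    · rw [hval, Finset.sum_range_succ, hd, mul_one]
      nth_rw 2 [hc]
      rw [triangularCoeff_of_even a k hn h]
      simp [ha, hc]
  · rw [hval, Finset.sum_range_succ, hd, mul_one, hc, triangularCoeff_self,
      Finset.sum_eq_zero, zero_add]
    intro j hj
    rw [triangularCoeff_of_lt a k (Finset.mem_range.1 hj), zero_mul]

/-- A pointwise null sequence of norm-one functionals stays bounded away from zero, in norm, on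
the joint kernel of finitely many functionals. -/
theorem exists_lower_bound_on_ker {h : ℕ → X →L[ℂ] ℂ} (h1 : ∀ m, ‖h m‖ = 1)
    (h0 : ∀ x, Tendsto (fun m => h m x) atTop (𝓝 0)) (s : Finset (X →L[ℂ] ℂ)) :
    ∃ c > (0 : ℝ), ∀ᶠ m in atTop, ∃ w : X, ‖w‖ ≤ 1 ∧ (∀ g ∈ s, g w = 0) ∧ c ≤ ‖h m w‖ := by
  classical
  induction s using Finset.induction_on with
  | empty =>
    refine ⟨1 / 2, by norm_num, Eventually.of_forall fun m => ?_⟩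
    obtain ⟨w, hw, hw'⟩ := (h m).exists_lt_apply_of_lt_opNorm (r := 1 / 2) (by rw [h1]; norm_num)
    exact ⟨w, hw.le, by simp, hw'.le⟩
  | insert g s _ ih =>
    obtain ⟨c, hc, hev⟩ := ih
    by_cases hg : ∀ x, (∀ g' ∈ s, g' x = 0) → g x = 0
    · refine ⟨c, hc, hev.mono ?_⟩
      rintro m ⟨w, hw, hws, hwc⟩
      refine ⟨w, hw, ?_, hwc⟩
      simpa using ⟨hg w hws, hws⟩
    push Not at hg
    obtain ⟨x, hxs, hx⟩ := hg
    set v : X := (g x)⁻¹ • x with hv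
    have hgv : g v = 1 := by simp [hv, hx]
    have hvs : ∀ g' ∈ s, g' v = 0 := fun g' hg' => by simp [hv, hxs g' hg']
    set K : ℝ := 1 + ‖g‖ * ‖v‖ with hK
    have hKpos : 0 < K := by positivity
    refine ⟨c / 2 / K, by positivity, ?_⟩
    have hsmall : ∀ᶠ m in atTop, ‖g‖ * ‖h m v‖ < c / 2 := by
      have := ((h0 v).norm).const_mul ‖g‖
      simp only [norm_zero, mul_zero] at this
      exact this.eventually_lt_const (by positivity)
    filter_upwards [hev, hsmall] with m hm hsm
    obtain ⟨w, hw, hws, hwc⟩ := hm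
    have hgw : ‖g w‖ ≤ ‖g‖ := by
      calc ‖g w‖ ≤ ‖g‖ * ‖w‖ := g.le_opNorm w
        _ ≤ ‖g‖ * 1 := by gcongr
        _ = _ := mul_one _
    refine ⟨((K⁻¹ : ℝ) : ℂ) • (w - g w • v), ?_, ?_, ?_⟩
    · rw [norm_smul, Complex.norm_real, Real.norm_of_nonneg (by positivity), inv_mul_le_iff₀ hKpos,
        mul_one]
      calc _ ≤ ‖w‖ + ‖g w • v‖ := norm_sub_le _ _
        _ ≤ 1 + ‖g‖ * ‖v‖ := by rw [norm_smul]; gcongr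
    · intro g' hg'
      rcases Finset.mem_insert.1 hg' with rfl | hg'
      · simp [hgv]
      · simp [hws g' hg', hvs g' hg']
    · rw [map_smul, norm_smul, Complex.norm_real, Real.norm_of_nonneg (by positivity), mul_comm,
        ← div_eq_mul_inv]
      gcongr
      have h2 : ‖h m (g w • v)‖ ≤ ‖g‖ * ‖h m v‖ := by
        rw [map_smul, norm_smul]; gcongr
      have h3 := norm_sub_norm_le (h m w) (h m (g w • v))
      rw [← map_sub] at h3
      linarith

/-- From a pointwise null sequence of norm-one functionals one can extract, up to scaling, a
subsequence which is part of an almost biorthogonal triangular system. -/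
theorem exists_triangular_system {h : ℕ → X →L[ℂ] ℂ} (h1 : ∀ m, ‖h m‖ = 1)
    (h0 : ∀ x, Tendsto (fun m => h m x) atTop (𝓝 0)) :
    ∃ (u : ℕ → X) (g : ℕ → X →L[ℂ] ℂ), (∀ n, ‖u n‖ ≤ 1) ∧ (∀ n, g n (u n) = 1) ∧
      (∀ n, ∃ (m : ℕ) (c : ℂ), g n = c • h m) ∧ (∀ i j, i < j → g i (u j) = 0) ∧
      ∀ i j, i < j → ‖g j (u i)‖ ≤ ((j : ℝ) + 1)⁻¹ * (1 / 2) ^ j := by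
  classical
  obtain ⟨q, hP, hr⟩ := exists_seq_of_forall_finset_exists
    (fun p : ℕ × X × (X →L[ℂ] ℂ) => ‖p.2.1‖ ≤ 1 ∧ p.2.2 p.2.1 = 1 ∧ ∃ (m : ℕ) (c : ℂ),
      p.2.2 = c • h m)
    (fun p p' => p.1 < p'.1 ∧ p.2.2 p'.2.1 = 0 ∧
      ‖p'.2.2 p.2.1‖ ≤ ((p'.1 : ℝ) + 1)⁻¹ * (1 / 2) ^ p'.1) (by
    intro s _
    obtain ⟨c, hc, hev⟩ := exists_lower_bound_on_ker h1 h0 (s.image fun p => p.2.2)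
    set t : ℕ := s.sup (fun p => p.1) + 1 with ht
    have hδ : 0 < c * (((t : ℝ) + 1)⁻¹ * (1 / 2) ^ t) := by positivity
    have hsmall : ∀ᶠ m in atTop, ∀ p ∈ s,
        ‖h m p.2.1‖ < c * (((t : ℝ) + 1)⁻¹ * (1 / 2) ^ t) := by
      rw [Filter.eventually_all_finset]
      intro p _
      have := (h0 p.2.1).norm
      rw [norm_zero] at this
      exact this.eventually_lt_const hδ
    obtain ⟨m, ⟨w, hw, hws, hwc⟩, hm⟩ := (hev.and hsmall).exists
    have hne : h m w ≠ 0 := norm_pos_iff.1 (hc.trans_le hwc)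
    refine ⟨(t, w, (h m w)⁻¹ • h m), ⟨hw, by simp [hne], m, _, rfl⟩, fun p hp => ⟨?_, ?_, ?_⟩⟩
    · exact Nat.lt_succ_of_le (Finset.le_sup (f := fun p : ℕ × X × (X →L[ℂ] ℂ) => p.1) hp)
    · exact hws _ (Finset.mem_image_of_mem _ hp)
    · simp only [smul_apply, norm_smul, norm_inv]
      rw [inv_mul_le_iff₀ (hc.trans_le hwc)]
      exact (hm p hp).le.trans (by gcongr))
  have hmono : StrictMono fun n => (q n).1 := fun i j hij => (hr i j hij).1
  refine ⟨fun n => (q n).2.1, fun n => (q n).2.2, fun n => (hP n).1, fun n => (hP n).2.1,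
    fun n => (hP n).2.2, fun i j hij => (hr i j hij).2.1, fun i j hij => ?_⟩
  have hj : j ≤ (q j).1 := hmono.id_le j
  refine (hr i j hij).2.2.trans ?_
  have : ((1 : ℝ) / 2) ^ (q j).1 ≤ (1 / 2) ^ j :=
    pow_le_pow_of_le_one (by norm_num) (by norm_num) hj
  gcongr

/-- A pointwise null sequence of norm-one functionals has, up to scaling, a subsequence whose
joint kernel is a halfspace. -/
theorem exists_isHalfspace_iInf_ker [CompleteSpace X] {h : ℕ → X →L[ℂ] ℂ} (h1 : ∀ m, ‖h m‖ = 1)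
    (h0 : ∀ x, Tendsto (fun m => h m x) atTop (𝓝 0)) :
    ∃ g : ℕ → X →L[ℂ] ℂ, (∀ n, ∃ (m : ℕ) (c : ℂ), g n = c • h m) ∧
      IsHalfspace (⨅ n, LinearMap.ker (g n : X →ₗ[ℂ] ℂ)) := by
  obtain ⟨u, g, hu, hd, hgh, ht, hs⟩ := exists_triangular_system h1 h0
  choose y hy0 hy1 hyt using fun k : ℕ =>
    exists_annihilated_by_even u g hu hd ht hs (2 * k + 1) ⟨k, rfl⟩
  set Y : Submodule ℂ X := ⨅ n, LinearMap.ker (g (2 * n) : X →ₗ[ℂ] ℂ) with hY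
  refine ⟨fun n => g (2 * n), fun n => hgh (2 * n), ?_, ?_, ?_⟩
  · rw [Submodule.coe_iInf]
    exact isClosed_iInter fun n => (g (2 * n)).isClosed_ker
  · refine not_finiteDimensional_of_triangular
      (fun n => (g (2 * n + 1) : X →ₗ[ℂ] ℂ) ∘ₗ Y.subtype)
      (fun k => ⟨y k, ?_⟩) (fun n => ?_) fun i j hij => ?_
    · simp only [Submodule.mem_iInf]
      exact fun n => hy0 k _ (even_two_mul n)
    · simp [hy1]
    · exact hyt j _ (by omega)
  · refine not_finiteDimensional_of_triangular
      (fun n => Y.liftQ (g (2 * n) : X →ₗ[ℂ] ℂ) (iInf_le _ n))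
      (fun n => Y.mkQ (u (2 * n))) (fun n => ?_) fun i j hij => ?_
    · simp [hd]
    · simpa using ht _ _ (by omega)

/-- The joint kernel of functionals `g n` with `g n ∘ (z n - T) = d n • f` has defect at most one. -/
theorem exists_defect_le_one_iInf_ker (T : X →L[ℂ] X) (f : X →L[ℂ] ℂ) (z : ℕ → ℂ)
    (g : ℕ → X →L[ℂ] ℂ) (d : ℕ → ℂ) (hg : ∀ n x, g n (z n • x - T x) = d n * f x) :
    ∃ E : Submodule ℂ X, FiniteDimensional ℂ E ∧ Module.finrank ℂ E ≤ 1 ∧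
      ∀ y ∈ (⨅ n, LinearMap.ker (g n : X →ₗ[ℂ] ℂ)),
        T y ∈ (⨅ n, LinearMap.ker (g n : X →ₗ[ℂ] ℂ)) ⊔ E := by
  set Y : Submodule ℂ X := ⨅ n, LinearMap.ker (g n : X →ₗ[ℂ] ℂ) with hY
  have hmem : ∀ x, x ∈ Y ↔ ∀ n, g n x = 0 := by simp [hY]
  have hT : ∀ y ∈ Y, ∀ n, g n (T y) = -(d n * f y) := by
    intro y hy n
    have := hg n y
    rw [map_sub, map_smul, (hmem y).1 hy n, smul_zero, zero_sub] at this
    rw [← this, neg_neg]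
  by_cases hf : ∀ y ∈ Y, f y = 0
  · refine ⟨⊥, inferInstance, by simp, fun y hy => ?_⟩
    rw [sup_bot_eq, hmem]
    intro n
    rw [hT y hy, hf y hy, mul_zero, neg_zero]
  push Not at hf
  obtain ⟨y₀, hy₀, hfy₀⟩ := hf
  refine ⟨ℂ ∙ T y₀, inferInstance, by simpa using finrank_span_le_card (R := ℂ) {T y₀},
    fun y hy => ?_⟩
  refine Submodule.mem_sup.2 ⟨T y - (f y / f y₀) • T y₀, ?_, (f y / f y₀) • T y₀,
    Submodule.smul_mem _ _ (Submodule.mem_span_singleton_self _), sub_add_cancel _ _⟩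
  rw [hmem]
  intro n
  rw [map_sub, map_smul, hT y hy, hT y₀ hy₀, smul_eq_mul]
  field_simp
  ring

/-- If `T*` has no eigenvalue `z`, then `z - T` has dense range. -/
theorem dense_range_smul_sub (T : X →L[ℂ] X) (z : ℂ)
    (hT : ∀ f : X →L[ℂ] ℂ, f ≠ 0 → f.comp T ≠ z • f) :
    DenseRange fun x => z • x - T x := by
  set A : X →L[ℂ] X := z • (1 : X →L[ℂ] X) - T with hA
  set R : Submodule ℂ X := (LinearMap.range (A : X →ₗ[ℂ] X)).topologicalClosure with hR
  have hmem : ∀ x, z • x - T x ∈ R := fun x =>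
    Submodule.le_topologicalClosure _ ⟨x, by simp [hA]⟩
  have htop : ∀ x, x ∈ R := by
    by_contra! hne
    obtain ⟨x, hx⟩ := hne
    have : IsClosed (R : Set X) := Submodule.isClosed_topologicalClosure _
    have hx' : R.mkQ x ≠ 0 := by simpa using hx
    obtain ⟨φ, hφ⟩ := SeparatingDual.exists_ne_zero (R := ℂ) hx'
    refine hT (φ.comp R.mkQL) (fun h => hφ (by simpa using DFunLike.congr_fun h x)) ?_
    ext y
    have hy : R.mkQ (z • y - T y) = 0 := (Submodule.Quotient.mk_eq_zero R).2 (hmem y)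
    rw [map_sub, map_smul, sub_eq_zero] at hy
    have := congrArg φ hy
    simpa using this.symm
  intro x
  refine closure_mono ?_ (htop x)
  rintro _ ⟨y, rfl⟩
  exact ⟨y, by simp [hA]⟩

/-- Near a boundary point of the spectrum, some functional has unbounded images under the adjoint
resolvents. -/
theorem exists_unbounded_comp_inverse [CompleteSpace X] (A : X →L[ℂ] X) (hA : ¬IsUnit A)
    (U : ℕ → (X →L[ℂ] X)ˣ) (hU : Tendsto (fun n => (U n : X →L[ℂ] X)) atTop (𝓝 A)) :
    ∃ f : X →L[ℂ] ℂ, ∀ C : ℝ, ∃ n, C < ‖f.comp (↑(U n)⁻¹ : X →L[ℂ] X)‖ := by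
  by_contra! hcon
  obtain ⟨C, hC⟩ := banach_steinhaus
    (g := fun n => (ContinuousLinearMap.compL ℂ X X ℂ).flip (↑(U n)⁻¹ : X →L[ℂ] X))
    (fun f => by simpa using hcon f)
  have hC0 : 0 ≤ C := (norm_nonneg _).trans (hC 0)
  have hbound : ∀ n, ‖(↑(U n)⁻¹ : X →L[ℂ] X)‖ ≤ C := by
    intro n
    refine ContinuousLinearMap.opNorm_le_bound _ hC0 fun x => ?_
    refine NormedSpace.norm_le_dual_bound ℂ _ (by positivity) fun f => ?_
    have h1 : ‖f.comp (↑(U n)⁻¹ : X →L[ℂ] X)‖ ≤ C * ‖f‖ := by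
      simpa using ContinuousLinearMap.le_of_opNorm_le _ (hC n) f
    calc ‖f ((↑(U n)⁻¹ : X →L[ℂ] X) x)‖ ≤ ‖f.comp (↑(U n)⁻¹ : X →L[ℂ] X)‖ * ‖x‖ :=
          (f.comp (↑(U n)⁻¹ : X →L[ℂ] X)).le_opNorm x
      _ ≤ C * ‖f‖ * ‖x‖ := by gcongr
      _ = _ := by ring
  have hclose : ∀ᶠ n in atTop, ‖A - U n‖ < (C + 1)⁻¹ := by
    have := (tendsto_iff_norm_sub_tendsto_zero.1 hU)
    simp only [norm_sub_rev] at this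
    exact this.eventually_lt_const (by positivity)
  obtain ⟨n, hn⟩ := hclose.exists
  have hX : Nontrivial (X →L[ℂ] X) := by
    by_contra hX
    rw [not_nontrivial_iff_subsingleton] at hX
    exact hA (isUnit_of_subsingleton A)
  have hpos : 0 < ‖(↑(U n)⁻¹ : X →L[ℂ] X)‖ := Units.norm_pos _
  refine hA ⟨(U n).ofNearby A (hn.trans_le ?_), rfl⟩
  gcongr
  linarith [hbound n]

/-- Normalized functionals `F k` with `F k ∘ (z k - T) = f` and `‖F k‖ → ∞` tend to zero pointwise
if `z k → l` and `l - T` has dense range. -/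
theorem tendsto_normalized_apply_zero (T : X →L[ℂ] X) (f : X →L[ℂ] ℂ) (F : ℕ → X →L[ℂ] ℂ)
    {z : ℕ → ℂ} {l : ℂ} (hz : Tendsto z atTop (𝓝 l)) (hF : ∀ k x, F k (z k • x - T x) = f x)
    (hinf : Tendsto (fun k => ‖F k‖) atTop atTop) (hdense : DenseRange fun x => l • x - T x)
    (x : X) : Tendsto (fun k => (((‖F k‖⁻¹ : ℝ) : ℂ) • F k) x) atTop (𝓝 0) := by
  have hinv : Tendsto (fun k => ((‖F k‖⁻¹ : ℝ) : ℂ)) atTop (𝓝 0) := by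
    rw [← Complex.ofReal_zero]
    exact (Complex.continuous_ofReal.tendsto 0).comp hinf.inv_tendsto_atTop
  set h : ℕ → X →L[ℂ] ℂ := fun k => ((‖F k‖⁻¹ : ℝ) : ℂ) • F k with hh
  have hnorm : ∀ k, ‖h k‖ ≤ 1 := fun k => by
    simpa [hh, norm_smul] using inv_mul_le_one (a := ‖F k‖)
  have hle : ∀ k x, ‖h k x‖ ≤ ‖x‖ := fun k x => by
    simpa using (h k).le_of_opNorm_le (hnorm k) x
  have hrange : ∀ x, Tendsto (fun k => h k (l • x - T x)) atTop (𝓝 0) := by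
    intro x
    have heq : ∀ k, h k (l • x - T x) = (l - z k) * h k x + ((‖F k‖⁻¹ : ℝ) : ℂ) * f x := by
      intro k
      have hsplit : l • x - T x = (l - z k) • x + (z k • x - T x) := by
        rw [sub_smul]; abel
      have hk : h k (z k • x - T x) = ((‖F k‖⁻¹ : ℝ) : ℂ) * f x := by
        rw [← hF k x]; rfl
      rw [hsplit, map_add, map_smul, smul_eq_mul, hk]
    simp only [heq]
    rw [← add_zero (0 : ℂ)]
    refine Tendsto.add ?_ (by simpa only [zero_mul] using hinv.mul_const (f x))
    have hz0 : Tendsto (fun k => ‖l - z k‖ * ‖x‖) atTop (𝓝 0) := by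
      simpa using ((hz.const_sub l).norm).mul_const ‖x‖
    refine squeeze_zero_norm (fun k => ?_) hz0
    rw [norm_mul]
    gcongr
    exact hle k x
  rw [Metric.tendsto_nhds]
  intro ε hε
  obtain ⟨w, hw⟩ := hdense.exists_dist_lt x (half_pos hε)
  filter_upwards [Metric.tendsto_nhds.1 (hrange w) _ (half_pos hε)] with k hk
  change dist (h k x) 0 < ε
  rw [dist_zero_right] at hk ⊢
  have h2 := hle k (x - (l • w - T w))
  rw [← dist_eq_norm] at h2
  have h3 : h k x = h k (x - (l • w - T w)) + h k (l • w - T w) := by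
    rw [← map_add, sub_add_cancel]
  rw [h3]
  exact (norm_add_le _ _).trans_lt (by linarith)

/-- There are a functional `f` and points `z k` of the resolvent set tending to a point of the
spectrum along which the images of `f` under the adjoint resolvent tend to infinity in norm. -/
theorem exists_adjoint_resolvents_tendsto_atTop [CompleteSpace X] [Nontrivial X]
    (T : X →L[ℂ] X) : ∃ (l : ℂ) (z : ℕ → ℂ) (f : X →L[ℂ] ℂ) (F : ℕ → X →L[ℂ] ℂ),
      Tendsto z atTop (𝓝 l) ∧ (∀ k x, F k (z k • x - T x) = f x) ∧ (∀ k, F k ≠ 0) ∧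
      Tendsto (fun k => ‖F k‖) atTop atTop := by
  obtain ⟨l, hl⟩ : (frontier (spectrum ℂ T)).Nonempty := by
    refine nonempty_frontier_iff.2 ⟨spectrum.nonempty T, fun h => ?_⟩
    exact noncompact_univ ℂ (h ▸ spectrum.isCompact T)
  have hlmem : l ∈ spectrum ℂ T := (spectrum.isClosed T).frontier_subset hl
  obtain ⟨z, hz, hzl⟩ := mem_closure_iff_seq_limit.1
    (frontier_subset_closure (frontier_compl (spectrum ℂ T) ▸ hl))
  choose U hU using fun n =>
    (spectrum.notMem_iff.1 (hz n) : IsUnit (algebraMap ℂ (X →L[ℂ] X) (z n) - T))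
  have hUlim : Tendsto (fun n => (U n : X →L[ℂ] X)) atTop
      (𝓝 (algebraMap ℂ (X →L[ℂ] X) l - T)) := by
    simp only [hU]
    exact (((continuous_algebraMap ℂ (X →L[ℂ] X)).tendsto l).comp hzl).sub_const T
  obtain ⟨f, hf⟩ := exists_unbounded_comp_inverse _ (spectrum.mem_iff.1 hlmem) U hUlim
  set F : ℕ → X →L[ℂ] ℂ := fun n => f.comp (↑(U n)⁻¹ : X →L[ℂ] X) with hF
  have hFz : ∀ n x, F n (z n • x - T x) = f x := by
    intro n x
    have h1 : (U n : X →L[ℂ] X) x = z n • x - T x := by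
      rw [hU, Algebra.algebraMap_eq_smul_one]; rfl
    have h2 : (↑(U n)⁻¹ : X →L[ℂ] X) ((U n : X →L[ℂ] X) x) = x :=
      DFunLike.congr_fun (U n).inv_mul x
    rw [← h1]
    exact congrArg f h2
  have hsub : ∀ k : ℕ, ∃ n, k ≤ n ∧ (k : ℝ) < ‖F n‖ := by
    intro k
    obtain ⟨n, hn⟩ := hf (k + ∑ i ∈ Finset.range k, ‖F i‖)
    change _ < ‖F n‖ at hn
    have hs : 0 ≤ ∑ i ∈ Finset.range k, ‖F i‖ := Finset.sum_nonneg fun i _ => norm_nonneg _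
    refine ⟨n, ?_, by linarith⟩
    by_contra! hnk
    have hle : ‖F n‖ ≤ ∑ i ∈ Finset.range k, ‖F i‖ :=
      Finset.single_le_sum (f := fun i => ‖F i‖) (fun i _ => norm_nonneg _)
        (Finset.mem_range.2 hnk)
    have hk : (0 : ℝ) ≤ k := Nat.cast_nonneg k
    linarith
  choose N hkN hN using hsub
  exact ⟨l, fun k => z (N k), f, fun k => F (N k), hzl.comp (tendsto_atTop_mono hkN tendsto_id),
    fun k => hFz (N k), fun k => norm_pos_iff.1 ((Nat.cast_nonneg k).trans_lt (hN k)),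
    tendsto_atTop_mono (fun k => (hN k).le) tendsto_natCast_atTop_atTop⟩

/-- If `T*` has empty point spectrum, then `T` has an almost-invariant halfspace of defect at
most one. -/
theorem hasAIHS1_of_adjoint_pointSpectrum_empty [CompleteSpace X] [Nontrivial X] (T : X →L[ℂ] X)
    (hT : ∀ (z : ℂ) (f : X →L[ℂ] ℂ), f ≠ 0 → f.comp T ≠ z • f) : HasAIHS1 T := by
  obtain ⟨l, z, f, F, hz, hF, hne, hinf⟩ := exists_adjoint_resolvents_tendsto_atTop T
  obtain ⟨g, hg, hhalf⟩ := exists_isHalfspace_iInf_ker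
    (h := fun k => ((‖F k‖⁻¹ : ℝ) : ℂ) • F k) (fun k => by simp [norm_smul, hne k])
    (tendsto_normalized_apply_zero T f F hz hF hinf (dense_range_smul_sub T l (hT l)))
  choose m c hgm using hg
  refine ⟨_, hhalf, exists_defect_le_one_iInf_ker T f (fun n => z (m n)) g
    (fun n => c n * ((‖F (m n)‖⁻¹ : ℝ) : ℂ)) fun n x => ?_⟩
  rw [hgm, ← hF (m n) x, mul_assoc]
  rfl

end AdjointResolvents

/-- If `S` has countable point spectrum, is not a multiple of the identity,
`T` has an adjoint with empty point spectrum (no `0 ≠ f ∈ X*` satisfies `f ∘ T = z • f`),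
and `S` commutes with `T`, then `T` admits an AIHS of defect ≤ 1. -/
theorem aihs_of_commuting_with_countable_point_spectrum
    {X : Type*} [NormedAddCommGroup X] [NormedSpace ℂ X] [CompleteSpace X]
    (hX : ¬FiniteDimensional ℂ X) (S T : X →L[ℂ] X)
    (hSp : {z : ℂ | ∃ x : X, x ≠ 0 ∧ S x = z • x}.Countable)
    (hSnotscalar : ∀ μ : ℂ, S ≠ μ • (1 : X →L[ℂ] X))
    (hTadj : ∀ (z : ℂ) (f : X →L[ℂ] ℂ), f ≠ 0 → f.comp T ≠ z • f)
    (hcomm : S * T = T * S) :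
    HasAIHS1 T := by
  have : Nontrivial X := by
    by_contra hX'
    rw [not_nontrivial_iff_subsingleton] at hX'
    exact hX inferInstance
  exact hasAIHS1_of_adjoint_pointSpectrum_empty T hTadj
end

section
/- Let X be an infinite-dimensional complex Banach space and T ∈ L(X). If (i) the adjoint T* ∈ L(X*) has empty point spectrum, σ_p(T*) = ∅, and (ii) T commutes with a nonzero strictly singular operator S ∈ L(X), then T admits an almost-invariant halfspace of defect ≤ 1. -/
/-- `S` is strictly singular: its restriction to any infinite-dimensional closed
subspace is not bounded below. -/
def StrictlySingular {X : Type*} [NormedAddCommGroup X] [NormedSpace ℂ X]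
    (S : X →L[ℂ] X) : Prop :=
  ∀ Y : Submodule ℂ X, IsClosed (Y : Set X) → ¬FiniteDimensional ℂ Y →
    ¬∃ c : ℝ, 0 < c ∧ ∀ y ∈ Y, c * ‖y‖ ≤ ‖S y‖

open Filter Topology

section BiorthogonalSystems

variable {X : Type*} [NormedAddCommGroup X] [NormedSpace ℂ X]

lemma not_finiteDimensional_of_biorthogonal {V : Type*} [AddCommGroup V] [Module ℂ V]
    (ψ : ℕ → V →ₗ[ℂ] ℂ) (v : ℕ → V) (h : ∀ i j, ψ i (v j) = if i = j then 1 else 0) :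
    ¬FiniteDimensional ℂ V := by
  intro hV
  have hli : LinearIndependent ℂ v := by
    rw [linearIndependent_iff']
    intro s a hs i hi
    simpa [map_sum, h, hi] using congrArg (ψ i) hs
  exact Infinite.not_finite (hli.finite : Finite ℕ)

/-- Given a biorthogonal system, the common kernel of every second functional is a halfspace. -/
lemma isHalfspace_iInf_ker_of_biorthogonal (φ : ℕ → X →L[ℂ] ℂ) (z : ℕ → X)
    (h : ∀ i j, φ i (z j) = if i = j then 1 else 0) :
    IsHalfspace (⨅ i, LinearMap.ker (φ (2 * i)).toLinearMap) := by
  set Y : Submodule ℂ X := ⨅ i, LinearMap.ker (φ (2 * i)).toLinearMap with hY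
  have mem : ∀ x, x ∈ Y ↔ ∀ i, φ (2 * i) x = 0 := fun x ↦ by simp [hY, Submodule.mem_iInf]
  refine ⟨?_, ?_, ?_⟩
  · have : (Y : Set X) = ⋂ i, {x | φ (2 * i) x = 0} := by
      ext x; simp [mem]
    rw [this]
    exact isClosed_iInter fun i ↦ isClosed_eq (φ (2 * i)).continuous continuous_const
  · have hz : ∀ j, z (2 * j + 1) ∈ Y := fun j ↦ (mem _).2 fun i ↦ by
      rw [h, if_neg (by omega)]
    refine not_finiteDimensional_of_biorthogonal
      (fun i ↦ (φ (2 * i + 1)).toLinearMap ∘ₗ Y.subtype) (fun j ↦ ⟨z (2 * j + 1), hz j⟩) ?_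
    intro i j
    simp [h]
  · refine not_finiteDimensional_of_biorthogonal
      (fun i ↦ Y.liftQ (φ (2 * i)).toLinearMap (iInf_le _ i))
      (fun j ↦ Y.mkQ (z (2 * j))) ?_
    intro i j
    simp [h]

/-- If `φ i` are approximate eigenvectors of the adjoint with all errors in the direction of a
single functional `g`, then `T` is almost invariant of defect one on their common kernel. -/
lemma exists_defect_of_comp_eq (T : X →L[ℂ] X) (φ : ℕ → X →L[ℂ] ℂ) (g : X →L[ℂ] ℂ)
    (h : ∀ i, ∃ l c : ℂ, (φ i).comp T = l • φ i + c • g) :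
    ∃ E : Submodule ℂ X, FiniteDimensional ℂ E ∧ Module.finrank ℂ E ≤ 1 ∧
      ∀ y ∈ (⨅ i, LinearMap.ker (φ i).toLinearMap : Submodule ℂ X),
        T y ∈ (⨅ i, LinearMap.ker (φ i).toLinearMap : Submodule ℂ X) ⊔ E := by
  set Y : Submodule ℂ X := ⨅ i, LinearMap.ker (φ i).toLinearMap with hY
  have mem : ∀ x, x ∈ Y ↔ ∀ i, φ i x = 0 := fun x ↦ by simp [hY, Submodule.mem_iInf]
  have key : ∀ y ∈ Y, g y = 0 → T y ∈ Y := by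
    intro y hy hg
    refine (mem _).2 fun i ↦ ?_
    obtain ⟨l, c, hlc⟩ := h i
    simpa [(mem y).1 hy i, hg] using DFunLike.congr_fun hlc y
  by_cases hg : ∀ y ∈ Y, g y = 0
  · exact ⟨⊥, inferInstance, by simp, fun y hy ↦ Submodule.mem_sup_left (key y hy (hg y hy))⟩
  push Not at hg
  obtain ⟨y₀, hy₀, hgy₀⟩ := hg
  refine ⟨ℂ ∙ T y₀, inferInstance, finrank_span_le_card _ |>.trans (by simp), fun y hy ↦ ?_⟩
  have h1 : T (y - (g y / g y₀) • y₀) ∈ Y :=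
    key _ (Y.sub_mem hy (Y.smul_mem _ hy₀)) (by simp [hgy₀])
  have h2 : T y = T (y - (g y / g y₀) • y₀) + (g y / g y₀) • T y₀ := by simp
  rw [h2]
  exact Submodule.add_mem_sup h1 (Submodule.smul_mem _ _ (Submodule.mem_span_singleton_self _))

lemma tendsto_norm_comp_of_tendsto_apply {V : Type*} [NormedAddCommGroup V] [NormedSpace ℂ V]
    [FiniteDimensional ℂ V] (f : ℕ → X →L[ℂ] ℂ) (hf : ∀ x, Tendsto (fun n ↦ f n x) atTop (𝓝 0))
    (L : V →L[ℂ] X) : Tendsto (fun n ↦ ‖(f n).comp L‖) atTop (𝓝 0) := by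
  obtain ⟨C, -, hC⟩ := (Module.finBasis ℂ V).exists_opNorm_le (F := ℂ)
  refine squeeze_zero (fun n ↦ norm_nonneg _) (fun n ↦ hC (u := (f n).comp L)
    (M := ∑ i, ‖f n (L (Module.finBasis ℂ V i))‖) (by positivity) fun i ↦ ?_) ?_
  · exact Finset.single_le_sum (f := fun i ↦ ‖f n (L (Module.finBasis ℂ V i))‖)
      (fun _ _ ↦ norm_nonneg _) (Finset.mem_univ i)
  · simpa using (tendsto_finsetSum Finset.univ fun i _ ↦
      (hf (L (Module.finBasis ℂ V i))).norm).const_mul C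

/-- There is a bounded operator into the common kernel of finitely many functionals which differs
from the identity by an operator factoring through a finite-dimensional space. -/
lemma exists_operator_into_ker (s : Finset (X →L[ℂ] ℂ)) :
    ∃ P : X →L[ℂ] X, (∀ φ ∈ s, ∀ x, φ (P x) = 0) ∧
      ∃ (V : Submodule ℂ (s → ℂ)) (A : X →L[ℂ] V) (B : V →L[ℂ] X),
        P = ContinuousLinearMap.id ℂ X - B.comp A := by
  let Φ : X →L[ℂ] (s → ℂ) := ContinuousLinearMap.pi fun φ ↦ φ.1
  let V : Submodule ℂ (s → ℂ) := LinearMap.range Φ.toLinearMap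
  let A : X →L[ℂ] V := Φ.codRestrict V fun x ↦ ⟨x, rfl⟩
  have hA : A.range = ⊤ := by
    refine LinearMap.range_eq_top.2 ?_
    rintro ⟨_, x, rfl⟩
    exact ⟨x, rfl⟩
  obtain ⟨B, hB⟩ := A.exists_rightInverse_of_surjective hA
  refine ⟨_, ?_, V, A, B, rfl⟩
  intro φ hφ x
  have h1 : A (B (A x)) = A x := DFunLike.congr_fun hB (A x)
  have h2 : φ (B (A x)) = φ x := congrFun (congrArg Subtype.val h1) ⟨φ, hφ⟩
  simp [h2]

/-- Norm-one functionals tending to zero pointwise remain uniformly bounded below on the common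
kernel of finitely many functionals. -/
lemma exists_unit_vector_in_ker (f : ℕ → X →L[ℂ] ℂ) (hf1 : ∀ n, ‖f n‖ = 1)
    (hf : ∀ x, Tendsto (fun n ↦ f n x) atTop (𝓝 0)) (s : Finset (X →L[ℂ] ℂ)) :
    ∃ d > (0 : ℝ), ∀ᶠ n in atTop, ∃ u : X, ‖u‖ = 1 ∧ (∀ φ ∈ s, φ u = 0) ∧ d ≤ ‖f n u‖ := by
  obtain ⟨P, hPs, V, A, B, hP⟩ := exists_operator_into_ker s
  have hlim : Tendsto (fun n ↦ ‖(f n).comp B‖ * ‖A‖) atTop (𝓝 0) := by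
    simpa using (tendsto_norm_comp_of_tendsto_apply f hf B).mul_const ‖A‖
  refine ⟨1 / (2 * (‖P‖ + 1)), by positivity, ?_⟩
  filter_upwards [hlim.eventually_lt_const (show (0 : ℝ) < 1 / 4 by norm_num)] with n hn
  have h1 : 1 / 2 < ‖(f n).comp P‖ := by
    have e : f n = (f n).comp P + ((f n).comp B).comp A := by
      ext x; simp [hP]
    have := norm_add_le ((f n).comp P) (((f n).comp B).comp A)
    rw [← e, hf1] at this
    have := ((f n).comp B).opNorm_comp_le A
    linarith
  obtain ⟨x, hx⟩ : ∃ x, 1 / 2 * ‖x‖ < ‖f n (P x)‖ := by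
    by_contra! hcon
    exact absurd (ContinuousLinearMap.opNorm_le_bound _ (by norm_num) hcon) (not_le.2 h1)
  have hPx : 0 < ‖P x‖ := by
    rw [norm_pos_iff]
    intro h0
    rw [h0, map_zero, norm_zero] at hx
    linarith [norm_nonneg x]
  refine ⟨((‖P x‖⁻¹ : ℝ) : ℂ) • P x, ?_, fun φ hφ ↦ by simp [hPs φ hφ], ?_⟩
  · simp [norm_smul, hPx.ne']
  · rw [map_smul, norm_smul, Complex.norm_real, norm_inv, norm_norm, div_le_iff₀ (by positivity)]
    have := P.le_opNorm x
    have h3 : ‖P x‖ ≤ ‖f n (P x)‖ * (2 * (‖P‖ + 1)) := by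
      nlinarith [norm_nonneg x, norm_nonneg P]
    rw [mul_assoc, ← div_eq_inv_mul, le_div_iff₀ hPx]
    linarith

/-- A triangular system with rapidly decaying entries below the diagonal can be corrected to a
biorthogonal one, keeping the functionals. -/
lemma exists_biorthogonal_of_triangular [CompleteSpace X] (φ : ℕ → X →L[ℂ] ℂ) (u : ℕ → X)
    (hu : ∀ i, ‖u i‖ = 1) (hdiag : ∀ i, φ i (u i) = 1) (hupper : ∀ i j, i < j → φ i (u j) = 0)
    (hlower : ∀ i j, i < j → ‖φ j (u i)‖ ≤ (1 / 2) ^ (j + 1)) :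
    ∃ z : ℕ → X, ∀ i j, φ i (z j) = if i = j then 1 else 0 := by
  suffices h : ∀ m, ∃ z, ∀ j, φ j z = if j = m then 1 else 0 by
    choose z hz using h
    exact ⟨z, fun i j ↦ hz j i⟩
  intro m
  let w : ℕ → X := fun k ↦
    Nat.rec (u m) (fun k x ↦ x - φ (m + k + 1) x • u (m + k + 1)) k
  have w0 : w 0 = u m := rfl
  have ws : ∀ k, w (k + 1) = w k - φ (m + k + 1) (w k) • u (m + k + 1) := fun k ↦ rfl
  have hbound : ∀ k j, m + k < j → ‖φ j (w k)‖ ≤ (2 - (1 / 2) ^ k) * (1 / 2) ^ (j + 1) := by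
    intro k
    induction k with
    | zero => intro j hj; rw [w0, pow_zero, show (2 : ℝ) - 1 = 1 by norm_num, one_mul]; exact hlower m j hj
    | succ k ih =>
      intro j hj
      have h1 := ih j (by omega)
      have h2 := ih (m + k + 1) (by omega)
      have h3 := hlower (m + k + 1) j (by omega)
      have h4 : ‖φ (m + k + 1) (w k)‖ ≤ (1 / 2) ^ (k + 1) := by
        refine h2.trans ?_
        have e1 : ((1 : ℝ) / 2) ^ (m + k + 1 + 1) = (1 / 2) ^ m * (1 / 2) ^ (k + 1) * (1 / 2) := by
          ring
        have e2 : ((1 : ℝ) / 2) ^ m ≤ 1 := pow_le_one₀ (by norm_num) (by norm_num)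
        have e3 : (0 : ℝ) < (1 / 2) ^ (k + 1) := by positivity
        have e4 : (0 : ℝ) < (1 / 2) ^ k := by positivity
        have e5 : (0 : ℝ) < (1 / 2) ^ m := by positivity
        calc (2 - (1 / 2 : ℝ) ^ k) * (1 / 2) ^ (m + k + 1 + 1)
            ≤ 2 * (1 / 2) ^ (m + k + 1 + 1) := by gcongr; linarith
          _ = (1 / 2) ^ m * (1 / 2) ^ (k + 1) := by rw [e1]; ring
          _ ≤ 1 * (1 / 2) ^ (k + 1) := by gcongr
          _ = _ := one_mul _
      rw [ws, map_sub, map_smul, smul_eq_mul]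
      calc ‖φ j (w k) - φ (m + k + 1) (w k) * φ j (u (m + k + 1))‖
          ≤ ‖φ j (w k)‖ + ‖φ (m + k + 1) (w k)‖ * ‖φ j (u (m + k + 1))‖ := by
            rw [← norm_mul]; exact norm_sub_le _ _
        _ ≤ (2 - (1 / 2) ^ k) * (1 / 2) ^ (j + 1) + (1 / 2) ^ (k + 1) * (1 / 2) ^ (j + 1) := by
            gcongr
        _ = _ := by ring
  have hval : ∀ k j, j ≤ m + k → φ j (w k) = if j = m then 1 else 0 := by
    intro k
    induction k with
    | zero =>
      intro j hj
      rcases (show j ≤ m by omega).lt_or_eq with h | rfl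
      · rw [w0, hupper j m h, if_neg h.ne]
      · simp [w0, hdiag]
    | succ k ih =>
      intro j hj
      rw [ws, map_sub, map_smul, smul_eq_mul]
      rcases hj.lt_or_eq with h | rfl
      · rw [hupper j (m + k + 1) (by omega), ih j (by omega)]; simp
      · rw [← add_assoc, hdiag, if_neg (by omega)]; simp
  have hcauchy : CauchySeq w := by
    refine cauchySeq_of_le_geometric (1 / 2) 1 (by norm_num) fun k ↦ ?_
    rw [dist_eq_norm, ws, sub_sub_cancel, norm_smul, hu, mul_one, one_mul]
    refine (hbound k (m + k + 1) (by omega)).trans ?_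
    have e1 : ((1 : ℝ) / 2) ^ (m + k + 1 + 1) ≤ (1 / 2) ^ (k + 1) :=
      pow_le_pow_of_le_one (by norm_num) (by norm_num) (by omega)
    have e4 : (0 : ℝ) < (1 / 2) ^ k := by positivity
    calc (2 - (1 / 2 : ℝ) ^ k) * (1 / 2) ^ (m + k + 1 + 1)
        ≤ 2 * (1 / 2) ^ (k + 1) := by gcongr; linarith
      _ = (1 / 2) ^ k := by ring
  obtain ⟨z, hz⟩ := cauchySeq_tendsto_of_complete hcauchy
  refine ⟨z, fun j ↦ tendsto_nhds_unique ((φ j).continuous.tendsto z |>.comp hz) ?_⟩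
  refine tendsto_const_nhds.congr' ?_
  filter_upwards [eventually_ge_atTop j] with k hk
  exact (hval k j (by omega)).symm

/-- A sequence of norm-one functionals converging pointwise to zero has, up to scalar factors, a
subsequence belonging to a biorthogonal system. -/
lemma exists_biorthogonal_of_tendsto_zero [CompleteSpace X] (f : ℕ → X →L[ℂ] ℂ)
    (hf1 : ∀ n, ‖f n‖ = 1) (hf : ∀ x, Tendsto (fun n ↦ f n x) atTop (𝓝 0)) :
    ∃ (φ : ℕ → X →L[ℂ] ℂ) (z : ℕ → X), (∀ i, ∃ (c : ℂ) (n : ℕ), φ i = c • f n) ∧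
      ∀ i j, φ i (z j) = if i = j then 1 else 0 := by
  classical
  obtain ⟨t, htP, htr⟩ := exists_seq_of_forall_finset_exists
    (α := (X →L[ℂ] ℂ) × X × ℕ)
    (fun p ↦ (∃ (c : ℂ) (n : ℕ), p.1 = c • f n) ∧ p.1 p.2.1 = 1 ∧ ‖p.2.1‖ = 1)
    (fun p q ↦ p.2.2 < q.2.2 ∧ p.1 q.2.1 = 0 ∧ ‖q.1 p.2.1‖ ≤ (1 / 2) ^ (q.2.2 + 1)) (by
      intro s hs
      obtain ⟨d, hd, hev⟩ := exists_unit_vector_in_ker f hf1 hf (s.image Prod.fst)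
      let k : ℕ := s.sup (fun p ↦ p.2.2) + 1
      have hsmall : ∀ᶠ n in atTop, ∀ p ∈ s, ‖f n p.2.1‖ < d * (1 / 2) ^ (k + 1) := by
        rw [Filter.eventually_all_finset]
        intro p _
        have := (hf p.2.1).norm
        rw [norm_zero] at this
        exact this.eventually_lt_const (by positivity)
      obtain ⟨n, ⟨u, hu1, hus, hud⟩, hn⟩ := (hev.and hsmall).exists
      have hfu : 0 < ‖f n u‖ := hd.trans_le hud
      have hfu0 : f n u ≠ 0 := norm_pos_iff.1 hfu
      refine ⟨((f n u)⁻¹ • f n, u, k), ⟨⟨_, n, rfl⟩, by simp [hfu0], hu1⟩, fun p hp ↦ ⟨?_, ?_, ?_⟩⟩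
      · exact Nat.lt_succ_of_le (Finset.le_sup (f := fun p : (X →L[ℂ] ℂ) × X × ℕ ↦ p.2.2) hp)
      · exact hus _ (Finset.mem_image_of_mem _ hp)
      · have h1 := hn p hp
        simp only [smul_apply, smul_eq_mul, norm_mul, norm_inv]
        rw [← div_eq_inv_mul, div_le_iff₀ hfu]
        have h2 : d * (1 / 2 : ℝ) ^ (k + 1) ≤ ‖f n u‖ * (1 / 2) ^ (k + 1) := by gcongr
        linarith)
  have hk : StrictMono fun i ↦ (t i).2.2 := fun i j hij ↦ (htr i j hij).1
  obtain ⟨z, hz⟩ := exists_biorthogonal_of_triangular (fun i ↦ (t i).1) (fun i ↦ (t i).2.1)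
    (fun i ↦ (htP i).2.2) (fun i ↦ (htP i).2.1) (fun i j hij ↦ (htr i j hij).2.1)
    (fun i j hij ↦ (htr i j hij).2.2.trans
      (pow_le_pow_of_le_one (by norm_num) (by norm_num) (Nat.succ_le_succ (hk.le_apply (x := j)))))
  exact ⟨fun i ↦ (t i).1, z, fun i ↦ (htP i).1, hz⟩

end BiorthogonalSystems

section ApproximateEigenvectors

variable {X : Type*} [NormedAddCommGroup X] [NormedSpace ℂ X]

/-- Approximate eigenvectors of an adjoint without eigenvalues are weak-star null. -/
lemma tendsto_zero_of_approximate_eigenvectors (T : X →L[ℂ] X)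
    (hT : ∀ (z : ℂ) (f : X →L[ℂ] ℂ), f ≠ 0 → f.comp T ≠ z • f)
    (f : ℕ → X →L[ℂ] ℂ) (hf1 : ∀ n, ‖f n‖ = 1) (l : ℕ → ℂ) (l₀ : ℂ)
    (hl : Tendsto l atTop (𝓝 l₀))
    (hfl : ∀ x, Tendsto (fun n ↦ f n (T x) - l n * f n x) atTop (𝓝 0)) (x : X) :
    Tendsto (fun n ↦ f n x) atTop (𝓝 0) := by
  let F : ℕ → WeakDual ℂ X := fun n ↦ StrongDual.toWeakDual (f n)
  have hF : Tendsto F atTop (𝓝 0) := by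
    refine (WeakDual.isCompact_closedBall (𝕜 := ℂ) (E := X) 0 1).tendsto_nhds_of_unique_mapClusterPt
      (Eventually.of_forall fun n ↦ ?_) fun h _ hh ↦ ?_
    · simp [F, hf1]
    · obtain ⟨U, hU, hUh⟩ := mapClusterPt_iff_ultrafilter.1 hh
      have hev : ∀ y, Tendsto (fun n ↦ f n y) U (𝓝 (h y)) := fun y ↦
        ((WeakDual.eval_continuous y).tendsto h).comp hUh
      by_contra hne
      refine hT l₀ (WeakDual.toStrongDual h) (by simpa using hne) ?_
      ext y
      have h1 := (hev (T y)).sub ((hl.mono_left hU).mul (hev y))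
      have h2 := tendsto_nhds_unique h1 ((hfl y).mono_left hU)
      simpa using sub_eq_zero.1 h2
  exact ((WeakDual.eval_continuous x).tendsto 0).comp hF

/-- Near a boundary point of the spectrum the resolvent of the adjoint is unbounded on some
functional. -/
lemma exists_functional_resolvent_unbounded [CompleteSpace X] [Nontrivial X] (T : X →L[ℂ] X) :
    ∃ (l : ℕ → ℂ) (l₀ : ℂ) (u : ℕ → (X →L[ℂ] X)ˣ) (g : X →L[ℂ] ℂ),
      Tendsto l atTop (𝓝 l₀) ∧ (∀ n, (u n : X →L[ℂ] X) = algebraMap ℂ _ (l n) - T) ∧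
      ¬∃ C, ∀ n, ‖g.comp (↑(u n)⁻¹ : X →L[ℂ] X)‖ ≤ C := by
  have hfr : (frontier (spectrum ℂ T)).Nonempty := by
    rw [Set.nonempty_iff_ne_empty, Ne, frontier_eq_empty_iff]
    rintro (h | h)
    · exact (spectrum.nonempty T).ne_empty h
    · exact NormedSpace.unbounded_univ ℂ ℂ (h ▸ spectrum.isBounded T)
  obtain ⟨l₀, hl₀⟩ := hfr
  have hmem : l₀ ∈ spectrum ℂ T := (spectrum.isClosed T).frontier_subset hl₀
  have hcl : l₀ ∈ closure (spectrum ℂ T)ᶜ := by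
    rw [frontier_eq_closure_inter_closure] at hl₀
    exact hl₀.2
  obtain ⟨l, hl, hlim⟩ := mem_closure_iff_seq_limit.1 hcl
  have hunit : ∀ n, IsUnit (algebraMap ℂ (X →L[ℂ] X) (l n) - T) := fun n ↦ by
    simpa [spectrum.mem_iff] using hl n
  choose u hu using hunit
  by_contra! hcon
  obtain ⟨C, hC⟩ := banach_steinhaus
    (g := fun n ↦ (ContinuousLinearMap.compL ℂ X X ℂ).flip (↑(u n)⁻¹ : X →L[ℂ] X))
    (fun g ↦ by simpa using hcon l l₀ u g hlim hu)
  have hinv : ∀ n, ‖(↑(u n)⁻¹ : X →L[ℂ] X)‖ ≤ C := by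
    intro n
    have hC0 : 0 ≤ C := (norm_nonneg _).trans (hC 0)
    refine ContinuousLinearMap.opNorm_le_bound _ hC0 fun x ↦ ?_
    refine NormedSpace.norm_le_dual_bound ℂ _ (by positivity) fun g ↦ ?_
    have h1 : ‖g.comp (↑(u n)⁻¹ : X →L[ℂ] X)‖ ≤ C * ‖g‖ :=
      ((ContinuousLinearMap.compL ℂ X X ℂ).flip (↑(u n)⁻¹ : X →L[ℂ] X)).le_of_opNorm_le (hC n) g
    calc ‖g ((↑(u n)⁻¹ : X →L[ℂ] X) x)‖ ≤ ‖g.comp (↑(u n)⁻¹ : X →L[ℂ] X)‖ * ‖x‖ :=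
          (g.comp (↑(u n)⁻¹ : X →L[ℂ] X)).le_opNorm x
      _ ≤ C * ‖g‖ * ‖x‖ := by gcongr
      _ = _ := by ring
  have hpos : ∀ n, 0 < ‖(↑(u n)⁻¹ : X →L[ℂ] X)‖ := fun n ↦ (u n)⁻¹.norm_pos
  have hCpos : 0 < C := (hpos 0).trans_le (hinv 0)
  obtain ⟨n, hn⟩ := ((tendsto_iff_norm_sub_tendsto_zero.1 hlim).eventually_lt_const
    (inv_pos.2 hCpos)).exists
  refine (spectrum.mem_iff.1 hmem) (((u n).ofNearby _ ?_).isUnit)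
  rw [hu, sub_sub_sub_cancel_right, ← map_sub, norm_algebraMap', norm_sub_rev]
  exact hn.trans_le (inv_anti₀ (hpos n) (hinv n))

lemma exists_approximate_eigenvectors [CompleteSpace X] [Nontrivial X] (T : X →L[ℂ] X) :
    ∃ (f : ℕ → X →L[ℂ] ℂ) (g : X →L[ℂ] ℂ) (l : ℕ → ℂ) (l₀ : ℂ) (c : ℕ → ℂ),
      (∀ n, ‖f n‖ = 1) ∧ Tendsto l atTop (𝓝 l₀) ∧ Tendsto c atTop (𝓝 0) ∧
      ∀ n, (f n).comp T = l n • f n + c n • g := by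
  obtain ⟨l, l₀, u, g, hl, hu, hunb⟩ := exists_functional_resolvent_unbounded T
  set h : ℕ → X →L[ℂ] ℂ := fun n ↦ g.comp (↑(u n)⁻¹ : X →L[ℂ] X) with hh
  have hfreq : ∀ k : ℕ, ∃ᶠ n in atTop, (k : ℝ) + 1 ≤ ‖h n‖ := by
    intro k hk
    obtain ⟨N, hN⟩ := eventually_atTop.1 hk
    refine hunb ⟨((k : ℝ) + 1) + ∑ i ∈ Finset.range N, ‖h i‖, fun n ↦ ?_⟩
    rcases lt_or_ge n N with hn | hn
    · have := Finset.single_le_sum (f := fun i ↦ ‖h i‖) (fun _ _ ↦ norm_nonneg _)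
        (Finset.mem_range.2 hn)
      have h2 : (0 : ℝ) ≤ (k : ℝ) + 1 := by positivity
      simp only [hh] at this ⊢
      linarith
    · have h1 := not_le.1 (hN n hn)
      have h2 : 0 ≤ ∑ i ∈ Finset.range N, ‖h i‖ := by positivity
      simp only [hh] at h1 h2 ⊢
      linarith
  obtain ⟨σ, hσ, hσk⟩ := extraction_forall_of_frequently hfreq
  have hpos : ∀ n, 0 < ‖h (σ n)‖ := fun n ↦ lt_of_lt_of_le (by positivity) (hσk n)
  have hcomp : ∀ n, (h n).comp T = l n • h n - g := by
    intro n
    ext x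
    have e : T x = l n • x - (u n : X →L[ℂ] X) x := by
      simp [hu, Algebra.algebraMap_eq_smul_one]
    have e2 : (↑(u n)⁻¹ : X →L[ℂ] X) ((u n : X →L[ℂ] X) x) = x :=
      DFunLike.congr_fun (u n).inv_mul x
    simp [hh, e, e2]
  refine ⟨fun n ↦ ((‖h (σ n)‖⁻¹ : ℝ) : ℂ) • h (σ n), g, fun n ↦ l (σ n), l₀,
    fun n ↦ -((‖h (σ n)‖⁻¹ : ℝ) : ℂ), fun n ↦ ?_, hl.comp hσ.tendsto_atTop, ?_, fun n ↦ ?_⟩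
  · rw [norm_smul, Complex.norm_real, norm_inv, norm_norm, inv_mul_cancel₀ (hpos n).ne']
  · have h1 : Tendsto (fun n ↦ ‖h (σ n)‖) atTop atTop :=
      tendsto_atTop_mono (fun n ↦ (le_add_of_nonneg_right zero_le_one).trans (hσk n))
        tendsto_natCast_atTop_atTop
    simpa using ((Complex.continuous_ofReal.tendsto 0).comp h1.inv_tendsto_atTop).neg
  · rw [ContinuousLinearMap.smul_comp, hcomp]
    module

end ApproximateEigenvectors

/-- If the adjoint of `T` has empty point spectrum (no `0 ≠ f ∈ X*` satisfies
`f ∘ T = z • f`) and `T` commutes with a nonzero strictly singular operator,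
then `T` admits an AIHS of defect ≤ 1. -/
theorem aihs_of_adjoint_empty_point_spectrum_commutes_strictly_singular
    {X : Type*} [NormedAddCommGroup X] [NormedSpace ℂ X] [CompleteSpace X]
    (hX : ¬FiniteDimensional ℂ X) (T S : X →L[ℂ] X)
    (hTadj : ∀ (z : ℂ) (f : X →L[ℂ] ℂ), f ≠ 0 → f.comp T ≠ z • f)
    (hSS : StrictlySingular S) (hS0 : S ≠ 0)
    (hcomm : S * T = T * S) :
    HasAIHS1 T := by
  have : Nontrivial X := by
    by_contra h
    rw [not_nontrivial_iff_subsingleton] at h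
    exact hX inferInstance
  obtain ⟨f, g, l, l₀, c, hf1, hl, hc, hfT⟩ := exists_approximate_eigenvectors T
  have hf := tendsto_zero_of_approximate_eigenvectors T hTadj f hf1 l l₀ hl fun x ↦ by
    have h1 : ∀ n, f n (T x) - l n * f n x = c n * g x := fun n ↦ by
      simpa [sub_eq_iff_eq_add'] using DFunLike.congr_fun (hfT n) x
    simpa [h1] using hc.mul_const (g x)
  obtain ⟨φ, z, hφ, hφz⟩ := exists_biorthogonal_of_tendsto_zero f hf1 hf
  refine ⟨_, isHalfspace_iInf_ker_of_biorthogonal φ z hφz,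
    exists_defect_of_comp_eq T (fun i ↦ φ (2 * i)) g fun i ↦ ?_⟩
  obtain ⟨a, n, ha⟩ := hφ (2 * i)
  refine ⟨l n, a * c n, ?_⟩
  rw [ha, ContinuousLinearMap.smul_comp, hfT]
  module
end

section
/- Let X be an infinite-dimensional complex Banach space and T ∈ L(X). Then either T admits an almost-invariant halfspace of defect ≤ 1, or else there exist a finite-codimensional closed subspace V of X, a bounded linear projection P_V ∈ L(X) from X onto V, a scalar λ ∈ σ_p(T) ∩ σ_p(P_V T|_V), and a linearly independent sequence (v_n)_{n=1}^∞ ⊆ V whose closed linear span is all of V, such that the operator S := λ − P_V T|_V ∈ L(V) satisfies S v_{n+1} = v_n for all n ≥ 1 and S v_1 = 0. -/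
/-- `D` is a set of functionals in the unit ball which computes the norm. -/
def IsNormingSet {E : Type*} [NormedAddCommGroup E] [NormedSpace ℂ E]
    (D : Set (StrongDual ℂ E)) : Prop :=
  (∀ g ∈ D, ‖g‖ ≤ 1) ∧ ∀ y : E, y ≠ 0 → ∀ r : ℝ, 1 < r → ∃ g ∈ D, ‖y‖ < r * ‖g y‖

/-- A finite-dimensional subspace is almost normed by finitely many members of a norming set. -/
theorem IsNormingSet.exists_finset {E : Type*} [NormedAddCommGroup E] [NormedSpace ℂ E]
    {D : Set (StrongDual ℂ E)} (hD : IsNormingSet D)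
    (F : Submodule ℂ E) [FiniteDimensional ℂ F] {r : ℝ} (hr : 1 < r) :
    ∃ G : Finset (StrongDual ℂ E), ↑G ⊆ D ∧ ∀ y ∈ F, y ≠ 0 → ∃ g ∈ G, ‖y‖ ≤ r * ‖g y‖ := by
  classical
  have key : ∀ y : F, y ∈ Metric.sphere (0 : F) 1 → ∃ g ∈ D, 1 < r * ‖g y‖ := by
    intro y hy
    have hy1 : ‖(y : E)‖ = 1 := by simpa using hy
    obtain ⟨g, hg, hlt⟩ := hD.2 y (by rintro h; simp [h] at hy1) r hr
    exact ⟨g, hg, hy1 ▸ hlt⟩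
  choose! g hgD hg using key
  have : ProperSpace F := FiniteDimensional.proper ℂ F
  obtain ⟨t, ht, hcov⟩ := (isCompact_sphere (0 : F) 1).elim_nhds_subcover
    (fun y ↦ {w : F | 1 < r * ‖g y w‖}) (by
      intro y hy
      refine IsOpen.mem_nhds (isOpen_lt continuous_const ?_) (hg y hy)
      fun_prop)
  refine ⟨t.image g, ?_, fun y hy hy0 ↦ ?_⟩
  · intro f hf
    obtain ⟨y, hy, rfl⟩ := Finset.mem_image.1 (Finset.mem_coe.1 hf)
    exact hgD y (ht y hy)
  · have hpos : 0 < ‖y‖ := norm_pos_iff.2 hy0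
    have hmem : ((‖y‖⁻¹ : ℝ) : ℂ) • (⟨y, hy⟩ : F) ∈ Metric.sphere (0 : F) 1 := by
      rw [mem_sphere_zero_iff_norm, norm_smul]
      simp [hpos.ne']
    obtain ⟨i, hi, hlt⟩ := Set.mem_iUnion₂.1 (hcov hmem)
    refine ⟨g i, Finset.mem_image_of_mem g hi, ?_⟩
    have hlt' : 1 < r * (‖y‖⁻¹ * ‖g i y‖) := by simpa using hlt
    have := mul_le_mul_of_nonneg_right hlt'.le hpos.le
    field_simp at this
    simpa using this

/-- The Mazur selection step. -/
theorem IsNormingSet.exists_mem_norm_le {E : Type*} [NormedAddCommGroup E] [NormedSpace ℂ E]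
    {D : Set (StrongDual ℂ E)} (hD : IsNormingSet D) {Z : Set E} {d : ℝ} (hd : 0 < d)
    (hZ : ∀ z ∈ Z, d ≤ ‖z‖)
    (hw : ∀ G : Finset (StrongDual ℂ E), ↑G ⊆ D → ∀ ε : ℝ, 0 < ε → ∃ z ∈ Z, ∀ g ∈ G, ‖g z‖ < ε)
    (F : Submodule ℂ E) [FiniteDimensional ℂ F] {r : ℝ} (hr : 1 < r) :
    ∃ z ∈ Z, ∀ y ∈ F, ∀ a : ℂ, ‖y‖ ≤ r * ‖y + a • z‖ := by
  obtain ⟨s, hs1, hsr⟩ := exists_between hr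
  have hs0 : 0 < s := by linarith
  have hr0 : 0 < r := by linarith
  obtain ⟨G, hGD, hG⟩ := hD.exists_finset F hs1
  have hgap : 0 < s⁻¹ - r⁻¹ := by
    have := inv_strictAnti₀ hs0 hsr
    linarith
  obtain ⟨z, hzZ, hz⟩ := hw G hGD ((s⁻¹ - r⁻¹) * d / 2) (by positivity)
  refine ⟨z, hzZ, fun y hy a ↦ ?_⟩
  rcases eq_or_ne y 0 with rfl | hy0
  · simp; positivity
  obtain ⟨g, hgG, hyg⟩ := hG y hy hy0
  have hzg := hz g hgG
  have hzd := hZ z hzZ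
  rcases le_total (2 * ‖y‖) (‖a‖ * d) with h | h
  · have h1 : ‖a • z‖ ≤ ‖y + a • z‖ + ‖y‖ := by
      have := norm_sub_le (y + a • z) y
      simpa using this
    have h2 : ‖a‖ * d ≤ ‖a • z‖ := by rw [norm_smul]; gcongr
    nlinarith [norm_nonneg (y + a • z), norm_nonneg y]
  · have h1 : ‖g (y + a • z)‖ ≤ ‖y + a • z‖ := by
      simpa using g.le_of_opNorm_le (hD.1 g (hGD hgG)) (y + a • z)
    have h2 : ‖g y‖ ≤ ‖g (y + a • z)‖ + ‖a‖ * ‖g z‖ := by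
      have := norm_sub_le (g (y + a • z)) (g (a • z))
      simpa [norm_smul] using this
    have h3 : ‖a‖ * ‖g z‖ ≤ (s⁻¹ - r⁻¹) * ‖y‖ := by
      calc ‖a‖ * ‖g z‖ ≤ ‖a‖ * ((s⁻¹ - r⁻¹) * d / 2) := by gcongr
        _ = (s⁻¹ - r⁻¹) * (‖a‖ * d) / 2 := by ring
        _ ≤ (s⁻¹ - r⁻¹) * (2 * ‖y‖) / 2 := by gcongr
        _ = _ := by ring
    have h4 : s⁻¹ * ‖y‖ ≤ ‖g y‖ := by
      rw [inv_mul_le_iff₀ hs0]; exact hyg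
    have h5 : r⁻¹ * ‖y‖ ≤ ‖y + a • z‖ := by nlinarith
    rwa [inv_mul_le_iff₀ hr0] at h5

/-- The Mazur selection: a set bounded away from `0` which has `0` in its closure for the topology
of a norming set contains a sequence which is basic relative to a prescribed vector `φ`. -/
theorem IsNormingSet.exists_seq {E : Type*} [NormedAddCommGroup E] [NormedSpace ℂ E]
    {D : Set (StrongDual ℂ E)} (hD : IsNormingSet D) {Z : Set E} {d : ℝ} (hd : 0 < d)
    (hZ : ∀ z ∈ Z, d ≤ ‖z‖)
    (hw : ∀ G : Finset (StrongDual ℂ E), ↑G ⊆ D → ∀ ε : ℝ, 0 < ε → ∃ z ∈ Z, ∀ g ∈ G, ‖g z‖ < ε)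
    (φ : E) :
    ∃ u : ℕ → E, (∀ n, u n ∈ Z) ∧ ∀ (c : ℂ) (a : ℕ → ℂ) (m k : ℕ), k < m →
      ‖a k‖ ≤ 4 / d * ‖c • φ + ∑ j ∈ Finset.range m, a j • u j‖ := by
  have hb : ∀ m : ℕ, (1 : ℝ) ≤ 2 - 1 / (m + 1) ∧ (2 : ℝ) - 1 / (m + 1) ≤ 2 ∧
      1 < (2 - 1 / ((m + 1 : ℕ) + 1 : ℝ)) / (2 - 1 / (m + 1)) := by
    intro m
    have h0 : (0 : ℝ) ≤ m := m.cast_nonneg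
    have h1 : (1 : ℝ) / (m + 1) ≤ 1 := by rw [div_le_one (by linarith)]; linarith
    have h2 : (0 : ℝ) < 1 / (m + 1) := by positivity
    refine ⟨by linarith, by linarith, ?_⟩
    rw [one_lt_div (by linarith)]
    have : (1 : ℝ) / ((m + 1 : ℕ) + 1) < 1 / (m + 1) := by
      push_cast
      gcongr
      linarith
    linarith
  set b : ℕ → ℝ := fun m ↦ 2 - 1 / (m + 1) with hbdef
  have hstep : ∀ (m : ℕ) (F : {F : Submodule ℂ E // FiniteDimensional ℂ F}),
      ∃ z ∈ Z, ∀ y ∈ F.1, ∀ a : ℂ, ‖y‖ ≤ b (m + 1) / b m * ‖y + a • z‖ := by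
    intro m F
    have := F.2
    exact hD.exists_mem_norm_le hd hZ hw F.1 (hb m).2.2
  choose next hnextZ hnext using hstep
  let F : ℕ → {F : Submodule ℂ E // FiniteDimensional ℂ F} := fun n ↦
    Nat.rec ⟨ℂ ∙ φ, inferInstance⟩
      (fun m F ↦ ⟨F.1 ⊔ ℂ ∙ next m F, have := F.2; inferInstance⟩) n
  have hFs : ∀ m, (F (m + 1)).1 = (F m).1 ⊔ ℂ ∙ next m (F m) := fun m ↦ rfl
  refine ⟨fun n ↦ next n (F n), fun n ↦ hnextZ _ _, fun c a m k hk ↦ ?_⟩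
  set s : ℕ → E := fun m ↦ c • φ + ∑ j ∈ Finset.range m, a j • next j (F j) with hs
  have hsucc : ∀ m, s (m + 1) = s m + a m • next m (F m) := fun m ↦ by
    simp [hs, Finset.sum_range_succ, add_assoc]
  have hmem : ∀ m, s m ∈ (F m).1 := by
    intro m
    induction m with
    | zero =>
      simp only [hs, Finset.range_zero, Finset.sum_empty, add_zero]
      exact Submodule.smul_mem _ _ (Submodule.mem_span_singleton_self φ)
    | succ m ih =>
      rw [hsucc, hFs]
      exact Submodule.add_mem_sup ih
        (Submodule.smul_mem _ _ (Submodule.mem_span_singleton_self _))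
  have hmono : Monotone fun m ↦ b m * ‖s m‖ := by
    refine monotone_nat_of_le_succ fun m ↦ ?_
    have h := hnext m (F m) (s m) (hmem m) (a m)
    have hbm : 0 < b m := by linarith [(hb m).1]
    rw [← hsucc, div_mul_eq_mul_div, le_div_iff₀ hbm] at h
    linarith
  have hle : ∀ i, i ≤ m → ‖s i‖ ≤ 2 * ‖s m‖ := by
    intro i hi
    have h1 : b i * ‖s i‖ ≤ b m * ‖s m‖ := hmono hi
    have h2 : 1 ≤ b i := (hb i).1
    have h3 : b m ≤ 2 := (hb m).2.1
    nlinarith [norm_nonneg (s i), norm_nonneg (s m)]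
  have h1 : ‖a k‖ * d ≤ 4 * ‖s m‖ := by
    calc ‖a k‖ * d ≤ ‖a k‖ * ‖next k (F k)‖ := by gcongr; exact hZ _ (hnextZ _ _)
      _ = ‖s (k + 1) - s k‖ := by rw [hsucc, add_sub_cancel_left, norm_smul]
      _ ≤ ‖s (k + 1)‖ + ‖s k‖ := norm_sub_le _ _
      _ ≤ 4 * ‖s m‖ := by linarith [hle (k + 1) hk, hle k hk.le]
  rw [div_mul_eq_mul_div, le_div_iff₀ hd]
  exact h1

/-- A uniformly minimal sequence. -/
def IsMinimalSeq {X : Type*} [NormedAddCommGroup X] [NormedSpace ℂ X] (x : ℕ → X) : Prop :=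
  ∃ C : ℝ, ∀ (a : ℕ →₀ ℂ) (k : ℕ), ‖a k‖ ≤ C * ‖Finsupp.linearCombination ℂ x a‖

theorem IsNormingSet.exists_isMinimalSeq {X E : Type*} [NormedAddCommGroup X] [NormedSpace ℂ X]
    [NormedAddCommGroup E] [NormedSpace ℂ E]
    {D : Set (StrongDual ℂ E)} (hD : IsNormingSet D) (J : X →L[ℂ] E) (hJ : ∀ x, ‖J x‖ ≤ ‖x‖)
    {S : Set X} (φ : E) {d : ℝ} (hd : 0 < d) (hS : ∀ x ∈ S, d ≤ ‖J x - φ‖)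
    (hφ : ∀ G : Finset (StrongDual ℂ E), ↑G ⊆ D → ∀ ε : ℝ, 0 < ε →
      ∃ x ∈ S, ∀ g ∈ G, ‖g (J x) - g φ‖ < ε) :
    ∃ x : ℕ → X, (∀ n, x n ∈ S) ∧ IsMinimalSeq x := by
  obtain ⟨u, huZ, hu⟩ := hD.exists_seq hd (Z := (fun x ↦ J x - φ) '' S)
    (by rintro _ ⟨x, hx, rfl⟩; exact hS x hx) (by
      intro G hG ε hε
      obtain ⟨x, hxS, hx⟩ := hφ G hG ε hε
      exact ⟨_, ⟨x, hxS, rfl⟩, fun g hg ↦ by simpa using hx g hg⟩) φ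
  choose x hxS hx using huZ
  refine ⟨x, hxS, 4 / d, fun a k ↦ ?_⟩
  obtain ⟨m, hm⟩ := (insert k a.support).exists_nat_subset_range
  refine (hu (∑ j ∈ Finset.range m, a j) a m k
    (Finset.mem_range.1 (hm (Finset.mem_insert_self _ _)))).trans ?_
  have : (∑ j ∈ Finset.range m, a j) • φ + ∑ j ∈ Finset.range m, a j • u j =
      J (Finsupp.linearCombination ℂ x a) := by
    rw [Finsupp.linearCombination_apply,
      Finsupp.sum_of_support_subset a ((Finset.subset_insert _ _).trans hm) _ (by simp)]
    simp only [← hx, map_sum, map_smul, smul_sub, Finset.sum_sub_distrib, Finset.sum_smul]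
    abel
  rw [this]
  gcongr
  exact hJ _

theorem isNormingSet_evaluations (X : Type*) [NormedAddCommGroup X] [NormedSpace ℂ X] :
    IsNormingSet (E := StrongDual ℂ (StrongDual ℂ X)) {g |
      ∃ f : StrongDual ℂ X, ‖f‖ ≤ 1 ∧ g = ContinuousLinearMap.apply ℂ ℂ f} := by
  refine ⟨?_, fun y hy r hr ↦ ?_⟩
  · rintro _ ⟨f, hf, rfl⟩
    refine ContinuousLinearMap.opNorm_le_bound _ zero_le_one fun y ↦ ?_
    rw [one_mul, ContinuousLinearMap.apply_apply]
    simpa using y.le_opNorm_of_le hf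
  · have hr0 : 0 < r := by linarith
    have hpos : 0 < ‖y‖ := (norm_nonneg y).lt_of_ne' (mt y.opNorm_zero_iff.1 hy)
    obtain ⟨f, hf, hlt⟩ := y.exists_lt_apply_of_lt_opNorm (r := r⁻¹ * ‖y‖)
      (mul_lt_of_lt_one_left hpos (inv_lt_one_of_one_lt₀ hr))
    exact ⟨_, ⟨f, hf.le, rfl⟩, (inv_mul_lt_iff₀ hr0).1 hlt⟩

/-- A set with a weak-star cluster point `φ` in the bidual, at positive distance from it,
contains a minimal sequence. -/
theorem exists_isMinimalSeq {X : Type*} [NormedAddCommGroup X] [NormedSpace ℂ X]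
    {S : Set X} (φ : StrongDual ℂ (StrongDual ℂ X)) {d : ℝ} (hd : 0 < d)
    (hS : ∀ x ∈ S, d ≤ ‖NormedSpace.inclusionInDoubleDual ℂ X x - φ‖)
    (hφ : ∀ (G : Finset (StrongDual ℂ X)) (ε : ℝ), 0 < ε → ∃ x ∈ S, ∀ g ∈ G, ‖g x - φ g‖ < ε) :
    ∃ x : ℕ → X, (∀ n, x n ∈ S) ∧ IsMinimalSeq x := by
  classical
  refine (isNormingSet_evaluations X).exists_isMinimalSeq
    (NormedSpace.inclusionInDoubleDual ℂ X) (NormedSpace.double_dual_bound ℂ X) φ hd hS ?_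
  intro G hG ε hε
  have hG' : ∀ g ∈ G, ∃ f : StrongDual ℂ X, g = ContinuousLinearMap.apply ℂ ℂ f := by
    intro g hg
    obtain ⟨f, -, hf⟩ := hG hg
    exact ⟨f, hf⟩
  choose! f hf using hG'
  obtain ⟨x, hxS, hx⟩ := hφ (G.image f) ε hε
  refine ⟨x, hxS, fun g hg ↦ ?_⟩
  have := hx (f g) (Finset.mem_image_of_mem f hg)
  rw [hf g hg]
  simpa [NormedSpace.dual_def] using this

theorem IsMinimalSeq.linearIndependent {X : Type*} [NormedAddCommGroup X] [NormedSpace ℂ X]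
    {x : ℕ → X} (hx : IsMinimalSeq x) : LinearIndependent ℂ x := by
  obtain ⟨C, hC⟩ := hx
  refine linearIndependent_iff.2 fun a ha ↦ Finsupp.ext fun k ↦ ?_
  simpa [ha] using hC a k

/-- Every other term of a minimal sequence spans a halfspace. -/
theorem IsMinimalSeq.isHalfspace {X : Type*} [NormedAddCommGroup X] [NormedSpace ℂ X]
    {x : ℕ → X} (hx : IsMinimalSeq x) :
    IsHalfspace (Submodule.span ℂ (Set.range fun n ↦ x (2 * n))).topologicalClosure := by
  set Y := (Submodule.span ℂ (Set.range fun n ↦ x (2 * n))).topologicalClosure with hY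
  have hev : Function.Injective fun n : ℕ ↦ 2 * n := fun m n h ↦ by simpa using h
  have hodd : Function.Injective fun n : ℕ ↦ 2 * n + 1 := fun m n h ↦ by simpa using h
  have hmem : ∀ n, x (2 * n) ∈ Y := fun n ↦
    Submodule.le_topologicalClosure _ (Submodule.subset_span ⟨n, rfl⟩)
  refine ⟨Submodule.isClosed_topologicalClosure _, fun _ ↦ ?_, fun _ ↦ ?_⟩
  · have : LinearIndependent ℂ fun n ↦ (⟨x (2 * n), hmem n⟩ : Y) :=
      LinearIndependent.of_comp Y.subtype (hx.linearIndependent.comp _ hev)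
    exact not_finite_iff_infinite.2 inferInstance this.finite
  · obtain ⟨C, hC⟩ := hx
    have : LinearIndependent ℂ fun n ↦ Y.mkQ (x (2 * n + 1)) := by
      refine linearIndependent_iff.2 fun b hb ↦ Finsupp.ext fun k ↦ ?_
      have hw : Finsupp.linearCombination ℂ (x ∘ fun n ↦ 2 * n + 1) b ∈ Y := by
        rw [← Submodule.Quotient.mk_eq_zero, ← Submodule.mkQ_apply, Finsupp.apply_linearCombination]
        exact hb
      set w := Finsupp.linearCombination ℂ (x ∘ fun n ↦ 2 * n + 1) b with hwdef
      have hclosed : IsClosed {y : X | ‖b k‖ ≤ C * ‖w - y‖} :=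
        isClosed_le continuous_const (by fun_prop)
      have hsub : (Y : Set X) ⊆ {y : X | ‖b k‖ ≤ C * ‖w - y‖} := by
        rw [hY, Submodule.topologicalClosure_coe]
        refine closure_minimal (fun y hy ↦ ?_) hclosed
        obtain ⟨c, rfl⟩ := (Finsupp.mem_span_range_iff_exists_finsupp).1 hy
        have h := hC (b.mapDomain (fun n ↦ 2 * n + 1) - c.mapDomain fun n ↦ 2 * n) (2 * k + 1)
        rw [map_sub, Finsupp.linearCombination_mapDomain, Finsupp.linearCombination_mapDomain,
          Finsupp.sub_apply, Finsupp.mapDomain_apply hodd,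
          Finsupp.mapDomain_of_notMem_range c (2 * k + 1) (by rintro ⟨n, hn⟩; dsimp at hn; omega),
          sub_zero] at h
        exact h
      simpa using hsub hw
    exact not_finite_iff_infinite.2 inferInstance this.finite

theorem IsMinimalSeq.hasAIHS1 {X : Type*} [NormedAddCommGroup X] [NormedSpace ℂ X]
    {x : ℕ → X} (hx : IsMinimalSeq x) {T : X →L[ℂ] X} (e : X)
    (h : ∀ n, T (x n) ∈ Submodule.span ℂ {x n} ⊔ Submodule.span ℂ {e}) : HasAIHS1 T := by
  refine ⟨_, hx.isHalfspace, ℂ ∙ e, inferInstance,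
    (finrank_span_le_card ({e} : Set X)).trans (by simp), fun y hy ↦ ?_⟩
  set Y := (Submodule.span ℂ (Set.range fun n ↦ x (2 * n))).topologicalClosure
  have hclosed : IsClosed ((Y ⊔ ℂ ∙ e : Submodule ℂ X) : Set X) :=
    Submodule.isClosed_sup_finiteDimensional _ _ (Submodule.isClosed_topologicalClosure _)
  have hle : Y ≤ (Y ⊔ ℂ ∙ e).comap (T : X →ₗ[ℂ] X) := by
    refine Submodule.topologicalClosure_minimal _ ?_ (hclosed.preimage T.continuous)
    rw [Submodule.span_le]
    rintro _ ⟨n, rfl⟩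
    refine (sup_le_sup_right ?_ _ : _ ≤ Y ⊔ ℂ ∙ e) (h (2 * n))
    rw [Submodule.span_singleton_le_iff_mem]
    exact Submodule.le_topologicalClosure _ (Submodule.subset_span ⟨n, rfl⟩)
  exact hle hy

theorem LinearIsometry.exists_pos_le_norm_sub {X E : Type*} [NormedAddCommGroup X]
    [NormedSpace ℂ X] [CompleteSpace X] [NormedAddCommGroup E] [NormedSpace ℂ E]
    (J : X →ₗᵢ[ℂ] E) (φ : E) (hφ : ∀ z, J z = φ → z = 0) :
    ∃ d > 0, ∀ x, ‖x‖ = 1 → d ≤ ‖J x - φ‖ := by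
  by_cases hr : φ ∈ Set.range J
  · obtain ⟨z, hz⟩ := hr
    refine ⟨1, one_pos, fun x hx ↦ ?_⟩
    rw [← hz, hφ z hz, map_zero, sub_zero, J.norm_map, hx]
  · have hcl : IsClosed (Set.range J) := J.isometry.isClosedEmbedding.isClosed_range
    obtain ⟨d, hd, hb⟩ := Metric.isOpen_iff.1 hcl.isOpen_compl φ hr
    refine ⟨d, hd, fun z _ ↦ ?_⟩
    by_contra! hlt
    exact hb (mem_ball_iff_norm.2 hlt) ⟨z, rfl⟩

theorem hasAIHS1_of_infinite_eigenspace {X : Type*} [NormedAddCommGroup X] [NormedSpace ℂ X]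
    [CompleteSpace X] {T : X →L[ℂ] X} {lam : ℂ} {K : Submodule ℂ X} (hK : ¬FiniteDimensional ℂ K)
    (hT : ∀ x ∈ K, T x = lam • x) : HasAIHS1 T := by
  obtain ⟨d, hd, hdist⟩ :=
    (NormedSpace.inclusionInDoubleDualLi ℂ (E := X)).exists_pos_le_norm_sub
      (0 : StrongDual ℂ (StrongDual ℂ X)) fun z hz ↦
      SeparatingDual.eq_zero_of_forall_dual_eq_zero (R := ℂ) fun f ↦ DFunLike.congr_fun hz f
  obtain ⟨x, hxS, hx⟩ := exists_isMinimalSeq (S := {x | x ∈ K ∧ ‖x‖ = 1}) 0 hd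
    (fun x hx ↦ hdist x hx.2) (by
    intro G ε hε
    let ev : K →ₗ[ℂ] (G → ℂ) := LinearMap.pi fun g ↦ (g.1 : X →ₗ[ℂ] ℂ) ∘ₗ K.subtype
    have hev : ¬Function.Injective ev := fun h ↦ hK (FiniteDimensional.of_injective ev h)
    obtain ⟨y, hy, hy0⟩ := Submodule.exists_mem_ne_zero_of_ne_bot (mt LinearMap.ker_eq_bot.1 hev)
    have hy0' : (y : X) ≠ 0 := by simpa using hy0
    refine ⟨((‖(y : X)‖⁻¹ : ℝ) : ℂ) • (y : X), ⟨K.smul_mem _ y.2, ?_⟩, fun g hg ↦ ?_⟩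
    · rw [norm_smul]
      simp [norm_ne_zero_iff.2 hy0']
    · have : g y = 0 := congrFun (LinearMap.mem_ker.1 hy) ⟨g, hg⟩
      simpa [this] using hε)
  refine hx.hasAIHS1 0 fun n ↦ ?_
  rw [hT _ (hxS n).1]
  exact Submodule.mem_sup_left (Submodule.smul_mem _ _ (Submodule.mem_span_singleton_self _))

theorem exists_weakStar_cluster {X : Type*} [NormedAddCommGroup X] [NormedSpace ℂ X]
    {x : ℕ → X} (hx1 : ∀ n, ‖x n‖ = 1) :
    ∃ φ : StrongDual ℂ (StrongDual ℂ X), ∀ f : StrongDual ℂ X,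
      Filter.Tendsto (fun n ↦ f (x n)) (Filter.hyperfilter ℕ) (nhds (φ f)) := by
  let y : ℕ → WeakDual ℂ (StrongDual ℂ X) := fun n ↦
    StrongDual.toWeakDual (NormedSpace.inclusionInDoubleDual ℂ X (x n))
  obtain ⟨ψ, -, hψ⟩ := (WeakDual.isCompact_closedBall (𝕜 := ℂ)
    (0 : StrongDual ℂ (StrongDual ℂ X)) 1).ultrafilter_le_nhds ((Filter.hyperfilter ℕ).map y) (by
      rw [Filter.le_principal_iff]
      refine Filter.mem_map.2 (Filter.univ_mem' fun n ↦ ?_)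
      have := NormedSpace.double_dual_bound ℂ X (x n)
      rw [hx1] at this
      simpa [y] using this)
  refine ⟨WeakDual.toStrongDual ψ, fun f ↦ ?_⟩
  exact ((WeakDual.eval_continuous f).tendsto ψ).comp hψ

theorem hasAIHS1_of_approx_kernel {X : Type*} [NormedAddCommGroup X] [NormedSpace ℂ X]
    [CompleteSpace X] {A : X →L[ℂ] X} (hA : Function.Injective A) {x : ℕ → X}
    (hx1 : ∀ n, ‖x n‖ = 1) (hx0 : Filter.Tendsto (fun n ↦ A (x n)) Filter.atTop (nhds 0)) (e : X)
    (hxe : ∀ n, A (x n) ∈ Submodule.span ℂ {x n} ⊔ Submodule.span ℂ {e}) : HasAIHS1 A := by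
  obtain ⟨φ, hφ⟩ := exists_weakStar_cluster hx1
  have hφA : ∀ f : StrongDual ℂ X, φ (f.comp A) = 0 := fun f ↦ by
    refine tendsto_nhds_unique (hφ (f.comp A)) ?_
    have h := (f.continuous.tendsto 0).comp hx0
    rw [map_zero] at h
    exact h.mono_left (Nat.cofinite_eq_atTop ▸ Filter.hyperfilter_le_cofinite)
  obtain ⟨d, hd, hdist⟩ :=
    (NormedSpace.inclusionInDoubleDualLi ℂ (E := X)).exists_pos_le_norm_sub φ fun z hz ↦ by
      refine hA ?_
      rw [map_zero]
      refine SeparatingDual.eq_zero_of_forall_dual_eq_zero (R := ℂ) fun f ↦ ?_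
      rw [← hφA f, ← hz]
      rfl
  obtain ⟨u, huS, hu⟩ := exists_isMinimalSeq (S := Set.range x) φ hd
    (by rintro _ ⟨n, rfl⟩; exact hdist _ (hx1 n)) (by
    intro G ε hε
    have hev : ∀ᶠ n in (Filter.hyperfilter ℕ : Filter ℕ), ∀ g ∈ G, ‖g (x n) - φ g‖ < ε := by
      rw [Filter.eventually_all_finset]
      intro g _
      filter_upwards [Metric.tendsto_nhds.1 (hφ g) ε hε] with n hn
      rwa [← dist_eq_norm]
    obtain ⟨n, hn⟩ := hev.exists
    exact ⟨x n, ⟨n, rfl⟩, hn⟩)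
  refine hu.hasAIHS1 e fun n ↦ ?_
  obtain ⟨k, hk⟩ := huS n
  rw [← hk]
  exact hxe k

/-- Popov and Tcaciuc: an injective non-invertible operator which is a limit of invertible
scalar perturbations has an almost-invariant halfspace of defect at most `1`. -/
theorem hasAIHS1_of_injective {X : Type*} [NormedAddCommGroup X] [NormedSpace ℂ X]
    [CompleteSpace X] {A : X →L[ℂ] X} (hA : Function.Injective A) (hAu : ¬IsUnit A)
    (hlim : ∀ ε > 0, ∃ μ : ℂ, ‖μ‖ < ε ∧ IsUnit (A - μ • 1)) : HasAIHS1 A := by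
  choose μ hμ hu using fun n : ℕ ↦ hlim (1 / (n + 1)) (by positivity)
  choose R hR using hu
  have hμ0 : Filter.Tendsto (fun n ↦ ‖μ n‖) Filter.atTop (nhds 0) :=
    squeeze_zero (fun _ ↦ norm_nonneg _) (fun n ↦ (hμ n).le) tendsto_one_div_add_atTop_nhds_zero_nat
  obtain ⟨e, he⟩ : ∃ e : X, ∀ C, ∃ n, C < ‖(↑(R n)⁻¹ : X →L[ℂ] X) e‖ := by
    by_contra! hcon
    obtain ⟨C, hC⟩ := banach_steinhaus hcon
    have hC0 : 0 ≤ C := (norm_nonneg _).trans (hC 0)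
    obtain ⟨n, hn⟩ := ((Metric.tendsto_nhds.1 hμ0) (1 / (C + 1)) (by positivity)).exists
    have hn' : ‖μ n‖ < 1 / (C + 1) := by simpa using hn
    have hinv : 0 < ‖(↑(R n)⁻¹ : X →L[ℂ] X)‖ := by
      rw [norm_pos_iff]
      intro h0
      have h1 : (1 : X →L[ℂ] X) = 0 := by rw [← (R n).inv_mul, h0, zero_mul]
      have : Subsingleton (X →L[ℂ] X) := subsingleton_of_zero_eq_one h1.symm
      exact hAu (isUnit_of_subsingleton A)
    refine hAu ⟨(R n).ofNearby A ?_, rfl⟩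
    rw [hR, sub_sub_cancel]
    have hle : ‖(↑(R n)⁻¹ : X →L[ℂ] X)‖ ≤ C := hC n
    calc ‖μ n • (1 : X →L[ℂ] X)‖ ≤ ‖μ n‖ * 1 := by
          rw [norm_smul]
          gcongr
          exact ContinuousLinearMap.norm_id_le
      _ < 1 / (C + 1) := by rwa [mul_one]
      _ ≤ ‖(↑(R n)⁻¹ : X →L[ℂ] X)‖⁻¹ := by
          rw [← one_div]
          exact one_div_le_one_div_of_le hinv (by linarith)
  have hfreq : ∀ k : ℕ, ∃ n, k ≤ n ∧ (k : ℝ) + 1 < ‖(↑(R n)⁻¹ : X →L[ℂ] X) e‖ := by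
    by_contra! hcon
    obtain ⟨k, hk⟩ := hcon
    obtain ⟨C, hC⟩ := Filter.IsBoundedUnder.bddAbove_range
      (f := fun n ↦ ‖(↑(R n)⁻¹ : X →L[ℂ] X) e‖)
      ⟨(k : ℝ) + 1, Filter.eventually_map.2 (Filter.eventually_atTop.2 ⟨k, hk⟩)⟩
    obtain ⟨n, hn⟩ := he C
    exact hn.not_ge (hC ⟨n, rfl⟩)
  choose m hmk hm using hfreq
  let h : ℕ → X := fun k ↦ (↑(R (m k))⁻¹ : X →L[ℂ] X) e
  have hlt : ∀ k : ℕ, (k : ℝ) + 1 < ‖h k‖ := hm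
  have hpos : ∀ k, 0 < ‖h k‖ := fun k ↦ lt_trans (by positivity) (hlt k)
  have hAh : ∀ k, A (h k) = μ (m k) • h k + e := fun k ↦ by
    have h1 : (A - μ (m k) • 1) (h k) = e := by
      have := congrArg (fun B : X →L[ℂ] X ↦ B e) (R (m k)).mul_inv
      rwa [hR] at this
    rw [← h1]
    simp
  let x : ℕ → X := fun k ↦ ((‖h k‖⁻¹ : ℝ) : ℂ) • h k
  have hx1 : ∀ k, ‖x k‖ = 1 := fun k ↦ by
    simp only [x, norm_smul]
    simp [(hpos k).ne']
  have hAx : ∀ k, A (x k) = μ (m k) • x k + ((‖h k‖⁻¹ : ℝ) : ℂ) • e := fun k ↦ by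
    simp only [x, map_smul, hAh, smul_add]
    rw [smul_comm]
  refine hasAIHS1_of_approx_kernel hA hx1 ?_ e fun k ↦ ?_
  · have hm' : Filter.Tendsto m Filter.atTop Filter.atTop :=
      Filter.tendsto_atTop_mono hmk Filter.tendsto_id
    have hbound : Filter.Tendsto (fun k : ℕ ↦ ‖μ (m k)‖ + 1 / ((k : ℝ) + 1) * ‖e‖)
        Filter.atTop (nhds 0) := by
      simpa using (hμ0.comp hm').add (tendsto_one_div_add_atTop_nhds_zero_nat.mul_const ‖e‖)
    refine squeeze_zero_norm (fun k ↦ ?_) hbound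
    rw [hAx]
    refine (norm_add_le _ _).trans ?_
    rw [norm_smul, hx1, mul_one, norm_smul]
    gcongr
    rw [Complex.norm_real, norm_inv, norm_norm, ← one_div]
    exact one_div_le_one_div_of_le (by positivity) (hlt k).le
  · rw [hAx]
    exact Submodule.add_mem_sup
      (Submodule.smul_mem _ _ (Submodule.mem_span_singleton_self _))
      (Submodule.smul_mem _ _ (Submodule.mem_span_singleton_self _))

theorem HasAIHS1.of_smul_one_sub {X : Type*} [NormedAddCommGroup X] [NormedSpace ℂ X]
    {T : X →L[ℂ] X} {lam : ℂ} (h : HasAIHS1 (lam • 1 - T)) : HasAIHS1 T := by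
  obtain ⟨Y, hY, E, hE, hE1, hYE⟩ := h
  refine ⟨Y, hY, E, hE, hE1, fun y hy ↦ ?_⟩
  have : T y = lam • y - (lam • 1 - T) y := by simp
  rw [this]
  exact Submodule.sub_mem _ (Submodule.mem_sup_left (Y.smul_mem _ hy)) (hYE y hy)

theorem HasAIHS1.of_surjective {X Z : Type*} [NormedAddCommGroup X] [NormedSpace ℂ X]
    [NormedAddCommGroup Z] [NormedSpace ℂ Z] {π : X →L[ℂ] Z} (hπ : Function.Surjective π)
    {T : X →L[ℂ] X} {A : Z →L[ℂ] Z} (hA : ∀ x, A (π x) = π (T x)) (h : HasAIHS1 A) :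
    HasAIHS1 T := by
  obtain ⟨Y, ⟨hYc, hYi, hYq⟩, E, hE, hE1, hYE⟩ := h
  obtain ⟨e, he⟩ := (finrank_le_one_iff).1 hE1
  obtain ⟨e', he'⟩ := hπ e
  have hsurj : Function.Surjective (π : X →ₗ[ℂ] Z) := hπ
  refine ⟨Y.comap (π : X →ₗ[ℂ] Z), ⟨hYc.preimage π.continuous, fun _ ↦ hYi ?_, fun _ ↦ hYq ?_⟩,
    ℂ ∙ e', inferInstance, (finrank_span_le_card ({e'} : Set X)).trans (by simp), fun y hy ↦ ?_⟩
  · have := Module.Finite.map (Y.comap (π : X →ₗ[ℂ] Z)) (π : X →ₗ[ℂ] Z)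
    rwa [Submodule.map_comap_eq_of_surjective hsurj] at this
  · refine Module.Finite.of_surjective
      (Submodule.mapQ (Y.comap (π : X →ₗ[ℂ] Z)) Y (π : X →ₗ[ℂ] Z) le_rfl) fun z ↦ ?_
    obtain ⟨z, rfl⟩ := Y.mkQ_surjective z
    obtain ⟨x, rfl⟩ := hπ z
    exact ⟨Submodule.Quotient.mk x, rfl⟩
  · obtain ⟨z, hz, w, hw, hzw⟩ := Submodule.mem_sup.1 (hYE (π y) hy)
    obtain ⟨c, hc⟩ := he ⟨w, hw⟩
    have hc' : c • π e' = w := by rw [he']; exact congrArg Subtype.val hc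
    refine Submodule.mem_sup.2 ⟨T y - c • e', ?_, c • e',
      Submodule.smul_mem _ _ (Submodule.mem_span_singleton_self _), sub_add_cancel _ _⟩
    change π (T y - c • e') ∈ Y
    rw [map_sub, map_smul, hc', ← hA, ← hzw, add_sub_cancel_right]
    exact hz

/-- If the kernels of the powers of an endomorphism with finite-dimensional kernel never
stabilise, then the endomorphism acts as a backward shift on some sequence. -/
theorem LinearMap.exists_backward_chain {X : Type*} [AddCommGroup X] [Module ℂ X]
    (B : X →ₗ[ℂ] X) [FiniteDimensional ℂ B.ker]
    (hB : ∀ k, ∃ x, (B ^ (k + 1)) x = 0 ∧ (B ^ k) x ≠ 0) :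
    ∃ v : ℕ → X, v 0 ≠ 0 ∧ B (v 0) = 0 ∧ ∀ n, B (v (n + 1)) = v n := by
  let K : ℕ →o (Submodule ℂ B.ker)ᵒᵈ :=
    ⟨fun k ↦ OrderDual.toDual ((B ^ k).range.comap B.ker.subtype), fun i j hij ↦ by
      refine OrderDual.toDual_le_toDual.2 (Submodule.comap_mono ?_)
      obtain ⟨c, rfl⟩ := Nat.exists_eq_add_of_le hij
      rintro _ ⟨x, rfl⟩
      exact ⟨(B ^ c) x, by rw [pow_add]; rfl⟩⟩
  obtain ⟨m, hm⟩ := WellFoundedGT.monotone_chain_condition K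
  have hstab : ∀ k, m ≤ k → ∀ x, B x = 0 → x ∈ (B ^ m).range → x ∈ (B ^ k).range := by
    intro k hk x hx hxm
    have h := OrderDual.toDual.injective (hm k hk)
    exact h.le (show (⟨x, hx⟩ : B.ker) ∈ (B ^ m).range.comap B.ker.subtype from hxm)
  let R : Submodule ℂ X := ⨅ k, (B ^ k).range
  have hker : ∀ x, B x = 0 → x ∈ (B ^ m).range → x ∈ R := by
    intro x hx hxm
    refine (Submodule.mem_iInf _).2 fun k ↦ ?_
    obtain ⟨y, rfl⟩ := hstab (k + m) (by omega) x hx hxm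
    exact ⟨(B ^ m) y, by rw [pow_add]; rfl⟩
  have hlift : ∀ x : R, ∃ y : R, B y = x := by
    rintro ⟨x, hx⟩
    have hx' := (Submodule.mem_iInf _).1 hx
    obtain ⟨z, hz⟩ := hx' (m + 1)
    refine ⟨⟨(B ^ m) z, (Submodule.mem_iInf _).2 fun k ↦ ?_⟩, by
      rw [pow_succ'] at hz; exact hz⟩
    obtain ⟨y, hy⟩ := hx' (k + m + 1)
    have hd : (B ^ m) z - (B ^ (k + m)) y ∈ R := by
      refine hker _ ?_ ?_
      · rw [map_sub, sub_eq_zero]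
        rw [pow_succ'] at hz hy
        exact hz.trans hy.symm
      · refine Submodule.sub_mem _ ⟨z, rfl⟩ ⟨(B ^ k) y, ?_⟩
        rw [add_comm k m, pow_add]; rfl
    have h2 : (B ^ (k + m)) y ∈ (B ^ k).range := ⟨(B ^ m) y, by rw [pow_add]; rfl⟩
    simpa using Submodule.add_mem _ ((Submodule.mem_iInf _).1 hd k) h2
  obtain ⟨x, hx, hx0⟩ := hB m
  choose g hg using hlift
  let v0 : R := ⟨(B ^ m) x, hker _ (by rw [pow_succ'] at hx; exact hx) ⟨x, rfl⟩⟩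
  refine ⟨fun n ↦ (g^[n] v0 : R), hx0, by rw [pow_succ'] at hx; exact hx, fun n ↦ ?_⟩
  dsimp only
  rw [Function.iterate_succ_apply', hg]

theorem LinearMap.linearIndependent_of_backward_chain {X : Type*} [AddCommGroup X] [Module ℂ X]
    {B : X →ₗ[ℂ] X} {v : ℕ → X} (h0 : v 0 ≠ 0) (hB : B (v 0) = 0)
    (hv : ∀ n, B (v (n + 1)) = v n) : LinearIndependent ℂ v := by
  have hpow : ∀ m n, (B ^ m) (v (n + m)) = v n := by
    intro m
    induction m with
    | zero => intro n; rfl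
    | succ m ih =>
      intro n
      rw [pow_succ, Module.End.mul_apply, ← add_assoc, hv, ih]
  have hzero : ∀ m n, n < m → (B ^ m) (v n) = 0 := by
    intro m n hmn
    obtain ⟨c, rfl⟩ := Nat.exists_eq_add_of_lt hmn
    rw [show n + c + 1 = c + 1 + n by omega, pow_add, Module.End.mul_apply]
    have := hpow n 0
    rw [zero_add] at this
    rw [this, pow_succ, Module.End.mul_apply, hB, map_zero]
  refine linearIndependent_iff'.2 fun s a hs i hi ↦ ?_
  by_contra hai
  have hne : (s.filter fun j ↦ a j ≠ 0).Nonempty := ⟨i, by simp [hi, hai]⟩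
  set m := (s.filter fun j ↦ a j ≠ 0).max' hne with hm
  have hmem := (s.filter fun j ↦ a j ≠ 0).max'_mem hne
  rw [← hm, Finset.mem_filter] at hmem
  have h := congrArg (B ^ m) hs
  rw [map_sum, map_zero, Finset.sum_eq_single m] at h
  · have h1 := hpow m 0
    rw [zero_add] at h1
    rw [map_smul, h1] at h
    exact (smul_ne_zero hmem.2 h0) h
  · intro j hj hjm
    rw [map_smul]
    by_cases haj : a j = 0
    · rw [haj, zero_smul]
    · have : j ≤ m := Finset.le_max' _ _ (by simp [hj, haj])
      rw [hzero m j (by omega), smul_zero]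
  · exact fun h ↦ absurd hmem.1 h

/-- `C` induces a bijection modulo `N`. -/
def BijectiveMod {X : Type*} [AddCommGroup X] [Module ℂ X] (C : X →ₗ[ℂ] X)
    (N : Submodule ℂ X) : Prop :=
  (∀ x, ∃ y, C y - x ∈ N) ∧ ∀ x, C x ∈ N → x ∈ N

theorem bijectiveMod_bot {X : Type*} [AddCommGroup X] [Module ℂ X] {C : X →ₗ[ℂ] X} :
    BijectiveMod C ⊥ ↔ Function.Bijective C := by
  simp only [BijectiveMod, Submodule.mem_bot, sub_eq_zero, Function.Bijective,
    injective_iff_map_eq_zero]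
  exact and_comm

theorem bijectiveMod_ker_iff {X Z : Type*} [AddCommGroup X] [Module ℂ X] [AddCommGroup Z]
    [Module ℂ Z] {C : X →ₗ[ℂ] X} {A : Z →ₗ[ℂ] Z} {π : X →ₗ[ℂ] Z} (hπ : Function.Surjective π)
    (hA : ∀ x, A (π x) = π (C x)) : BijectiveMod C π.ker ↔ Function.Bijective A := by
  simp only [BijectiveMod, LinearMap.mem_ker, map_sub, sub_eq_zero, ← hA, Function.Bijective,
    injective_iff_map_eq_zero, Function.Surjective, hπ.forall, hπ.exists]
  exact and_comm

theorem BijectiveMod.mono {X : Type*} [AddCommGroup X] [Module ℂ X] {C : X →ₗ[ℂ] X}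
    {N N' : Submodule ℂ X} [FiniteDimensional ℂ N'] (h : BijectiveMod C N) (hle : N ≤ N')
    (hN : N ≤ N.comap C) (hN' : N' ≤ N'.comap C) : BijectiveMod C N' := by
  refine ⟨fun x ↦ (h.1 x).imp fun y hy ↦ hle hy, fun x hx ↦ ?_⟩
  let p := N.comap N'.subtype
  let f : N' ⧸ p →ₗ[ℂ] N' ⧸ p := p.mapQ p (C.restrict hN') fun y hy ↦ hN hy
  have hf : Function.Injective f := by
    rw [injective_iff_map_eq_zero]
    intro z hz
    obtain ⟨y, rfl⟩ := p.mkQ_surjective z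
    rw [Submodule.mkQ_apply] at hz ⊢
    replace hz := (Submodule.Quotient.mk_eq_zero _).1 hz
    exact (Submodule.Quotient.mk_eq_zero _).2 (h.2 _ hz)
  obtain ⟨z, hz⟩ := LinearMap.injective_iff_surjective.1 hf (p.mkQ ⟨C x, hx⟩)
  obtain ⟨y, rfl⟩ := p.mkQ_surjective z
  replace hz := (Submodule.Quotient.eq _).1 hz
  have hyx : C (y - x) ∈ N := by rw [map_sub]; exact hz
  simpa using N'.sub_mem y.2 (hle (h.2 _ hyx))

theorem BijectiveMod.bijective {X : Type*} [AddCommGroup X] [Module ℂ X] {C : X →ₗ[ℂ] X}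
    {N : Submodule ℂ X} [FiniteDimensional ℂ N] (h : BijectiveMod C N)
    (hN : N ≤ N.comap C) (hinj : ∀ x ∈ N, C x = 0 → x = 0) : Function.Bijective C := by
  refine ⟨(injective_iff_map_eq_zero _).2 fun x hx ↦ hinj x (h.2 x (hx ▸ N.zero_mem)) hx,
    fun x ↦ ?_⟩
  have hf : Function.Injective (C.restrict hN) := by
    rw [injective_iff_map_eq_zero]
    intro z hz
    exact Subtype.ext (hinj z z.2 (congrArg Subtype.val hz))
  obtain ⟨y, hy⟩ := h.1 x
  obtain ⟨z, hz⟩ := LinearMap.injective_iff_surjective.1 hf ⟨C y - x, hy⟩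
  have hz' : C z = C y - x := congrArg Subtype.val hz
  exact ⟨y - z, by rw [map_sub, hz', sub_sub_cancel]⟩

/-- The second alternative: a compression of `T` to a finite-codimensional subspace is, up to a
scalar, a backward shift. -/
def IsCompressedShift {X : Type*} [NormedAddCommGroup X] [NormedSpace ℂ X]
    (T : X →L[ℂ] X) : Prop :=
  ∃ V : Submodule ℂ X, IsClosed (V : Set X) ∧ FiniteDimensional ℂ (X ⧸ V) ∧
      ∃ P : X →L[ℂ] X, (∀ x : X, P x ∈ V) ∧ (∀ v ∈ V, P v = v) ∧
        ∃ lam : ℂ,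
          (∃ x : X, x ≠ 0 ∧ T x = lam • x) ∧
          (∃ w : ↥V, w ≠ 0 ∧ P (T (w : X)) = lam • (w : X)) ∧
          ∃ S : ↥V →L[ℂ] ↥V,
            (∀ v : ↥V, (S v : X) = lam • (v : X) - P (T (v : X))) ∧
            ∃ v : ℕ → ↥V, LinearIndependent ℂ v ∧
              (Submodule.span ℂ (Set.range v)).topologicalClosure = ⊤ ∧
              S (v 0) = 0 ∧ (∀ n : ℕ, S (v (n + 1)) = v n)

theorem hasAIHS1_or_isCompressedShift_of_chain {X : Type*} [NormedAddCommGroup X]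
    [NormedSpace ℂ X] {T : X →L[ℂ] X} {lam : ℂ} {v : ℕ → X} (h0 : v 0 ≠ 0)
    (hB : (lam • 1 - T) (v 0) = 0) (hv : ∀ n, (lam • 1 - T) (v (n + 1)) = v n) :
    HasAIHS1 T ∨ IsCompressedShift T := by
  have hli : LinearIndependent ℂ v :=
    LinearMap.linearIndependent_of_backward_chain (B := ((lam • 1 - T : X →L[ℂ] X) : X →ₗ[ℂ] X))
      h0 hB hv
  set W := Submodule.span ℂ (Set.range v) with hW
  set V := W.topologicalClosure
  have hvV : ∀ n, v n ∈ V := fun n ↦ W.le_topologicalClosure (Submodule.subset_span ⟨n, rfl⟩)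
  have hVc : IsClosed (V : Set X) := Submodule.isClosed_topologicalClosure _
  have hBV : ∀ x ∈ V, (lam • 1 - T) x ∈ V := by
    have : V ≤ V.comap ((lam • 1 - T : X →L[ℂ] X) : X →ₗ[ℂ] X) := by
      refine Submodule.topologicalClosure_minimal _ ?_ (hVc.preimage (lam • 1 - T).continuous)
      rw [hW, Submodule.span_le]
      rintro _ ⟨n | n, rfl⟩
      · change (lam • 1 - T) (v 0) ∈ V
        rw [hB]
        exact V.zero_mem
      · change (lam • 1 - T) (v (n + 1)) ∈ V
        rw [hv]
        exact hvV n
    exact this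
  have hTV : ∀ x ∈ V, T x ∈ V := fun x hx ↦ by
    have : T x = lam • x - (lam • 1 - T) x := by simp
    rw [this]
    exact V.sub_mem (V.smul_mem _ hx) (hBV x hx)
  by_cases hq : FiniteDimensional ℂ (X ⧸ V)
  · right
    obtain ⟨f, hf⟩ := Submodule.ClosedComplemented.of_finiteDimensional_quotient hVc
    have hPT : ∀ x ∈ V, (f (T x) : X) = T x := fun x hx ↦ congrArg _ (hf ⟨T x, hTV x hx⟩)
    have hT0 : T (v 0) = lam • v 0 := by
      rw [eq_comm, ← sub_eq_zero]
      exact hB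
    have hli' : LinearIndependent ℂ fun n ↦ (⟨v n, hvV n⟩ : V) :=
      LinearIndependent.of_comp V.subtype hli
    refine ⟨V, hVc, hq, V.subtypeL.comp f, fun x ↦ (f x).2,
      fun x hx ↦ congrArg Subtype.val (hf ⟨x, hx⟩), lam, ⟨v 0, h0, hT0⟩, ⟨⟨v 0, hvV 0⟩, ?_, ?_⟩,
      (lam • 1 - T).restrict hBV, fun x ↦ ?_, fun n ↦ ⟨v n, hvV n⟩, hli', ?_,
      Subtype.ext hB, fun n ↦ Subtype.ext (hv n)⟩
    · exact fun h ↦ h0 (congrArg Subtype.val h)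
    · exact (hPT _ (hvV 0)).trans hT0
    · exact congrArg (lam • (x : X) - ·) (hPT x x.2).symm
    · refine eq_top_iff.2 fun x _ ↦ ?_
      have hx : (x : X) ∈ closure (W : Set X) := x.2
      rw [← SetLike.mem_coe, Submodule.topologicalClosure_coe,
        Topology.IsInducing.subtypeVal.closure_eq_preimage_closure_image, Set.mem_preimage]
      refine closure_mono ?_ hx
      have hle : W ≤ (Submodule.span ℂ (Set.range fun n ↦ (⟨v n, hvV n⟩ : V))).map V.subtype := by
        rw [Submodule.map_span, ← Set.range_comp]
        exact le_rfl
      exact hle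
  · left
    refine ⟨V, ⟨hVc, fun _ ↦ ?_, hq⟩, ⊥, inferInstance, by simp, fun y hy ↦
      Submodule.mem_sup_left (hTV y hy)⟩
    have hli' : LinearIndependent ℂ fun n ↦ (⟨v n, hvV n⟩ : V) :=
      LinearIndependent.of_comp V.subtype hli
    exact not_finite_iff_infinite.2 inferInstance hli'.finite

theorem ContinuousLinearMap.sub_zero_smul_one {X : Type*} [NormedAddCommGroup X]
    [NormedSpace ℂ X] (C : X →L[ℂ] X) : C - (0 : ℂ) • 1 = C := by
  rw [zero_smul, sub_zero]

theorem ContinuousLinearMap.exists_quotient_map {X : Type*} [NormedAddCommGroup X]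
    [NormedSpace ℂ X] [CompleteSpace X] (C : X →L[ℂ] X) {N : Submodule ℂ X}
    (hNc : IsClosed (N : Set X)) (hN : N ≤ N.comap (C : X →ₗ[ℂ] X)) :
    ∃ A : X ⧸ N →L[ℂ] X ⧸ N, (∀ x, A (N.mkQL x) = N.mkQL (C x)) ∧
      ∀ μ : ℂ, BijectiveMod ((C : X →ₗ[ℂ] X) - μ • 1) N ↔ IsUnit (A - μ • 1) := by
  let A : X ⧸ N →L[ℂ] X ⧸ N :=
    N.liftQL (N.mkQL.comp C) fun _ hx ↦ (Submodule.Quotient.mk_eq_zero _).2 (hN hx)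
  refine ⟨A, fun _ ↦ rfl, fun μ ↦ ?_⟩
  rw [ContinuousLinearMap.isUnit_iff_bijective]
  have := bijectiveMod_ker_iff (C := (C : X →ₗ[ℂ] X) - μ • 1)
    (A := ((A - μ • 1 : X ⧸ N →L[ℂ] X ⧸ N) : X ⧸ N →ₗ[ℂ] X ⧸ N)) N.mkQ_surjective fun _ ↦ rfl
  rwa [N.ker_mkQ] at this

theorem ker_pow_le_comap_sub_smul {X : Type*} [AddCommGroup X] [Module ℂ X] (L : X →ₗ[ℂ] X)
    (k : ℕ) (μ : ℂ) : (L ^ k).ker ≤ (L ^ k).ker.comap (L - μ • 1) := by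
  intro x hx
  have hx' : (L ^ k) x = 0 := hx
  have h : (L ^ k) (L x) = 0 := by
    rw [← Module.End.mul_apply, ← pow_succ, pow_succ', Module.End.mul_apply, hx', map_zero]
  change (L ^ k) (L x - μ • x) = 0
  rw [map_sub, map_smul, h, hx', smul_zero, sub_zero]

theorem exists_isUnit_sub_smul {X : Type*} [NormedAddCommGroup X] [NormedSpace ℂ X]
    [CompleteSpace X] {B : X →L[ℂ] X} (hB : IsUnit B) :
    ∃ ε > 0, ∀ μ : ℂ, ‖μ‖ < ε → IsUnit (B - μ • 1) := by
  have hc : Continuous fun μ : ℂ ↦ B - μ • (1 : X →L[ℂ] X) := by fun_prop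
  obtain ⟨ε, hε, h⟩ := Metric.isOpen_iff.1 (Units.isOpen.preimage hc) 0
    (by simpa using hB)
  exact ⟨ε, hε, fun μ hμ ↦ h (by simpa using hμ)⟩

/-- If `B` is invertible modulo the finite-dimensional kernel of one of its powers, then
`0` is at most an isolated point of its spectrum. -/
theorem BijectiveMod.exists_isUnit_sub_smul {X : Type*} [NormedAddCommGroup X] [NormedSpace ℂ X]
    [CompleteSpace X] {B : X →L[ℂ] X} {k : ℕ} [FiniteDimensional ℂ ((B : X →ₗ[ℂ] X) ^ k).ker]
    (h : BijectiveMod (B : X →ₗ[ℂ] X) ((B : X →ₗ[ℂ] X) ^ k).ker) :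
    ∃ ε > 0, ∀ μ : ℂ, μ ≠ 0 → ‖μ‖ < ε → IsUnit (B - μ • 1) := by
  set L : X →ₗ[ℂ] X := B.toLinearMap
  set N := (L ^ k).ker
  have hNc : IsClosed (N : Set X) := N.closed_of_finiteDimensional
  have hinv : ∀ μ : ℂ, N ≤ N.comap (L - μ • 1) := ker_pow_le_comap_sub_smul L k
  obtain ⟨A, -, hbij⟩ := B.exists_quotient_map hNc (by simpa using hinv 0)
  obtain ⟨ε, hε, hu⟩ := _root_.exists_isUnit_sub_smul (B := A)
    (A.sub_zero_smul_one ▸ (hbij 0).1 (by simpa using h))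
  refine ⟨ε, hε, fun μ hμ hμε ↦ ?_⟩
  rw [ContinuousLinearMap.isUnit_iff_bijective]
  refine ((hbij μ).2 (hu μ hμε)).bijective (hinv μ) fun x hx hx0 ↦ ?_
  have hLx : L x = μ • x := sub_eq_zero.1 hx0
  have hpow : ∀ n : ℕ, (L ^ n) x = μ ^ n • x := by
    intro n
    induction n with
    | zero => simp
    | succ n ih => rw [pow_succ, Module.End.mul_apply, hLx, map_smul, ih, smul_smul, pow_succ']
  have hkx : μ ^ k • x = 0 := by rw [← hpow]; exact hx
  exact (smul_eq_zero.1 hkx).resolve_left (pow_ne_zero _ hμ)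

theorem finiteDimensional_ker_pow {X : Type*} [AddCommGroup X] [Module ℂ X] {L : X →ₗ[ℂ] X}
    [FiniteDimensional ℂ L.ker] (k : ℕ) : FiniteDimensional ℂ (L ^ k).ker := by
  induction k with
  | zero =>
    rw [pow_zero, Module.End.one_eq_id, LinearMap.ker_id]
    infer_instance
  | succ k ih =>
    rw [pow_succ, Module.End.mul_eq_comp, LinearMap.ker_comp]
    infer_instance

/-- The local dichotomy at a boundary point of the spectrum. -/
theorem hasAIHS1_or_chain_or_bijectiveMod {X : Type*} [NormedAddCommGroup X] [NormedSpace ℂ X]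
    [CompleteSpace X] {B : X →L[ℂ] X} (hlim : ∀ ε > 0, ∃ μ : ℂ, ‖μ‖ < ε ∧ IsUnit (B - μ • 1)) :
    HasAIHS1 B ∨ (∃ v : ℕ → X, v 0 ≠ 0 ∧ B (v 0) = 0 ∧ ∀ n, B (v (n + 1)) = v n) ∨
      ∃ k, FiniteDimensional ℂ ((B : X →ₗ[ℂ] X) ^ k).ker ∧
        BijectiveMod (B : X →ₗ[ℂ] X) ((B : X →ₗ[ℂ] X) ^ k).ker := by
  by_cases hfin : FiniteDimensional ℂ (B : X →ₗ[ℂ] X).ker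
  swap
  · exact .inl (hasAIHS1_of_infinite_eigenspace (lam := 0) hfin fun x hx ↦ by
      rw [zero_smul]
      exact hx)
  set L : X →ₗ[ℂ] X := B.toLinearMap
  by_cases hstrict : ∀ k, ∃ x, (L ^ (k + 1)) x = 0 ∧ (L ^ k) x ≠ 0
  · exact .inr (.inl (L.exists_backward_chain hstrict))
  push Not at hstrict
  obtain ⟨k, hk⟩ := hstrict
  have hNfin : FiniteDimensional ℂ (L ^ k).ker := finiteDimensional_ker_pow k
  by_cases hbij : BijectiveMod L (L ^ k).ker
  · exact .inr (.inr ⟨k, hNfin, hbij⟩)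
  left
  set N := (L ^ k).ker
  have hNc : IsClosed (N : Set X) := N.closed_of_finiteDimensional
  have hinv : ∀ μ : ℂ, N ≤ N.comap (L - μ • 1) := ker_pow_le_comap_sub_smul L k
  obtain ⟨A, hA, hiff⟩ := B.exists_quotient_map hNc (by simpa using hinv 0)
  refine HasAIHS1.of_surjective (π := N.mkQL) N.mkQ_surjective hA (hasAIHS1_of_injective ?_ ?_ ?_)
  · refine (injective_iff_map_eq_zero _).2 fun z hz ↦ ?_
    obtain ⟨x, rfl⟩ := N.mkQ_surjective z
    have hx : L x ∈ N := (Submodule.Quotient.mk_eq_zero _).1 ((hA x).symm.trans hz)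
    refine (Submodule.Quotient.mk_eq_zero _).2 (hk x ?_)
    rw [pow_succ]
    exact hx
  · intro hA1
    exact hbij (by simpa using (hiff 0).2 (A.sub_zero_smul_one.symm ▸ hA1))
  · intro ε hε
    obtain ⟨μ, hμ, hu⟩ := hlim ε hε
    refine ⟨μ, hμ, (hiff μ).1 ?_⟩
    refine (bijectiveMod_bot.2 ?_).mono bot_le (by simp) (hinv μ)
    exact ContinuousLinearMap.isUnit_iff_bijective.1 hu

theorem IsCompact.subset_frontier_of_countable {K : Set ℂ} (hK : IsCompact K)
    (hF : (frontier K).Countable) : K ⊆ frontier K := by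
  have hc : IsPreconnected (frontier K)ᶜ :=
    (hF.isConnected_compl_of_one_lt_rank (by simp [Complex.rank_real_complex])).isPreconnected
  intro x hx
  by_contra hxF
  have hsub : (frontier K)ᶜ ⊆ interior K := by
    refine hc.subset_left_of_subset_union isOpen_interior hK.isClosed.isOpen_compl
      (disjoint_compl_right.mono_left interior_subset) (fun y hy ↦ ?_) ⟨x, hxF, ?_⟩
    · by_cases hyK : y ∈ K
      · left
        rw [hK.isClosed.frontier_eq] at hy
        by_contra hyi
        exact hy ⟨hyK, hyi⟩
      · exact .inr hyK
    · rw [hK.isClosed.frontier_eq] at hxF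
      by_contra hxi
      exact hxF ⟨hx, hxi⟩
  refine hK.ne_univ (Set.eq_univ_of_forall fun y ↦ ?_)
  by_cases hy : y ∈ frontier K
  · exact hK.isClosed.frontier_subset hy
  · exact interior_subset (hsub hy)

theorem mem_spectrum_iff_smul_one_sub {X : Type*} [NormedAddCommGroup X] [NormedSpace ℂ X]
    {T : X →L[ℂ] X} {z : ℂ} : z ∈ spectrum ℂ T ↔ ¬IsUnit (z • 1 - T) := by
  rw [spectrum.mem_iff, Algebra.algebraMap_eq_smul_one]

/-- On an infinite-dimensional space, some boundary point of the spectrum is not a pole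
of finite rank of the resolvent. -/
theorem exists_frontier_not_bijectiveMod {X : Type*} [NormedAddCommGroup X] [NormedSpace ℂ X]
    [CompleteSpace X] (hX : ¬FiniteDimensional ℂ X) (T : X →L[ℂ] X) :
    ∃ lam ∈ frontier (spectrum ℂ T), ¬∃ k,
      FiniteDimensional ℂ ((lam • 1 - T : X →L[ℂ] X).toLinearMap ^ k).ker ∧
        BijectiveMod (lam • 1 - T : X →L[ℂ] X).toLinearMap
          ((lam • 1 - T : X →L[ℂ] X).toLinearMap ^ k).ker := by
  by_contra! hcon
  have hσ : IsCompact (spectrum ℂ T) := spectrum.isCompact T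
  have hFσ : frontier (spectrum ℂ T) ⊆ spectrum ℂ T := hσ.isClosed.frontier_subset
  have hfin : (frontier (spectrum ℂ T)).Finite := by
    by_contra hinf
    obtain ⟨lam, hlam, hacc⟩ := Set.Infinite.exists_accPt_of_subset_isCompact hinf
      (hσ.of_isClosed_subset isClosed_frontier hFσ) subset_rfl
    obtain ⟨k, _, hk⟩ := hcon lam hlam
    obtain ⟨ε, hε, hu⟩ := hk.exists_isUnit_sub_smul
    obtain ⟨z, ⟨hz, hzF⟩, hne⟩ := accPt_iff_nhds.1 hacc _ (Metric.ball_mem_nhds lam hε)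
    have := hu (lam - z) (sub_ne_zero.2 hne.symm) (by rwa [← dist_eq_norm, dist_comm])
    refine mem_spectrum_iff_smul_one_sub.1 (hFσ hzF) ?_
    convert this using 1
    module
  have hsub := hσ.subset_frontier_of_countable hfin.countable
  have : Finite (spectrum ℂ T) := (hfin.subset hsub).to_subtype
  choose k hkfin hk using fun lam : spectrum ℂ T ↦ hcon lam (hsub lam.2)
  let K : spectrum ℂ T → Submodule ℂ X := fun lam ↦
    ((lam.1 • 1 - T : X →L[ℂ] X).toLinearMap ^ k lam).ker
  have hKinv : ∀ (lam : spectrum ℂ T) (z : ℂ),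
      K lam ≤ (K lam).comap (z • 1 - T : X →L[ℂ] X).toLinearMap := by
    intro lam z
    have h := ker_pow_le_comap_sub_smul (lam.1 • 1 - T : X →L[ℂ] X).toLinearMap (k lam) (lam.1 - z)
    convert h using 2
    ext x
    simp [sub_smul]
  let N := ⨆ lam, K lam
  have hNfin : FiniteDimensional ℂ N := Submodule.finiteDimensional_iSup K
  have hNinv : ∀ z : ℂ, N ≤ N.comap (z • 1 - T : X →L[ℂ] X).toLinearMap := fun z ↦
    iSup_le fun lam ↦ (hKinv lam z).trans (Submodule.comap_mono (le_iSup K lam))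
  have hN : ∀ z : ℂ, BijectiveMod (z • 1 - T : X →L[ℂ] X).toLinearMap N := fun z ↦ by
    by_cases hz : z ∈ spectrum ℂ T
    · exact (hk ⟨z, hz⟩).mono (le_iSup K ⟨z, hz⟩) (hKinv ⟨z, hz⟩ z) (hNinv z)
    · rw [mem_spectrum_iff_smul_one_sub, not_not, ContinuousLinearMap.isUnit_iff_bijective] at hz
      exact (bijectiveMod_bot.2 hz).mono bot_le (by simp) (hNinv z)
  have hNc : IsClosed (N : Set X) := N.closed_of_finiteDimensional
  obtain ⟨A, -, hA⟩ := (-T).exists_quotient_map hNc (by simpa using hNinv 0)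
  have hNtop : N ≠ ⊤ := fun h ↦ hX (by
    rw [h] at hNfin
    exact Module.Finite.equiv Submodule.topEquiv)
  have : Nontrivial (X ⧸ N) := Submodule.Quotient.nontrivial_iff.2 hNtop
  obtain ⟨z, hz⟩ := spectrum.nonempty A
  refine mem_spectrum_iff_smul_one_sub.1 hz ?_
  rw [← neg_sub, IsUnit.neg_iff, ← hA]
  convert hN (-z) using 1
  ext x
  simp
  abel

theorem hasAIHS1_or_isCompressedShift {X : Type*} [NormedAddCommGroup X] [NormedSpace ℂ X]
    [CompleteSpace X] (hX : ¬FiniteDimensional ℂ X) (T : X →L[ℂ] X) :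
    HasAIHS1 T ∨ IsCompressedShift T := by
  obtain ⟨lam, hlam, hbij⟩ := exists_frontier_not_bijectiveMod hX T
  have hlim : ∀ ε > 0, ∃ μ : ℂ, ‖μ‖ < ε ∧ IsUnit (lam • 1 - T - μ • 1) := by
    intro ε hε
    rw [frontier_eq_closure_inter_closure] at hlam
    obtain ⟨z, hz, hd⟩ := Metric.mem_closure_iff.1 hlam.2 ε hε
    refine ⟨lam - z, by rwa [← dist_eq_norm], ?_⟩
    have hu : IsUnit (z • 1 - T) := not_not.1 (mt mem_spectrum_iff_smul_one_sub.2 hz)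
    convert hu using 1
    module
  obtain h | ⟨v, h0, hB, hv⟩ | h := hasAIHS1_or_chain_or_bijectiveMod hlim
  · exact .inl h.of_smul_one_sub
  · exact hasAIHS1_or_isCompressedShift_of_chain h0 hB hv
  · exact absurd h hbij

/-- Either `T` admits an AIHS of defect ≤ 1, or there are a finite-codimensional
closed subspace `V` with projection `P` onto `V`, an eigenvalue
`λ ∈ σ_p(T) ∩ σ_p(P T|_V)`, and a linearly independent sequence `(v_n) ⊆ V` whose
closed span is `V`, such that `S := λ - P T|_V` satisfies `S v_{n+1} = v_n`, `S v_1 = 0`. -/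
theorem aihs_or_backward_shift_structure
    {X : Type*} [NormedAddCommGroup X] [NormedSpace ℂ X] [CompleteSpace X]
    (hX : ¬FiniteDimensional ℂ X) (T : X →L[ℂ] X) :
    HasAIHS1 T ∨
    ∃ V : Submodule ℂ X, IsClosed (V : Set X) ∧ FiniteDimensional ℂ (X ⧸ V) ∧
      ∃ P : X →L[ℂ] X, (∀ x : X, P x ∈ V) ∧ (∀ v ∈ V, P v = v) ∧
        ∃ lam : ℂ,
          (∃ x : X, x ≠ 0 ∧ T x = lam • x) ∧
          (∃ w : ↥V, w ≠ 0 ∧ P (T (w : X)) = lam • (w : X)) ∧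
          ∃ S : ↥V →L[ℂ] ↥V,
            (∀ v : ↥V, (S v : X) = lam • (v : X) - P (T (v : X))) ∧
            ∃ v : ℕ → ↥V, LinearIndependent ℂ v ∧
              (Submodule.span ℂ (Set.range v)).topologicalClosure = ⊤ ∧
              S (v 0) = 0 ∧ (∀ n : ℕ, S (v (n + 1)) = v n) := by
  exact hasAIHS1_or_isCompressedShift hX T
end

section
/- Let X be an infinite-dimensional complex Banach space and T ∈ L(X). Then at least one of the following holds: (i) T admits an almost-invariant halfspace of defect ≤ 1; or (ii) there exists μ ∈ ℂ such that for every ε > 0 there exist a halfspace Y ⊆ X and a compact operator K̃ ∈ L(X) with ‖K̃‖ < ε such that (μ − T)y = K̃ y for all y ∈ Y. -/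
open Set Metric BoundedContinuousFunction

/-- Every operator on a nontrivial complex Banach space has an approximate eigenvalue. -/
theorem exists_forall_norm_smul_sub_lt {B : Type*} [NormedAddCommGroup B] [NormedSpace ℂ B]
    [CompleteSpace B] [Nontrivial B] (A : B →L[ℂ] B) :
    ∃ μ : ℂ, ∀ c : ℝ, 0 < c → ∃ x, ‖μ • x - A x‖ < c * ‖x‖ := by
  by_contra! hbelow
  have hclosed : IsClosed (resolventSet ℂ A) := by
    refine isClosed_of_closure_subset fun μ hμ => ?_
    obtain ⟨c, hc, hcμ⟩ := hbelow μ
    obtain ⟨ν, hν, hdist⟩ := Metric.mem_closure_iff.1 hμ (c / 2) (by positivity)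
    obtain ⟨u, hu⟩ : IsUnit (algebraMap ℂ (B →L[ℂ] B) ν - A) := hν
    have hinv : ‖(↑u⁻¹ : B →L[ℂ] B)‖ ≤ 2 / c := by
      refine ContinuousLinearMap.opNorm_le_bound _ (by positivity) fun x => ?_
      set y := (↑u⁻¹ : B →L[ℂ] B) x with hy
      have hx : x = ν • y - A y := by
        have h1 : ((u : B →L[ℂ] B) * (↑u⁻¹ : B →L[ℂ] B)) x = x := by simp
        rw [hu] at h1
        simpa [Algebra.algebraMap_eq_smul_one, ← hy] using h1.symm
      have h2 : μ • y - A y = x + (μ - ν) • y := by rw [hx, sub_smul]; abel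
      have h3 : ‖(μ - ν) • y‖ ≤ c / 2 * ‖y‖ := by
        rw [norm_smul, ← dist_eq_norm]
        gcongr
      have h4 := hcμ y
      rw [h2] at h4
      have h5 := norm_add_le x ((μ - ν) • y)
      rw [div_mul_eq_mul_div, le_div_iff₀ hc]
      linarith
    have hpos : 0 < ‖(↑u⁻¹ : B →L[ℂ] B)‖ := Units.norm_pos _
    have hnear : ‖(algebraMap ℂ (B →L[ℂ] B) μ - A) - u‖ < ‖(↑u⁻¹ : B →L[ℂ] B)‖⁻¹ := by
      have h1 : (algebraMap ℂ (B →L[ℂ] B) μ - A) - u = algebraMap ℂ (B →L[ℂ] B) (μ - ν) := by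
        rw [hu, map_sub]; abel
      rw [h1, norm_algebraMap', ← dist_eq_norm]
      refine hdist.trans_le ?_
      rw [le_inv_comm₀ (by positivity) hpos]
      simpa using hinv
    exact ⟨u.ofNearby _ hnear, rfl⟩
  rcases isClopen_iff.1 ⟨hclosed, spectrum.isOpen_resolventSet A⟩ with h | h
  · have h1 : spectrum ℂ A = univ := by rw [spectrum, h, compl_empty]
    exact noncompact_univ ℂ (h1 ▸ spectrum.isCompact A)
  · have h1 : spectrum ℂ A = ∅ := by rw [spectrum, h, compl_univ]
    exact (spectrum.nonempty A).ne_empty h1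

section FiniteRange

variable {X : Type*} [NormedAddCommGroup X] [NormedSpace ℂ X]

variable (X) in
/-- The sequences taking finitely many values. -/
noncomputable def finiteRangeSeq : Submodule ℂ (ℕ →ᵇ X) where
  carrier := {u | (range u).Finite}
  add_mem' {u v} hu hv := (hu.add hv).subset <| by
    rintro _ ⟨n, rfl⟩
    exact add_mem_add ⟨n, rfl⟩ ⟨n, rfl⟩
  zero_mem' := (finite_singleton 0).subset <| by
    rintro _ ⟨n, rfl⟩
    rfl
  smul_mem' a u hu := (hu.image (a • ·)).subset <| by
    rintro _ ⟨n, rfl⟩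
    exact ⟨u n, ⟨n, rfl⟩, rfl⟩

variable (X) in
/-- The closed subspace of uniform limits of sequences taking finitely many values, that is, of
sequences with totally bounded range. -/
noncomputable def totallyBoundedSeq : Submodule ℂ (ℕ →ᵇ X) := (finiteRangeSeq X).topologicalClosure

instance : IsClosed (totallyBoundedSeq X : Set (ℕ →ᵇ X)) :=
  Submodule.isClosed_topologicalClosure _

theorem mem_totallyBoundedSeq_iff {u : ℕ →ᵇ X} :
    u ∈ totallyBoundedSeq X ↔ ∀ ε > 0, ∃ v ∈ finiteRangeSeq X, ‖u - v‖ < ε := by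
  simp only [← dist_eq_norm]
  exact Metric.mem_closure_iff

theorem TotallyBounded.mem_totallyBoundedSeq {u : ℕ →ᵇ X} (hu : TotallyBounded (range u)) :
    u ∈ totallyBoundedSeq X := by
  refine mem_totallyBoundedSeq_iff.2 fun ε hε => ?_
  obtain ⟨t, ht, htu⟩ := Metric.totallyBounded_iff.1 hu (ε / 2) (by positivity)
  have h : ∀ n, ∃ y ∈ t, dist (u n) y < ε / 2 := fun n => by
    simpa using htu (mem_range_self n)
  choose g hgt hg using h
  have hfin : (range g).Finite := ht.subset (range_subset_iff.2 hgt)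
  obtain ⟨C, hC⟩ := isBounded_iff.1 hfin.isBounded
  refine ⟨.mkOfDiscrete g C fun m n => hC ⟨m, rfl⟩ ⟨n, rfl⟩, hfin, ?_⟩
  refine lt_of_le_of_lt ((BoundedContinuousFunction.norm_le (by positivity)).2 fun n => ?_)
    (half_lt_self hε)
  simpa [dist_eq_norm] using (hg n).le

theorem comp_mem_totallyBoundedSeq (S : X →L[ℂ] X) {u : ℕ →ᵇ X} (hu : u ∈ totallyBoundedSeq X) :
    S.compLeftContinuousBounded ℕ u ∈ totallyBoundedSeq X := by
  refine (finiteRangeSeq X).topologicalClosure_minimal (t := (totallyBoundedSeq X).comap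
    (S.compLeftContinuousBounded ℕ : (ℕ →ᵇ X) →ₗ[ℂ] (ℕ →ᵇ X))) (fun v hv => ?_) ?_ hu
  · refine (finiteRangeSeq X).le_topologicalClosure ?_
    refine (Set.Finite.image S (show (range v).Finite from hv)).subset ?_
    rintro _ ⟨n, rfl⟩
    exact ⟨v n, ⟨n, rfl⟩, rfl⟩
  · exact (Submodule.isClosed_topologicalClosure _).preimage
      (S.compLeftContinuousBounded ℕ).continuous

theorem nontrivial_quotient_totallyBoundedSeq (hX : ¬FiniteDimensional ℂ X) :
    Nontrivial ((ℕ →ᵇ X) ⧸ totallyBoundedSeq X) := by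
  rw [Submodule.Quotient.nontrivial_iff]
  intro htop
  obtain ⟨R, f, -, hR, hf⟩ := exists_seq_norm_le_one_le_norm_sub (𝕜 := ℂ) hX
  let u : ℕ →ᵇ X := .ofNormedAddCommGroupDiscrete f R hR
  have hu : u ∈ totallyBoundedSeq X := htop ▸ Submodule.mem_top
  obtain ⟨v, hv, huv⟩ := mem_totallyBoundedSeq_iff.1 hu (1 / 2) (by norm_num)
  have hfin : (range v).Finite := hv
  obtain ⟨m, n, hmn, hvmn⟩ : ∃ m n, m ≠ n ∧ v m = v n := by
    by_contra! h
    exact infinite_range_of_injective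
      (fun m n hmn => by_contra fun hne => h m n hne hmn) hfin
  have h1 := (u - v).norm_coe_le_norm m
  have h2 := (u - v).norm_coe_le_norm n
  have h3 : f m - f n = (u - v) m - (u - v) n := by
    simp [u, hvmn]
  have h4 := norm_sub_le ((u - v) m) ((u - v) n)
  have h5 := hf hmn
  simp only [h3] at h5
  linarith

theorem norm_mk_le_of_forall_norm_sub_le (S : X →L[ℂ] X) {c : ℝ} (hc : 0 < c) (u : ℕ →ᵇ X)
    (hu : ∀ m n, c * ‖u m - u n‖ ≤ ‖S (u m - u n)‖) :
    c / 2 * ‖(totallyBoundedSeq X).mkQ u‖ ≤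
      ‖(totallyBoundedSeq X).mkQ (S.compLeftContinuousBounded ℕ u)‖ := by
  refine le_of_forall_pos_lt_add fun ε hε => ?_
  set η := ‖(totallyBoundedSeq X).mkQ (S.compLeftContinuousBounded ℕ u)‖ + ε / 2 with hη
  have hη0 : 0 < η := by positivity
  obtain ⟨z, hz, hzη⟩ := Submodule.Quotient.norm_mk_lt
    ((totallyBoundedSeq X).mkQ (S.compLeftContinuousBounded ℕ u)) (half_pos hε)
  have hy : S.compLeftContinuousBounded ℕ u - z ∈ totallyBoundedSeq X :=
    (Submodule.Quotient.eq _).1 hz.symm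
  obtain ⟨v, hv, hvz⟩ := mem_totallyBoundedSeq_iff.1 hy (η - ‖z‖) (sub_pos.2 hzη)
  have hvS : ‖S.compLeftContinuousBounded ℕ u - v‖ < η := by
    have h1 := norm_add_le z (S.compLeftContinuousBounded ℕ u - z - v)
    have h2 : z + (S.compLeftContinuousBounded ℕ u - z - v) =
      S.compLeftContinuousBounded ℕ u - v := by abel
    rw [h2] at h1
    linarith
  have hvS' : ∀ n, ‖S (u n) - v n‖ < η := fun n =>
    ((S.compLeftContinuousBounded ℕ u - v).norm_coe_le_norm n).trans_lt hvS
  let rep : X → ℕ := Function.invFun v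
  have hrep : ∀ n, v (rep (v n)) = v n := fun n => Function.invFun_eq ⟨n, rfl⟩
  have hfin : (range fun n => u (rep (v n))).Finite := by
    refine (Set.Finite.image (u ∘ rep) (show (range v).Finite from hv)).subset ?_
    rintro _ ⟨n, rfl⟩
    exact ⟨v n, ⟨n, rfl⟩, rfl⟩
  let w : ℕ →ᵇ X := .ofNormedAddCommGroupDiscrete (fun n => u (rep (v n))) ‖u‖
    fun n => u.norm_coe_le_norm _
  have hw : w ∈ totallyBoundedSeq X :=
    (finiteRangeSeq X).le_topologicalClosure hfin
  have huw : ‖u - w‖ ≤ 2 * η / c := by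
    refine (BoundedContinuousFunction.norm_le (by positivity)).2 fun n => ?_
    rw [le_div_iff₀' hc]
    refine (hu n (rep (v n))).trans ?_
    have h1 : S (u n - u (rep (v n))) =
        (S (u n) - v n) - (S (u (rep (v n))) - v (rep (v n))) := by
      rw [map_sub, hrep]; abel
    rw [h1]
    refine (norm_sub_le _ _).trans ?_
    linarith [hvS' n, hvS' (rep (v n))]
  have hmk : (totallyBoundedSeq X).mkQ u = (totallyBoundedSeq X).mkQ (u - w) := by
    refine (Submodule.Quotient.eq _).2 ?_
    rwa [sub_sub_cancel]
  have hle : ‖(totallyBoundedSeq X).mkQ u‖ ≤ 2 * η / c := by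
    rw [hmk]
    exact (Submodule.Quotient.norm_mk_le _ _).trans huw
  calc c / 2 * ‖(totallyBoundedSeq X).mkQ u‖ ≤ c / 2 * (2 * η / c) := by gcongr
    _ = η := by field_simp
    _ < _ := by rw [hη]; linarith

theorem totallyBounded_range_comp (P : X →L[ℂ] X) [FiniteDimensional ℂ P.range] (u : ℕ →ᵇ X) :
    TotallyBounded (range (P.compLeftContinuousBounded ℕ u)) := by
  have hP : IsCompactOperator P := by
    have : LocallyCompactSpace P.range := by
      have := FiniteDimensional.proper ℂ P.range
      infer_instance
    have h : IsCompactOperator (P.codRestrict P.range fun x => ⟨x, rfl⟩) :=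
      isCompactOperator_of_locallyCompactSpace_dom _
    exact h.clm_comp P.range.subtypeL
  refine ((hP.isCompact_closure_image_of_bounded u.isBounded_range).totallyBounded).subset ?_
  refine subset_trans ?_ subset_closure
  rintro _ ⟨n, rfl⟩
  exact ⟨u n, ⟨n, rfl⟩, rfl⟩

/-- An operator which is bounded below on the range of a projection of finite corank is bounded
below modulo the totally bounded sequences. -/
theorem norm_mk_le_of_finiteDimensional (S R : X →L[ℂ] X)
    [FiniteDimensional ℂ (ContinuousLinearMap.id ℂ X - R).range] {c : ℝ} (hc : 0 < c)
    (hR : ∀ x, c * ‖R x‖ ≤ ‖S (R x)‖) (u : ℕ →ᵇ X) :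
    c / 2 * ‖(totallyBoundedSeq X).mkQ u‖ ≤
      ‖(totallyBoundedSeq X).mkQ (S.compLeftContinuousBounded ℕ u)‖ := by
  have hmem := (totallyBounded_range_comp (ContinuousLinearMap.id ℂ X - R)
    u).mem_totallyBoundedSeq
  have h1 : (totallyBoundedSeq X).mkQ u =
      (totallyBoundedSeq X).mkQ (R.compLeftContinuousBounded ℕ u) := by
    refine (Submodule.Quotient.eq _).2 ?_
    convert hmem using 1
    ext n
    simp
  have h2 : (totallyBoundedSeq X).mkQ (S.compLeftContinuousBounded ℕ u) =
      (totallyBoundedSeq X).mkQ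
        (S.compLeftContinuousBounded ℕ (R.compLeftContinuousBounded ℕ u)) := by
    refine (Submodule.Quotient.eq _).2 ?_
    convert comp_mem_totallyBoundedSeq S hmem using 1
    ext n
    simp
  rw [h1, h2]
  refine norm_mk_le_of_forall_norm_sub_le S hc _ fun m n => ?_
  simpa using hR (u m - u n)

end FiniteRange

theorem exists_forall_mem_ker_norm_smul_sub_lt.{u, v} {X : Type u} [NormedAddCommGroup X]
    [NormedSpace ℂ X] [CompleteSpace X] (hX : ¬FiniteDimensional ℂ X) (T : X →L[ℂ] X) :
    ∃ μ : ℂ, ∀ (W : Type v) [NormedAddCommGroup W] [NormedSpace ℂ W] [FiniteDimensional ℂ W]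
      (L : X →L[ℂ] W) (c : ℝ), 0 < c → ∃ x, L x = 0 ∧ ‖μ • x - T x‖ < c * ‖x‖ := by
  have := nontrivial_quotient_totallyBoundedSeq hX
  let A : ((ℕ →ᵇ X) ⧸ totallyBoundedSeq X) →L[ℂ] ((ℕ →ᵇ X) ⧸ totallyBoundedSeq X) :=
    (totallyBoundedSeq X).liftQL
      ((totallyBoundedSeq X).mkQL.comp (T.compLeftContinuousBounded ℕ)) fun u hu =>
        (Submodule.Quotient.mk_eq_zero _).2 (comp_mem_totallyBoundedSeq T hu)
  obtain ⟨μ, hμ⟩ := exists_forall_norm_smul_sub_lt A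
  refine ⟨μ, fun W _ _ _ L c hc => ?_⟩
  by_contra! hbelow
  obtain ⟨R, hR⟩ := L.ker_closedComplemented_of_finiteDimensional_range
  let R' : X →L[ℂ] X := L.ker.subtypeL.comp R
  have hLR : ∀ x, L (R' x) = 0 := fun x => (R x).2
  have hker : L.ker ≤ (ContinuousLinearMap.id ℂ X - R').ker := fun x hx => by
    have := hR ⟨x, hx⟩
    simp [R', this]
  have : FiniteDimensional ℂ (X ⧸ L.ker) := L.toLinearMap.quotKerEquivRange.symm.finiteDimensional
  have : FiniteDimensional ℂ (ContinuousLinearMap.id ℂ X - R').range := by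
    have h := Submodule.range_liftQ L.ker (ContinuousLinearMap.id ℂ X - R').toLinearMap hker
    rw [← h]
    infer_instance
  obtain ⟨q, hq⟩ := hμ (c / 2) (by positivity)
  obtain ⟨u, rfl⟩ := (totallyBoundedSeq X).mkQ_surjective q
  refine hq.not_ge ?_
  have h := norm_mk_le_of_finiteDimensional (μ • ContinuousLinearMap.id ℂ X - T) R' hc
    (fun x => by simpa using hbelow (R' x) (hLR x)) u
  have heq : μ • (totallyBoundedSeq X).mkQ u - A ((totallyBoundedSeq X).mkQ u) =
      (totallyBoundedSeq X).mkQ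
        ((μ • ContinuousLinearMap.id ℂ X - T).compLeftContinuousBounded ℕ u) := by
    change (totallyBoundedSeq X).mkQ (μ • u - T.compLeftContinuousBounded ℕ u) = _
    congr 1
  rwa [heq]

theorem not_finiteDimensional_of_biorthogonal_s13 {K V : Type*} [Field K] [AddCommGroup V] [Module K V]
    (v : ℕ → V) (φ : ℕ → Module.Dual K V) (h1 : ∀ n, φ n (v n) = 1)
    (h0 : Pairwise fun m n => φ m (v n) = 0) : ¬FiniteDimensional K V := fun _ =>
  not_finite_iff_infinite.2 inferInstance
    (LinearIndependent.of_pairwise_dual_eq_zero_one v φ h0 h1).finite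

theorem isHalfspace_topologicalClosure_span {X : Type*} [NormedAddCommGroup X] [NormedSpace ℂ X]
    (x : ℕ → X) (f : ℕ → X →L[ℂ] ℂ) (h1 : ∀ n, f n (x n) = 1)
    (h0 : Pairwise fun m n => f m (x n) = 0) :
    IsHalfspace (Submodule.span ℂ (range fun n => x (2 * n))).topologicalClosure := by
  set Y := (Submodule.span ℂ (range fun n => x (2 * n))).topologicalClosure with hY
  have hx : ∀ n, x (2 * n) ∈ Y := fun n =>
    Submodule.le_topologicalClosure _ (Submodule.subset_span ⟨n, rfl⟩)
  have hker : ∀ n, Y ≤ (f (2 * n + 1)).ker := fun n => by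
    refine Submodule.topologicalClosure_minimal _ (Submodule.span_le.2 ?_)
      (f (2 * n + 1)).isClosed_ker
    rintro _ ⟨m, rfl⟩
    exact h0 (by omega)
  refine ⟨Submodule.isClosed_topologicalClosure _, ?_, ?_⟩
  · exact not_finiteDimensional_of_biorthogonal_s13 (fun n => (⟨x (2 * n), hx n⟩ : Y))
      (fun n => (f (2 * n)).toLinearMap ∘ₗ Y.subtype) (fun n => h1 _)
      fun m n hmn => h0 (by omega)
  · exact not_finiteDimensional_of_biorthogonal_s13 (fun n => Y.mkQ (x (2 * n + 1)))
      (fun n => Y.liftQ (f (2 * n + 1)).toLinearMap (hker n)) (fun n => h1 _)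
      fun m n hmn => h0 (by omega)

/-- If `S` is not bounded below on any closed subspace of finite codimension, then there is a
biorthogonal system on which `S` is as small as desired. -/
theorem exists_biorthogonal_norm_mul_norm_le.{u} {X : Type u} [NormedAddCommGroup X]
    [NormedSpace ℂ X] (S : X →L[ℂ] X)
    (hS : ∀ (W : Type u) [NormedAddCommGroup W] [NormedSpace ℂ W] [FiniteDimensional ℂ W]
      (L : X →L[ℂ] W) (c : ℝ), 0 < c → ∃ x, L x = 0 ∧ ‖S x‖ < c * ‖x‖) {ε : ℝ} (hε : 0 < ε) :
    ∃ (x : ℕ → X) (f : ℕ → X →L[ℂ] ℂ), (∀ n, f n (x n) = 1) ∧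
      (Pairwise fun m n => f m (x n) = 0) ∧ ∀ n, ‖f n‖ * ‖S (x n)‖ ≤ ε * (1 / 2) ^ n := by
  obtain ⟨a, ha, hlt⟩ := exists_seq_of_forall_finset_exists
    (fun a : X × (X →L[ℂ] ℂ) × ℕ =>
      a.2.1 a.1 = 1 ∧ ‖a.2.1‖ * ‖S a.1‖ ≤ ε * (1 / 2) ^ a.2.2)
    (fun a b => a.2.1 b.1 = 0 ∧ b.2.1 a.1 = 0 ∧ a.2.2 < b.2.2) fun s _ => by
      classical
      let V : Submodule ℂ X := Submodule.span ℂ (s.image Prod.fst : Finset X)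
      obtain ⟨Q, hQ⟩ := Submodule.ClosedComplemented.of_finiteDimensional V
      let P : X →L[ℂ] X := ContinuousLinearMap.id ℂ X - V.subtypeL.comp Q
      let k := s.sup (fun a => a.2.2) + 1
      let L : X →L[ℂ] V × (s → ℂ) := Q.prod (ContinuousLinearMap.pi fun a => a.1.2.1)
      obtain ⟨x, hLx, hSx⟩ := hS _ L (ε * (1 / 2) ^ k / (‖P‖ + 1)) (by positivity)
      have hx : 0 < ‖x‖ := by
        by_contra! h
        have h0 : x = 0 := norm_le_zero_iff.1 h
        simp [h0] at hSx
      have hQx : Q x = 0 := congrArg Prod.fst hLx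
      have hsx : ∀ a ∈ s, a.2.1 x = 0 := fun a ha => congrFun (congrArg Prod.snd hLx) ⟨a, ha⟩
      obtain ⟨g, hg, hgx⟩ := exists_dual_vector ℂ x hx.ne'
      refine ⟨(x, (‖x‖⁻¹ : ℂ) • g.comp P, k), ⟨?_, ?_⟩, fun b hb => ⟨hsx b hb, ?_, ?_⟩⟩
      · have : (‖x‖ : ℂ) ≠ 0 := by exact_mod_cast hx.ne'
        simp [P, hQx, hgx, this]
      · have h1 : ‖(‖x‖⁻¹ : ℂ) • g.comp P‖ ≤ ‖x‖⁻¹ * (‖P‖ + 1) := by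
          rw [norm_smul]
          have := g.opNorm_comp_le P
          rw [hg, one_mul] at this
          simp only [norm_inv, Complex.norm_real, norm_norm]
          gcongr
          linarith
        calc ‖(‖x‖⁻¹ : ℂ) • g.comp P‖ * ‖S x‖
            ≤ (‖x‖⁻¹ * (‖P‖ + 1)) * (ε * (1 / 2) ^ k / (‖P‖ + 1) * ‖x‖) := by gcongr
          _ = ε * (1 / 2) ^ k := by field_simp
      · have hbV : b.1 ∈ V := Submodule.subset_span (by
          simpa using ⟨b.2.1, b.2.2, hb⟩)
        have := hQ ⟨b.1, hbV⟩
        simp only at this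
        simp [P, this]
      · exact Nat.lt_succ_of_le (Finset.le_sup (f := fun a : X × (X →L[ℂ] ℂ) × ℕ => a.2.2) hb)
  have hmono : StrictMono fun n => (a n).2.2 := fun m n hmn => (hlt m n hmn).2.2
  refine ⟨fun n => (a n).1, fun n => (a n).2.1, fun n => (ha n).1, fun m n hmn => ?_, fun n => ?_⟩
  · rcases hmn.lt_or_gt with h | h
    · exact (hlt m n h).1
    · exact (hlt n m h).2.1
  · refine (ha n).2.trans ?_
    gcongr ε * ?_
    exact pow_le_pow_of_le_one (by norm_num) (by norm_num) (hmono.le_apply)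

theorem exists_isHalfspace_eq_compact.{u} {X : Type u} [NormedAddCommGroup X] [NormedSpace ℂ X]
    [CompleteSpace X] (S : X →L[ℂ] X)
    (hS : ∀ (W : Type u) [NormedAddCommGroup W] [NormedSpace ℂ W] [FiniteDimensional ℂ W]
      (L : X →L[ℂ] W) (c : ℝ), 0 < c → ∃ x, L x = 0 ∧ ‖S x‖ < c * ‖x‖) {ε : ℝ} (hε : 0 < ε) :
    ∃ Y : Submodule ℂ X, IsHalfspace Y ∧
      ∃ K : X →L[ℂ] X, IsCompactOperator ⇑K ∧ ‖K‖ < ε ∧ ∀ y ∈ Y, S y = K y := by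
  obtain ⟨x, f, h1, h0, hle⟩ :=
    exists_biorthogonal_norm_mul_norm_le S hS (show 0 < ε / 4 by positivity)
  let F : ℕ → X →L[ℂ] X := fun n => (f n).smulRight (S (x n))
  have hF : ∀ n, ‖F n‖ ≤ ε / 4 * (1 / 2) ^ n := fun n => by
    simpa [F, ContinuousLinearMap.norm_smulRight_apply] using hle n
  have hgeom : HasSum (fun n : ℕ => ε / 4 * (1 / 2 : ℝ) ^ n) (ε / 4 * 2) :=
    hasSum_geometric_two.mul_left _
  have hsum : Summable F := Summable.of_norm_bounded hgeom.summable hF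
  have hKx : ∀ m, (∑' n, F n) (x m) = S (x m) := fun m => by
    have h2 : HasSum (fun n => F n (x m)) ((∑' n, F n) (x m)) := by
      simpa only [ContinuousLinearMap.apply_apply] using
        hsum.hasSum.mapL (ContinuousLinearMap.apply ℂ X (x m))
    have h3 : HasSum (fun n => F n (x m)) (F m (x m)) :=
      hasSum_single m fun n hn => by simp [F, h0 hn]
    rw [h2.unique h3]
    simp [F, h1]
  refine ⟨_, isHalfspace_topologicalClosure_span x f h1 h0, ∑' n, F n, ?_, ?_, ?_⟩
  · refine isCompactOperator_of_tendsto hsum.hasSum (Filter.Eventually.of_forall fun s => ?_)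
    refine (compactOperator (RingHom.id ℂ) X X).sum_mem fun n _ => ?_
    have h : IsCompactOperator (f n) := isCompactOperator_of_locallyCompactSpace_dom _
    exact h.clm_comp (ContinuousLinearMap.toSpanSingleton ℂ (S (x n)))
  · refine (tsum_of_norm_bounded hgeom hF).trans_lt ?_
    linarith
  · have hle : (Submodule.span ℂ (range fun n => x (2 * n))).topologicalClosure ≤
        (S - ∑' n, F n).ker := by
      refine Submodule.topologicalClosure_minimal _ (Submodule.span_le.2 ?_)
        (S - ∑' n, F n).isClosed_ker
      rintro _ ⟨n, rfl⟩
      exact sub_eq_zero.2 (hKx _).symm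
    exact fun y hy => sub_eq_zero.1 (hle hy)

/-- Either `T` admits an AIHS of defect ≤ 1, or there is `μ ∈ ℂ` such that for each
`ε > 0` there are a halfspace `Y` and a compact operator `K̃` of norm `< ε` with
`(μ - T) y = K̃ y` for all `y ∈ Y`. -/
theorem aihs_or_compact_restriction
    {X : Type*} [NormedAddCommGroup X] [NormedSpace ℂ X] [CompleteSpace X]
    (hX : ¬FiniteDimensional ℂ X) (T : X →L[ℂ] X) :
    HasAIHS1 T ∨
    ∃ μ : ℂ, ∀ ε : ℝ, 0 < ε →
      ∃ Y : Submodule ℂ X, IsHalfspace Y ∧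
        ∃ K : X →L[ℂ] X, IsCompactOperator ⇑K ∧ ‖K‖ < ε ∧
          ∀ y ∈ Y, μ • y - T y = K y := by
  obtain ⟨μ, hμ⟩ := exists_forall_mem_ker_norm_smul_sub_lt hX T
  exact Or.inr ⟨μ, fun ε hε => exists_isHalfspace_eq_compact (μ • ContinuousLinearMap.id ℂ X - T)
    hμ hε⟩
end
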